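/- Every C₃-free 3-planar finite simple graph on n ≥ 2 vertices and m edges satisfies m ≤ (2673/20)^{1/3}·n; in particular m < 5.113·n. -/

import Mathlib

open unitInterval

/-- A (good) drawing of a simple graph in the plane: vertices map to distinct
points, each edge is drawn as a simple continuous arc between its endpoints,
arcs avoid vertex points other than their endpoints, two arcs meet in finitely
many points, and no three arcs pass through a common interior point. -/
structure PlaneDrawing {V : Type*} (G : SimpleGraph V) where
  pos : V → ℝ × ℝ
  pos_inj : Function.Injective pos
  arc : ∀ ⦃u v : V⦄, G.Adj u v → Path (pos u) (pos v)
  arc_symm : ∀ ⦃u v : V⦄ (h : G.Adj u v), arc h.symm = (arc h).symm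
  arc_inj : ∀ ⦃u v : V⦄ (h : G.Adj u v), Function.Injective (arc h)
  no_vertex_mem : ∀ ⦃u v : V⦄ (h : G.Adj u v) (w : V) (t : I),
      arc h t = pos w → w = u ∨ w = v
  finite_inter : ∀ ⦃u v x y : V⦄ (h₁ : G.Adj u v) (h₂ : G.Adj x y),
      s(u, v) ≠ s(x, y) →
      (Set.range (arc h₁) ∩ Set.range (arc h₂)).Finite
  no_triple_point : ∀ ⦃u₁ v₁ u₂ v₂ u₃ v₃ : V⦄
      (h₁ : G.Adj u₁ v₁) (h₂ : G.Adj u₂ v₂) (h₃ : G.Adj u₃ v₃),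
      s(u₁, v₁) ≠ s(u₂, v₂) → s(u₁, v₁) ≠ s(u₃, v₃) → s(u₂, v₂) ≠ s(u₃, v₃) →
      ∀ t₁ t₂ t₃ : I, t₁ ≠ 0 → t₁ ≠ 1 → t₂ ≠ 0 → t₂ ≠ 1 → t₃ ≠ 0 → t₃ ≠ 1 →
      arc h₁ t₁ = arc h₂ t₂ → arc h₂ t₂ = arc h₃ t₃ → False

namespace PlaneDrawing

variable {V : Type*} {G : SimpleGraph V} (D : PlaneDrawing G)

/-- `p` is an interior point of the arc of the edge `uv`. -/
def IsInteriorPoint {u v : V} (h : G.Adj u v) (p : ℝ × ℝ) : Prop :=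
  ∃ t : I, t ≠ 0 ∧ t ≠ 1 ∧ D.arc h t = p

/-- The set of crossing points of the drawing: points where the interiors of
the arcs of two distinct edges meet. -/
def crossings : Set (ℝ × ℝ) :=
  {p | ∃ (u v x y : V) (h₁ : G.Adj u v) (h₂ : G.Adj x y),
    s(u, v) ≠ s(x, y) ∧ D.IsInteriorPoint h₁ p ∧ D.IsInteriorPoint h₂ p}

/-- The number of crossings of the drawing. -/
noncomputable def crossingCount : ℕ := D.crossings.ncard

/-- The set of crossing points lying on the edge `uv`. -/
def edgeCrossings {u v : V} (h : G.Adj u v) : Set (ℝ × ℝ) :=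
  {p | D.IsInteriorPoint h p ∧
    ∃ (x y : V) (h₂ : G.Adj x y), s(u, v) ≠ s(x, y) ∧ D.IsInteriorPoint h₂ p}

/-- A drawing is `k`-plane if every edge is involved in at most `k` crossings. -/
def IsKPlane (k : ℕ) : Prop :=
  ∀ ⦃u v : V⦄ (h : G.Adj u v), (D.edgeCrossings h).ncard ≤ k

end PlaneDrawing

/-- The crossing number of a graph: the minimum number of crossings over all
drawings. -/
noncomputable def crossingNumber {V : Type*} (G : SimpleGraph V) : ℕ :=
  sInf {c : ℕ | ∃ D : PlaneDrawing G, D.crossingCount = c}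

/-- A graph is `k`-planar if it admits a drawing in which every edge is
involved in at most `k` crossings. -/
def KPlanar {V : Type*} (G : SimpleGraph V) (k : ℕ) : Prop :=
  ∃ D : PlaneDrawing G, D.IsKPlane k

/-- `G` has no cycle of length `ℓ`. -/
def HasNoCycleOfLength {V : Type*} (G : SimpleGraph V) (ℓ : ℕ) : Prop :=
  ∀ (v : V) (c : G.Walk v v), c.IsCycle → c.length ≠ ℓ

open Set

/-- The variation of the argument of `f` along `[a, b]`. -/
noncomputable def argVar (f : ℝ → ℂ) (a b : ℝ) : ℝ :=
  open Classical in
  if h : ∃ g : ℝ → ℂ, ContinuousOn g (Icc a b) ∧ ∀ x ∈ Icc a b, Complex.exp (g x) = f x then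
    (h.choose b - h.choose a).im
  else 0

theorem argVar_eq {f g : ℝ → ℂ} {a b : ℝ} (hab : a ≤ b) (hg : ContinuousOn g (Icc a b))
    (hfg : ∀ x ∈ Icc a b, Complex.exp (g x) = f x) :
    argVar f a b = (g b - g a).im := by
  have h : ∃ g : ℝ → ℂ, ContinuousOn g (Icc a b) ∧ ∀ x ∈ Icc a b, Complex.exp (g x) = f x :=
    ⟨g, hg, hfg⟩
  rw [argVar, dif_pos h]
  obtain ⟨hc, he⟩ := h.choose_spec
  set k := h.choose
  have hcont : ContinuousOn (fun x => (k x - g x).im / (2 * Real.pi)) (Icc a b) := by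
    have : ContinuousOn (fun x => (k x - g x)) (Icc a b) := hc.sub hg
    exact (Complex.continuous_im.comp_continuousOn this).div_const _
  have hInt : ∀ x ∈ Icc a b, ∃ n : ℤ, (k x - g x).im / (2 * Real.pi) = n := by
    intro x hx
    have h1 : Complex.exp (k x) = Complex.exp (g x) := by rw [he x hx, hfg x hx]
    obtain ⟨n, hn⟩ := Complex.exp_eq_exp_iff_exists_int.1 h1
    refine ⟨n, ?_⟩
    rw [hn]
    have : (g x + n * (2 * Real.pi * Complex.I) - g x).im = n * (2 * Real.pi) := by
      simp
    rw [this]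
    field_simp
  have hmaps : MapsTo (fun x => (k x - g x).im / (2 * Real.pi)) (Icc a b)
      (range ((↑) : ℤ → ℝ)) := by
    intro x hx
    obtain ⟨n, hn⟩ := hInt x hx
    exact ⟨n, hn.symm⟩
  have hdisc : IsDiscrete (range ((↑) : ℤ → ℝ)) := by
    exact Int.isClosedEmbedding_coe_real.isEmbedding.isInducing.isDiscrete_range
  have := isPreconnected_Icc.constant_of_mapsTo hdisc hcont hmaps
    (left_mem_Icc.2 hab) (right_mem_Icc.2 hab)
  have h2 : (k a - g a).im = (k b - g b).im := by
    have hpi : (2 * Real.pi) ≠ 0 := by positivity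
    field_simp at this
    exact this
  simp only [Complex.sub_im] at h2 ⊢
  linarith

theorem exists_log_prod {F : ℝ × ℝ → ℂ} (hF : Continuous F) (h0 : ∀ x, F x ≠ 0) :
    ∃ g : ℝ × ℝ → ℂ, Continuous g ∧ ∀ x, Complex.exp (g x) = F x := by
  have huniv : IsSimplyConnected (univ : Set (ℝ × ℝ)) := by
    have : ContractibleSpace (univ : Set (ℝ × ℝ)) := convex_univ.contractibleSpace univ_nonempty
    exact (inferInstance : SimplyConnectedSpace (univ : Set (ℝ × ℝ)))
  obtain ⟨g, hg, hg'⟩ := Complex.exists_continuousOn_eqOn_exp_comp huniv isOpen_univ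
    (hF.continuousOn (s := univ)) (by rintro ⟨x, -, hx⟩; exact h0 x hx)
  exact ⟨g, by simpa using hg, fun x => hg' (mem_univ x)⟩

theorem exists_log_rect {F : ℝ → ℝ → ℂ} {a b c d : ℝ} (hab : a ≤ b) (hcd : c ≤ d)
    (hF : ContinuousOn (fun p : ℝ × ℝ => F p.1 p.2) (Icc a b ×ˢ Icc c d))
    (h0 : ∀ s ∈ Icc a b, ∀ t ∈ Icc c d, F s t ≠ 0) :
    ∃ g : ℝ → ℝ → ℂ, Continuous (fun p : ℝ × ℝ => g p.1 p.2) ∧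
      ∀ s ∈ Icc a b, ∀ t ∈ Icc c d, Complex.exp (g s t) = F s t := by
  let P : ℝ × ℝ → ℝ × ℝ := fun p => (projIcc a b hab p.1, projIcc c d hcd p.2)
  have hP : Continuous P := by fun_prop
  have hP' : ∀ p, P p ∈ Icc a b ×ˢ Icc c d := fun p =>
    ⟨(projIcc a b hab p.1).2, (projIcc c d hcd p.2).2⟩
  obtain ⟨g, hg, hg'⟩ := exists_log_prod (F := fun p => F (P p).1 (P p).2)
    (hF.comp_continuous hP hP') (fun p => h0 _ (hP' p).1 _ (hP' p).2)
  refine ⟨fun s t => g (s, t), by simpa using hg, fun s hs t ht => ?_⟩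
  rw [hg']
  simp [P, projIcc_of_mem _ hs, projIcc_of_mem _ ht]

theorem exists_log {f : ℝ → ℂ} {a b : ℝ} (hab : a ≤ b) (hf : ContinuousOn f (Icc a b))
    (h0 : ∀ x ∈ Icc a b, f x ≠ 0) :
    ∃ g : ℝ → ℂ, Continuous g ∧ ∀ x ∈ Icc a b, Complex.exp (g x) = f x := by
  obtain ⟨g, hg, hg'⟩ := exists_log_rect (F := fun s _ => f s) hab (le_refl (0 : ℝ))
    (hf.comp continuousOn_fst (fun p hp => hp.1)) (fun s hs _ _ => h0 s hs)
  refine ⟨fun s => g s 0, ?_, fun x hx => hg' x hx 0 (by simp)⟩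
  exact hg.comp (f := fun s : ℝ => (s, (0 : ℝ))) (by fun_prop)

/-- The total variation of the argument around the boundary of a rectangle vanishes. -/
theorem argVar_rect {F : ℝ → ℝ → ℂ} {a b c d : ℝ} (hab : a ≤ b) (hcd : c ≤ d)
    (hF : ContinuousOn (fun p : ℝ × ℝ => F p.1 p.2) (Icc a b ×ˢ Icc c d))
    (h0 : ∀ s ∈ Icc a b, ∀ t ∈ Icc c d, F s t ≠ 0) :
    argVar (fun s => F s c) a b + argVar (fun t => F b t) c d =
      argVar (fun t => F a t) c d + argVar (fun s => F s d) a b := by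
  obtain ⟨g, hg, hg'⟩ := exists_log_rect hab hcd hF h0
  have hs : ∀ t, Continuous fun s => g s t := fun t =>
    hg.comp (f := fun s : ℝ => (s, t)) (by fun_prop)
  have ht : ∀ s, Continuous fun t => g s t := fun s =>
    hg.comp (f := fun t : ℝ => (s, t)) (by fun_prop)
  rw [argVar_eq hab (hs c).continuousOn (fun x hx => hg' x hx c (left_mem_Icc.2 hcd)),
    argVar_eq hab (hs d).continuousOn (fun x hx => hg' x hx d (right_mem_Icc.2 hcd)),
    argVar_eq hcd (ht a).continuousOn (fun x hx => hg' a (left_mem_Icc.2 hab) x hx),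
    argVar_eq hcd (ht b).continuousOn (fun x hx => hg' b (right_mem_Icc.2 hab) x hx)]
  simp only [Complex.sub_im]
  ring

theorem argVar_add {f : ℝ → ℂ} {a b c : ℝ} (hab : a ≤ b) (hbc : b ≤ c)
    (hf : ContinuousOn f (Icc a c)) (h0 : ∀ x ∈ Icc a c, f x ≠ 0) :
    argVar f a b + argVar f b c = argVar f a c := by
  obtain ⟨g, hg, hg'⟩ := exists_log (hab.trans hbc) hf h0
  rw [argVar_eq hab hg.continuousOn (fun x hx => hg' x ⟨hx.1, hx.2.trans hbc⟩),
    argVar_eq hbc hg.continuousOn (fun x hx => hg' x ⟨hab.trans hx.1, hx.2⟩),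
    argVar_eq (hab.trans hbc) hg.continuousOn hg']
  simp only [Complex.sub_im]
  ring

theorem argVar_congr {f k : ℝ → ℂ} {a b : ℝ} (hab : a ≤ b) (hf : ContinuousOn f (Icc a b))
    (h0 : ∀ x ∈ Icc a b, f x ≠ 0) (h : ∀ x ∈ Icc a b, f x = k x) :
    argVar f a b = argVar k a b := by
  obtain ⟨g, hg, hg'⟩ := exists_log hab hf h0
  rw [argVar_eq hab hg.continuousOn hg',
    argVar_eq hab hg.continuousOn fun x hx => (hg' x hx).trans (h x hx)]

theorem argVar_mul {f k : ℝ → ℂ} {a b : ℝ} (hab : a ≤ b)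
    (hf : ContinuousOn f (Icc a b)) (hf0 : ∀ x ∈ Icc a b, f x ≠ 0)
    (hk : ContinuousOn k (Icc a b)) (hk0 : ∀ x ∈ Icc a b, k x ≠ 0) :
    argVar (fun x => f x * k x) a b = argVar f a b + argVar k a b := by
  obtain ⟨g, hg, hg'⟩ := exists_log hab hf hf0
  obtain ⟨l, hl, hl'⟩ := exists_log hab hk hk0
  rw [argVar_eq hab hg.continuousOn hg', argVar_eq hab hl.continuousOn hl',
    argVar_eq (g := fun x => g x + l x) hab (by fun_prop)
      (fun x hx => by rw [Complex.exp_add, hg' x hx, hl' x hx])]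
  simp only [Complex.sub_im, Complex.add_im]
  ring

theorem argVar_neg {f : ℝ → ℂ} {a b : ℝ} (hab : a ≤ b)
    (hf : ContinuousOn f (Icc a b)) (hf0 : ∀ x ∈ Icc a b, f x ≠ 0) :
    argVar (fun x => - f x) a b = argVar f a b := by
  obtain ⟨g, hg, hg'⟩ := exists_log hab hf hf0
  rw [argVar_eq hab hg.continuousOn hg',
    argVar_eq (g := fun x => g x + Real.pi * Complex.I) hab (by fun_prop)
      (fun x hx => by rw [Complex.exp_add, hg' x hx, Complex.exp_pi_mul_I]; ring)]
  simp

theorem argVar_reverse {f : ℝ → ℂ} {a b : ℝ} (c : ℝ) (hab : a ≤ b)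
    (hf : ContinuousOn f (Icc a b)) (hf0 : ∀ x ∈ Icc a b, f x ≠ 0) :
    argVar (fun x => f (c - x)) (c - b) (c - a) = - argVar f a b := by
  obtain ⟨g, hg, hg'⟩ := exists_log hab hf hf0
  rw [argVar_eq hab hg.continuousOn hg',
    argVar_eq (g := fun x => g (c - x)) (by linarith) (by fun_prop)
      (fun x hx => hg' _ ⟨by linarith [hx.2], by linarith [hx.1]⟩)]
  simp

theorem argVar_slit {f : ℝ → ℂ} {a b : ℝ} (w : ℂ) (hw : w ≠ 0) (hab : a ≤ b)
    (hf : ContinuousOn f (Icc a b)) (h : ∀ x ∈ Icc a b, f x / w ∈ Complex.slitPlane) :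
    argVar f a b = (f b / w).arg - (f a / w).arg := by
  rw [argVar_eq (g := fun x => Complex.log w + Complex.log (f x / w)) hab]
  · simp [Complex.log_im]
  · exact continuousOn_const.add ((hf.div_const w).clog h)
  · intro x hx
    rw [Complex.exp_add, Complex.exp_log hw, Complex.exp_log (Complex.slitPlane_ne_zero (h x hx))]
    field_simp

theorem div_mem_slitPlane_of_near {x y p : ℂ} (h : ‖x - p‖ ≤ ‖y - p‖) (hx : x ≠ y) (hp : p ≠ y) :
    (x - y) / (p - y) ∈ Complex.slitPlane := by
  have hpy : p - y ≠ 0 := sub_ne_zero.2 hp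
  set w := (x - p) / (p - y) with hw
  have h1 : (x - y) / (p - y) = 1 + w := by rw [hw]; field_simp; ring
  have hn : ‖w‖ ≤ 1 := by
    rw [hw, norm_div, norm_sub_rev p y]
    exact div_le_one_of_le₀ h (norm_nonneg _)
  have hne : 1 + w ≠ 0 := by
    rw [← h1]
    exact div_ne_zero (sub_ne_zero.2 hx) hpy
  rw [h1, Complex.mem_slitPlane_iff]
  by_contra hcon
  push Not at hcon
  obtain ⟨hre, him⟩ := hcon
  apply hne
  have h2 := (abs_le.1 ((Complex.abs_re_le_norm w).trans hn)).1
  simp only [Complex.add_re, Complex.one_re, Complex.add_im, Complex.one_im, zero_add] at hre him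
  apply Complex.ext <;> simp
  · linarith
  · exact him

theorem argVar_near {γ : ℝ → ℂ} {a b : ℝ} {x p : ℂ} (hab : a ≤ b) (hγ : Continuous γ)
    (hx : ∀ s ∈ Icc a b, x ≠ γ s) (hp : ∀ s ∈ Icc a b, p ≠ γ s)
    (h : ∀ s ∈ Icc a b, ‖x - p‖ ≤ ‖γ s - p‖) :
    argVar (fun s => x - γ s) a b = argVar (fun s => p - γ s) a b +
      (((x - γ b) / (p - γ b)).arg - ((x - γ a) / (p - γ a)).arg) := by
  have hp0 : ∀ s ∈ Icc a b, p - γ s ≠ 0 := fun s hs => sub_ne_zero.2 (hp s hs)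
  have hq : ContinuousOn (fun s => (x - γ s) / (p - γ s)) (Icc a b) :=
    ContinuousOn.div (by fun_prop) (by fun_prop) hp0
  have hs : ∀ s ∈ Icc a b, (x - γ s) / (p - γ s) ∈ Complex.slitPlane := fun s hs =>
    div_mem_slitPlane_of_near (h s hs) (hx s hs) (hp s hs)
  rw [argVar_congr hab (by fun_prop) (fun s hs => sub_ne_zero.2 (hx s hs))
      (k := fun s => (p - γ s) * ((x - γ s) / (p - γ s)))
      (fun s hs => by field_simp [hp0 s hs]),
    argVar_mul hab (by fun_prop) hp0 hq (fun s h' => Complex.slitPlane_ne_zero (hs s h')),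
    argVar_slit (f := fun s => (x - γ s) / (p - γ s)) 1 one_ne_zero hab hq (by simpa using hs)]
  simp

/-- The argument of `w`, normalised to lie in `(0, 2π]`. -/
noncomputable def angle (w : ℂ) : ℝ := if 0 < w.arg then w.arg else w.arg + 2 * Real.pi

theorem angle_pos (w : ℂ) : 0 < angle w := by
  unfold angle
  split_ifs with h
  · exact h
  · linarith [Complex.neg_pi_lt_arg w, Real.pi_pos]

theorem angle_le (w : ℂ) : angle w ≤ 2 * Real.pi := by
  unfold angle
  split_ifs with h
  · linarith [Complex.arg_le_pi w, Real.pi_pos]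
  · linarith

theorem angle_one : angle 1 = 2 * Real.pi := by simp [angle]

theorem exp_angle {w : ℂ} (hw : ‖w‖ = 1) : Complex.exp (angle w * Complex.I) = w := by
  have h := Complex.norm_mul_exp_arg_mul_I w
  rw [hw, Complex.ofReal_one, one_mul] at h
  unfold angle
  split_ifs
  · exact h
  · push_cast
    rw [add_mul, Complex.exp_add, h, Complex.exp_two_pi_mul_I, mul_one]

theorem angle_eq {w : ℂ} {x : ℝ} (hx0 : 0 < x) (hx : x ≤ 2 * Real.pi)
    (hw : Complex.exp (x * Complex.I) = w) : angle w = x := by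
  have hw1 : ‖w‖ = 1 := by rw [← hw]; exact Complex.norm_exp_ofReal_mul_I x
  have h := (exp_angle hw1).trans hw.symm
  obtain ⟨n, hn⟩ := Complex.exp_eq_exp_iff_exists_int.1 h
  have h2 := congrArg Complex.im hn
  simp at h2
  have h3 := angle_pos w
  have h4 := angle_le w
  have hpi := Real.pi_pos
  have hn0 : n = 0 := by
    have h5 : (n : ℝ) < 1 := by
      by_contra! hc
      nlinarith
    have h6 : (-1 : ℝ) < n := by
      by_contra! hc
      nlinarith
    have h7 : n < 1 := by exact_mod_cast h5
    have h8 : -1 < n := by exact_mod_cast h6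
    omega
  rw [hn0] at h2
  simpa using h2

theorem two_mul_arg_one_sub {w : ℂ} (hw : ‖w‖ = 1) (h1 : w ≠ 1) :
    2 * (1 - w).arg = angle w - Real.pi := by
  have hpi := Real.pi_pos
  have he := exp_angle hw
  have hpos := angle_pos w
  have hle := angle_le w
  have hlt : angle w < 2 * Real.pi := by
    rcases hle.lt_or_eq with h | h
    · exact h
    · rw [h] at he
      push_cast at he
      rw [Complex.exp_two_pi_mul_I] at he
      exact absurd he.symm h1
  set x := angle w
  have hsin : 0 < 2 * Real.sin (x / 2) := by
    have := Real.sin_pos_of_pos_of_lt_pi (x := x / 2) (by linarith) (by linarith)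
    linarith
  have key : 1 - w = ((2 * Real.sin (x / 2) : ℝ) : ℂ) *
      (Complex.cos ((x / 2 - Real.pi / 2 : ℝ)) + Complex.sin ((x / 2 - Real.pi / 2 : ℝ)) * Complex.I) := by
    rw [← Complex.ofReal_cos, ← Complex.ofReal_sin, Real.cos_sub_pi_div_two, Real.sin_sub_pi_div_two,
      ← he, Complex.exp_mul_I, ← Complex.ofReal_cos, ← Complex.ofReal_sin]
    have e1 : Real.cos x = 1 - 2 * Real.sin (x / 2) ^ 2 := by
      have := Real.cos_two_mul (x / 2)
      have h3 := Real.sin_sq_add_cos_sq (x / 2)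
      rw [show 2 * (x / 2) = x by ring] at this
      linarith
    have e2 : Real.sin x = 2 * Real.sin (x / 2) * Real.cos (x / 2) := by
      have := Real.sin_two_mul (x / 2)
      rwa [show 2 * (x / 2) = x by ring] at this
    rw [e1, e2]
    push_cast
    ring
  rw [key, Complex.arg_mul_cos_add_sin_mul_I hsin ⟨by linarith, by linarith⟩]
  ring

theorem arg_one_sub_inv {w : ℂ} (hw : ‖w‖ = 1) :
    (1 - w⁻¹).arg = - (1 - w).arg := by
  have : w⁻¹ = (starRingEnd ℂ) w := by rw [Complex.inv_def, Complex.normSq_eq_norm_sq, hw]; simp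
  rw [this, show 1 - (starRingEnd ℂ) w = (starRingEnd ℂ) (1 - w) by simp, Complex.arg_conj, if_neg]
  intro h
  have h3 : (1 - w).re < 0 ∧ (1 - w).im = 0 := Complex.arg_eq_pi_iff.1 h
  have := Complex.re_le_norm w
  simp at h3
  linarith [h3.1]

open Set

theorem re_lt_one {w : ℂ} (hw : ‖w‖ = 1) (h1 : w ≠ 1) : w.re < 1 := by
  refine lt_of_le_of_ne ((Complex.re_le_norm w).trans hw.le) fun h => h1 ?_
  have h2 := Complex.sq_norm_sub_sq_re w
  rw [hw, h] at h2
  apply Complex.ext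
  · simpa using h
  · simpa using h2.symm

theorem angle_div_sub {v w : ℂ} (hv : ‖v‖ = 1) (hw : ‖w‖ = 1) (h : angle v < angle w) :
    angle (w / v) = angle w - angle v := by
  refine angle_eq (sub_pos.2 h) (by linarith [angle_pos v, angle_le w]) ?_
  push_cast
  rw [sub_mul, Complex.exp_sub, exp_angle hv, exp_angle hw]

/-- Finitely many oriented arcs in the complex plane, closed under reversal, that meet only at
their endpoints and are radial near their endpoints. -/
structure NiceArcs (D : Type*) where
  α : D → D
  α_α : ∀ d, α (α d) = d
  γ : D → ℝ → ℂ
  cont : ∀ d, Continuous (γ d)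
  symm : ∀ d t, γ (α d) t = γ d (1 - t)
  inj : ∀ d, InjOn (γ d) (Icc 0 1)
  disj : ∀ d d', d' ≠ d → d' ≠ α d → ∀ s ∈ Icc (0 : ℝ) 1, ∀ t ∈ Icc (0 : ℝ) 1,
    γ d s = γ d' t → s = 0 ∨ s = 1
  ε : ℝ
  ε_pos : 0 < ε
  u : D → ℂ
  norm_u : ∀ d, ‖u d‖ = 1
  radial : ∀ d, ∀ t ∈ Icc (0 : ℝ) (1 / 3), γ d t = γ d 0 + 3 * t * ε * u d
  far : ∀ d, ∀ t ∈ Icc (1 / 3 : ℝ) 1, ε ≤ ‖γ d t - γ d 0‖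
  away : ∀ d d', γ d' 0 ≠ γ d 0 → γ d' 0 ≠ γ d 1 → ∀ t ∈ Icc (0 : ℝ) 1, ε < ‖γ d t - γ d' 0‖

namespace NiceArcs

variable {D : Type*} (N : NiceArcs D)

/-- The initial point of an arc. -/
noncomputable def base (d : D) : ℂ := N.γ d 0

/-- The point where an arc leaves the disc around its initial point. -/
noncomputable def tip (d : D) : ℂ := N.γ d (1 / 3)

theorem base_α (d : D) : N.base (N.α d) = N.γ d 1 := by simp [base, N.symm]

theorem tip_α (d : D) : N.tip (N.α d) = N.γ d (2 / 3) := by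
  rw [tip, N.symm]; norm_num

theorem base_α_ne (d : D) : N.base (N.α d) ≠ N.base d := by
  rw [base_α, base]
  intro h
  have := N.inj d (by norm_num) (by norm_num) h
  norm_num at this

theorem α_ne (d : D) : N.α d ≠ d := fun h => N.base_α_ne d (by rw [h])

theorem tip_eq (d : D) : N.tip d = N.base d + N.ε * N.u d := by
  rw [tip, N.radial d (1 / 3) (by norm_num), base]
  norm_num

theorem u_ne_zero (d : D) : N.u d ≠ 0 := by
  intro h
  have := N.norm_u d
  simp [h] at this

theorem norm_tip_sub (d : D) : ‖N.tip d - N.base d‖ = N.ε := by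
  rw [tip_eq, add_sub_cancel_left, norm_mul, N.norm_u, mul_one, Complex.norm_real,
    Real.norm_of_nonneg N.ε_pos.le]

theorem disj' {d d' : D} (h : d' ≠ d) (h' : d' ≠ N.α d) {s t : ℝ} (hs : s ∈ Icc (0 : ℝ) 1)
    (ht : t ∈ Icc (0 : ℝ) 1) (ht0 : t ≠ 0) (ht1 : t ≠ 1) : N.γ d' t ≠ N.γ d s := by
  intro he
  rcases N.disj d' d h.symm (fun h2 => h' (by rw [h2, N.α_α])) t ht s hs he with h | h
  · exact ht0 h
  · exact ht1 h

theorem tip_ne {d d' : D} (h : d' ≠ d) (h' : d' ≠ N.α d) {s : ℝ} (hs : s ∈ Icc (0 : ℝ) 1) :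
    N.tip d' ≠ N.γ d s :=
  N.disj' h h' hs (by norm_num) (by norm_num) (by norm_num)

theorem u_ne {d d' : D} (h : d' ≠ d) (hb : N.base d' = N.base d) : N.u d' ≠ N.u d := by
  intro hu
  have h' : d' ≠ N.α d := fun h' => N.base_α_ne d (h' ▸ hb)
  apply N.disj' h h' (s := 1 / 6) (t := 1 / 6) (by norm_num) (by norm_num) (by norm_num)
    (by norm_num)
  rw [N.radial d' _ (by norm_num), N.radial d _ (by norm_num), hu]
  exact congrArg (· + _) hb

theorem base_ne {d : D} {p : ℂ} (h : ∃ d', p = N.base d') (h0 : p ≠ N.base d)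
    (h1 : p ≠ N.base (N.α d)) {s : ℝ} (hs : s ∈ Icc (0 : ℝ) 1) : N.ε < ‖N.γ d s - p‖ := by
  obtain ⟨d', rfl⟩ := h
  exact N.away d d' h0 (by rw [← base_α]; exact h1) s hs

/-- The variation of the argument of an arc, as seen from `x`. -/
noncomputable def turn (x : ℂ) (d : D) : ℝ := argVar (fun s => x - N.γ d s) 0 1

theorem turn_of_ne {d d' : D} (h : d' ≠ d) (h' : d' ≠ N.α d) (h0 : N.base d' ≠ N.base d)
    (h1 : N.base d' ≠ N.base (N.α d)) :
    N.turn (N.tip d') d = N.turn (N.base d') d +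
      (((N.tip d' - N.base (N.α d)) / (N.base d' - N.base (N.α d))).arg -
        ((N.tip d' - N.base d) / (N.base d' - N.base d)).arg) := by
  have hlt : ∀ s ∈ Icc (0 : ℝ) 1, N.ε < ‖N.γ d s - N.base d'‖ := fun s hs =>
    N.base_ne ⟨d', rfl⟩ h0 h1 hs
  rw [turn, turn, argVar_near (p := N.base d') zero_le_one (N.cont d), base_α]
  · rfl
  · exact fun s hs => N.tip_ne h h' hs
  · intro s hs he
    have := hlt s hs
    rw [he, sub_self, norm_zero] at this
    exact absurd this (not_lt.2 N.ε_pos.le)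
  · intro s hs
    rw [norm_tip_sub]
    exact (hlt s hs).le

theorem turn_of_base_eq {d d' : D} (h : d' ≠ d) (h0 : N.base d' = N.base d) :
    N.turn (N.tip d') d = argVar (fun s => N.base d - N.γ d s) (1 / 3) 1 +
      (((N.tip d' - N.base (N.α d)) / (N.base d' - N.base (N.α d))).arg -
        2 * (1 - N.u d' / N.u d).arg) := by
  have h' : d' ≠ N.α d := fun h' => N.base_α_ne d (h' ▸ h0)
  have hud := N.u_ne_zero d
  have hud' := N.u_ne_zero d'
  have hε : (N.ε : ℂ) ≠ 0 := by exact_mod_cast N.ε_pos.ne'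
  have hu := N.u_ne h h0
  have hq : ‖N.u d' / N.u d‖ = 1 := by rw [norm_div, N.norm_u, N.norm_u, div_one]
  have hq1 : N.u d' / N.u d ≠ 1 := by rwa [Ne, div_eq_one_iff_eq hud]
  have hne : ∀ s ∈ Icc (0 : ℝ) 1, N.tip d' ≠ N.γ d s := fun s hs => N.tip_ne h h' hs
  have hc := N.cont d
  rw [turn, ← argVar_add (b := 1 / 3) (by norm_num) (by norm_num) (by fun_prop)
    (fun s hs => sub_ne_zero.2 (hne s hs))]
  rw [argVar_near (a := 1 / 3) (p := N.base d') (by norm_num) hc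
    (fun s hs => hne s ⟨by linarith [hs.1], hs.2⟩)]
  rotate_left
  · intro s hs he
    have := N.far d s hs
    rw [← he, h0, base, sub_self, norm_zero] at this
    exact absurd N.ε_pos (not_lt.2 this)
  · intro s hs
    rw [norm_tip_sub, h0]
    exact N.far d s hs
  have hdisc : ∀ s ∈ Icc (0 : ℝ) (1 / 3), (N.tip d' - N.γ d s) / (N.ε * N.u d') =
      1 - (3 * s : ℝ) * (N.u d' / N.u d)⁻¹ := by
    intro s hs
    rw [tip_eq, N.radial d s hs, h0, base]
    push_cast
    field_simp
    ring
  have hslit : ∀ s ∈ Icc (0 : ℝ) (1 / 3), (N.tip d' - N.γ d s) / (N.ε * N.u d') ∈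
      Complex.slitPlane := by
    intro s hs
    rw [hdisc s hs, Complex.mem_slitPlane_iff]
    left
    have h3 := re_lt_one (w := (N.u d' / N.u d)⁻¹) (by rw [norm_inv, hq, inv_one])
      (by rwa [Ne, inv_eq_one])
    rw [Complex.sub_re, Complex.re_ofReal_mul, Complex.one_re]
    by_cases h4 : 0 ≤ (N.u d' / N.u d)⁻¹.re
    · nlinarith [hs.1, hs.2]
    · nlinarith [hs.1, hs.2]
  rw [argVar_slit (N.ε * N.u d') (mul_ne_zero hε hud') (by norm_num) (by fun_prop) hslit,
    hdisc _ (by norm_num), hdisc _ (by norm_num)]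
  have e1 : (1 - ((3 * (1 / 3) : ℝ) : ℂ) * (N.u d' / N.u d)⁻¹).arg =
      - (1 - N.u d' / N.u d).arg := by
    norm_num
    have := arg_one_sub_inv hq
    simpa using this
  have e2 : (N.tip d' - N.γ d (1 / 3)) / (N.base d' - N.γ d (1 / 3)) = 1 - N.u d' / N.u d := by
    change (N.tip d' - N.tip d) / (N.base d' - N.tip d) = _
    rw [tip_eq, tip_eq, h0]
    field_simp
    ring
  rw [e1, e2, h0, base_α]
  simp
  ring

theorem turn_of_base_eq' {d d' : D} (h : d' ≠ N.α d) (h1 : N.base d' = N.base (N.α d)) :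
    N.turn (N.tip d') d = argVar (fun s => N.base (N.α d) - N.γ d s) 0 (2 / 3) -
      (((N.tip d' - N.base d) / (N.base d' - N.base d)).arg -
        2 * (1 - N.u d' / N.u (N.α d)).arg) := by
  have h' : d' ≠ d := fun h' => N.base_α_ne d (h' ▸ h1.symm)
  have hc := N.cont d
  have e1 : N.turn (N.tip d') (N.α d) = - N.turn (N.tip d') d := by
    have := argVar_reverse (f := fun s => N.tip d' - N.γ d s) (a := 0) (b := 1) 1 zero_le_one
      (by fun_prop) (fun s hs => sub_ne_zero.2 (N.tip_ne h' h hs))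
    simp only [sub_self, sub_zero] at this
    rw [turn, turn, ← this]
    simp only [N.symm]
  have e2 : argVar (fun s => N.base (N.α d) - N.γ (N.α d) s) (1 / 3) 1 =
      - argVar (fun s => N.base (N.α d) - N.γ d s) 0 (2 / 3) := by
    have := argVar_reverse (f := fun s => N.base (N.α d) - N.γ d s) (a := 0) (b := 2 / 3) 1
      (by norm_num) (by fun_prop) (fun s hs => ?_)
    · norm_num at this
      rw [← this]
      simp only [N.symm]
    · rw [sub_ne_zero, base_α]
      intro he
      have := N.inj d (by norm_num) ⟨hs.1, by linarith [hs.2]⟩ he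
      linarith [hs.2]
  have := N.turn_of_base_eq h h1
  rw [e1, e2, N.α_α] at this
  linarith

theorem ε_le_dist (d : D) : N.ε ≤ ‖N.base (N.α d) - N.base d‖ := by
  rw [base_α]
  exact N.far d 1 (by norm_num)

theorem argVar_start (d : D) :
    argVar (fun s => N.base (N.α d) - N.γ d s) 0 (1 / 3) =
      ((N.tip d - N.base (N.α d)) / (N.base d - N.base (N.α d))).arg := by
  have hc := N.cont d
  have hne : N.base (N.α d) - N.base d ≠ 0 := sub_ne_zero.2 (N.base_α_ne d)
  have hdiv : ∀ x, (N.base (N.α d) - x) / (N.base (N.α d) - N.base d) =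
      (x - N.base (N.α d)) / (N.base d - N.base (N.α d)) := fun x => by
    rw [← neg_sub x, ← neg_sub (N.base d), neg_div_neg_eq]
  rw [argVar_slit (N.base (N.α d) - N.base d) hne (by norm_num) (by fun_prop), hdiv, hdiv]
  · change ((N.tip d - _) / _).arg - ((N.base d - _) / _).arg = _
    rw [div_self (sub_ne_zero.2 (N.base_α_ne d).symm)]
    simp
  · intro s hs
    rw [hdiv]
    refine div_mem_slitPlane_of_near ?_ ?_ (N.base_α_ne d).symm
    · refine le_trans ?_ (N.ε_le_dist d)
      rw [N.radial d s hs, base, add_sub_cancel_left, norm_mul, N.norm_u, mul_one, norm_mul,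
        Complex.norm_real, Real.norm_of_nonneg N.ε_pos.le, norm_mul, Complex.norm_real,
        Real.norm_of_nonneg hs.1]
      norm_num
      nlinarith [N.ε_pos, hs.2]
    · rw [base_α]
      intro h
      have := N.inj d ⟨hs.1, by linarith [hs.2]⟩ (by norm_num) h
      linarith [hs.2]

/-- The variation of the argument of the central part of an arc. -/
noncomputable def midTurn (p : ℂ) (d : D) : ℝ := argVar (fun t => N.γ d t - p) (1 / 3) (2 / 3)

theorem midTurn_α {p : ℂ} {d : D} (hp : ∀ t ∈ Icc (1 / 3 : ℝ) (2 / 3), N.γ d t ≠ p) :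
    N.midTurn p (N.α d) = - N.midTurn p d := by
  have hc := N.cont d
  have := argVar_reverse (f := fun s => N.γ d s - p) (a := 1 / 3) (b := 2 / 3) 1
    (by norm_num) (by fun_prop) (fun s hs => sub_ne_zero.2 (hp s hs))
  rw [midTurn, midTurn, ← this]
  simp only [N.symm]
  norm_num

theorem ne_base_of_mem {d d' : D} {t : ℝ} (ht : t ∈ Icc (1 / 3 : ℝ) (2 / 3)) :
    N.γ d t ≠ N.base d' := by
  have ht' : t ∈ Icc (0 : ℝ) 1 := ⟨by linarith [ht.1], by linarith [ht.2]⟩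
  by_cases h : d' = d
  · subst h
    intro he
    have := N.inj d' ht' (by norm_num) he
    linarith [ht.1]
  by_cases h' : d' = N.α d
  · subst h'
    rw [base_α]
    intro he
    have := N.inj d ht' (by norm_num) he
    linarith [ht.2]
  · intro he
    rcases N.disj d d' h h' t ht' 0 (by norm_num) he with h | h
    · linarith [ht.1]
    · linarith [ht.2]

theorem argVar_to_mid (d : D) :
    argVar (fun s => N.base (N.α d) - N.γ d s) 0 (2 / 3) =
      ((N.tip d - N.base (N.α d)) / (N.base d - N.base (N.α d))).arg +
        N.midTurn (N.base (N.α d)) d := by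
  have hc := N.cont d
  have hne : ∀ t ∈ Icc (0 : ℝ) (2 / 3), N.base (N.α d) - N.γ d t ≠ 0 := by
    intro t ht
    rw [sub_ne_zero, base_α]
    intro h
    have := N.inj d (by norm_num) ⟨ht.1, by linarith [ht.2]⟩ h
    linarith [ht.2]
  rw [← argVar_add (b := 1 / 3) (by norm_num) (by norm_num) (by fun_prop) hne, argVar_start,
    midTurn, ← argVar_neg (by norm_num) (by fun_prop)
      (fun t ht => sub_ne_zero.2 (N.ne_base_of_mem ht))]
  simp

theorem argVar_from_mid (d : D) :
    argVar (fun s => N.base d - N.γ d s) (1 / 3) 1 =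
      N.midTurn (N.base d) d -
      ((N.tip (N.α d) - N.base d) / (N.base (N.α d) - N.base d)).arg := by
  have hc := N.cont d
  have hne : ∀ t ∈ Icc (1 / 3 : ℝ) 1, N.base d - N.γ d t ≠ 0 := by
    intro t ht
    rw [sub_ne_zero]
    intro h
    have := N.inj d (by norm_num) ⟨by linarith [ht.1], ht.2⟩ h
    linarith [ht.1]
  have h1 := argVar_reverse (f := fun s => N.base d - N.γ d s) (a := 1 / 3) (b := 1) 1
    (by norm_num) (by fun_prop) hne
  have h2 := N.argVar_to_mid (N.α d)
  rw [N.α_α, midTurn_α _ (fun t ht => N.ne_base_of_mem ht)] at h2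
  simp only [N.symm] at h2
  norm_num at h1
  linarith

/-- Auxiliary angle coefficients. -/
noncomputable def kcoef (d d' : D) : ℝ :=
  open Classical in
  if N.base d' = N.base d then 2 * (1 - N.u d' / N.u d).arg
    else ((N.tip d' - N.base d) / (N.base d' - N.base d)).arg

theorem kcoef_self (d : D) : N.kcoef d d = 0 := by
  simp [kcoef, N.u_ne_zero]

/-- Auxiliary potential on the endpoints of the arcs. -/
noncomputable def pot (d : D) (p : ℂ) : ℝ :=
  open Classical in
  if p = N.base d then argVar (fun s => N.base d - N.γ d s) (1 / 3) 1
  else if p = N.base (N.α d) then argVar (fun s => N.base (N.α d) - N.γ d s) 0 (2 / 3)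
  else N.turn p d

theorem turn_tip {d d' : D} (h : d' ≠ d) (h' : d' ≠ N.α d) :
    N.turn (N.tip d') d = N.pot d (N.base d') + (N.kcoef (N.α d) d' - N.kcoef d d') := by
  have hne := N.base_α_ne d
  by_cases h0 : N.base d' = N.base d
  · rw [turn_of_base_eq N h h0]
    simp [pot, kcoef, h0, hne.symm]
  by_cases h1 : N.base d' = N.base (N.α d)
  · rw [turn_of_base_eq' N h' h1]
    simp [pot, kcoef, h1, hne]
    ring
  · rw [turn_of_ne N h h' h0 h1]
    simp [pot, kcoef, h0, h1]

theorem midTurn_sub (d d' : D) :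
    N.midTurn (N.base (N.α d)) d' - N.midTurn (N.base d) d' =
      (N.pot d (N.base (N.α d')) + (N.kcoef (N.α d) (N.α d') - N.kcoef d (N.α d'))) -
      (N.pot d (N.base d') + (N.kcoef (N.α d) d' - N.kcoef d d')) := by
  have hne := N.base_α_ne d
  have hself : N.midTurn (N.base (N.α d)) d - N.midTurn (N.base d) d =
      (N.pot d (N.base (N.α d)) + (N.kcoef (N.α d) (N.α d) - N.kcoef d (N.α d))) -
      (N.pot d (N.base d) + (N.kcoef (N.α d) d - N.kcoef d d)) := by
    rw [kcoef_self, kcoef_self]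
    simp only [pot, if_neg hne, if_true, kcoef, if_neg hne.symm]
    rw [argVar_to_mid, argVar_from_mid]
    ring
  by_cases h : d' = d
  · rw [h, hself]
  by_cases h' : d' = N.α d
  · rw [h', midTurn_α _ (fun t ht => N.ne_base_of_mem ht),
      midTurn_α _ (fun t ht => N.ne_base_of_mem ht), N.α_α]
    linarith
  have h2 : N.α d' ≠ d := fun h2 => h' (by rw [← h2, N.α_α])
  have h3 : N.α d' ≠ N.α d := fun h3 => h (by rw [← N.α_α d', h3, N.α_α])
  rw [← turn_tip N h h', ← turn_tip N h2 h3]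
  have hc := N.cont d
  have hc' := N.cont d'
  have := argVar_rect (F := fun s t => N.γ d' t - N.γ d s) (a := 0) (b := 1) (c := 1 / 3)
    (d := 2 / 3) (by norm_num) (by norm_num) (Continuous.continuousOn (by fun_prop))
    (fun s hs t ht => sub_ne_zero.2 (N.disj' h h' hs ⟨by linarith [ht.1], by linarith [ht.2]⟩
      (by linarith [ht.1]) (by linarith [ht.2])))
  rw [turn, turn, tip_α, tip, midTurn, midTurn, base_α, base]
  linarith

variable [Fintype D]

/-- Antisymmetric weights with vanishing divergence. -/
structure IsCirculation (z : D → ℝ) : Prop where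
  anti : ∀ d, z (N.α d) = - z d
  div : ∀ d', open Classical in ∑ d, (if N.base d = N.base d' then z d else 0) = 0

theorem IsCirculation.sum_base {z : D → ℝ} {N : NiceArcs D} (hz : N.IsCirculation z) (A : ℂ → ℝ) :
    ∑ d, z d * A (N.base d) = 0 := by
  classical
  have h1 : ∀ d, z d * A (N.base d) =
      ∑ p ∈ Finset.univ.image N.base, A p * (if N.base d = p then z d else 0) := by
    intro d
    rw [Finset.sum_eq_single (N.base d)]
    · simp [mul_comm]
    · intro b _ hb
      simp [hb.symm]
    · intro h
      exact absurd (Finset.mem_image_of_mem _ (Finset.mem_univ d)) h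
  rw [Finset.sum_congr rfl fun d _ => h1 d, Finset.sum_comm]
  refine Finset.sum_eq_zero fun p hp => ?_
  obtain ⟨d', -, rfl⟩ := Finset.mem_image.1 hp
  rw [← Finset.mul_sum]
  have := hz.div d'
  rw [mul_eq_zero]
  right
  convert this

/-- The coefficients of the face potential. -/
noncomputable def coef (d d' : D) : ℝ :=
  open Classical in
  N.midTurn (N.base d) d' / 2 + (if N.base d' = N.base d then angle (N.u d' / N.u d)
    else ((N.tip d' - N.base d) / (N.base d' - N.base d)).arg)

theorem sum_kcoef {z : D → ℝ} (hz : N.IsCirculation z) (d : D) :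
    ∑ d', z d' * (N.midTurn (N.base (N.α d)) d' / 2 + N.kcoef (N.α d) d') =
      ∑ d', z d' * (N.midTurn (N.base d) d' / 2 + N.kcoef d d') := by
  rw [← sub_eq_zero, ← Finset.sum_sub_distrib]
  set Y : D → ℝ := fun d' => N.pot d (N.base d') + (N.kcoef (N.α d) d' - N.kcoef d d') with hY
  have h1 : ∀ d', z d' * (N.midTurn (N.base (N.α d)) d' / 2 + N.kcoef (N.α d) d') -
      z d' * (N.midTurn (N.base d) d' / 2 + N.kcoef d d') =
      (z d' * Y (N.α d') + z d' * Y d') / 2 - z d' * N.pot d (N.base d') := by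
    intro d'
    have := N.midTurn_sub d d'
    simp only [hY]
    linear_combination (z d' / 2) * this
  rw [Finset.sum_congr rfl fun d' _ => h1 d', Finset.sum_sub_distrib, hz.sum_base,
    ← Finset.sum_div, Finset.sum_add_distrib]
  have h2 : ∑ d', z d' * Y (N.α d') = ∑ d', z (N.α d') * Y d' := by
    refine Finset.sum_nbij' N.α N.α ?_ ?_ ?_ ?_ ?_ <;> simp [N.α_α]
  rw [h2, ← Finset.sum_add_distrib, Finset.sum_eq_zero]
  · simp
  · intro d' _
    rw [hz.anti]
    ring

theorem sum_coef_eq {z : D → ℝ} (hz : N.IsCirculation z) (d : D) :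
    ∑ d', z d' * N.coef d d' =
      ∑ d', z d' * (N.midTurn (N.base d) d' / 2 + N.kcoef d d') + Real.pi * z d := by
  classical
  have h1 : ∀ d', z d' * N.coef d d' = z d' * (N.midTurn (N.base d) d' / 2 + N.kcoef d d') +
      (Real.pi * (if N.base d' = N.base d then z d' else 0) + if d' = d then Real.pi * z d else 0) := by
    intro d'
    by_cases h : d' = d
    · subst h
      simp [coef, kcoef, N.u_ne_zero, angle_one]
      ring
    by_cases hb : N.base d' = N.base d
    · have := two_mul_arg_one_sub (w := N.u d' / N.u d) (by rw [norm_div, N.norm_u, N.norm_u, div_one])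
        (by rw [Ne, div_eq_one_iff_eq (N.u_ne_zero d)]; exact N.u_ne h hb)
      simp only [coef, kcoef, if_pos hb, if_neg h, this]
      ring
    · simp only [coef, kcoef, if_neg hb, if_neg h]
      ring
  rw [Finset.sum_congr rfl fun d' _ => h1 d', Finset.sum_add_distrib, Finset.sum_add_distrib,
    ← Finset.mul_sum]
  have := hz.div d
  have h2 : ∑ d', (if N.base d' = N.base d then z d' else 0) = 0 := by convert this
  rw [h2]
  simp

theorem sum_coef_α {z : D → ℝ} (hz : N.IsCirculation z) (d : D) :
    ∑ d', z d' * N.coef (N.α d) d' = ∑ d', z d' * N.coef d d' - 2 * Real.pi * z d := by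
  rw [sum_coef_eq N hz, sum_coef_eq N hz, sum_kcoef N hz, hz.anti]
  ring


omit [Fintype D] in
theorem norm_div_u (d d' : D) : ‖N.u d' / N.u d‖ = 1 := by
  rw [norm_div, N.norm_u, N.norm_u, div_one]

omit [Fintype D] in
theorem angle_div_u_sub {d e f : D} (h : angle (N.u e / N.u d) < angle (N.u f / N.u d)) :
    angle (N.u f / N.u e) = angle (N.u f / N.u d) - angle (N.u e / N.u d) := by
  rw [← angle_div_sub (N.norm_div_u _ _) (N.norm_div_u _ _) h]
  congr 1
  have := N.u_ne_zero d
  have := N.u_ne_zero e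
  field_simp

omit [Fintype D] in
theorem angle_div_u_inj {d e f : D} (hb : N.base e = N.base f)
    (h : angle (N.u e / N.u d) = angle (N.u f / N.u d)) : e = f := by
  by_contra hne
  refine N.u_ne hne hb ?_
  have h1 := exp_angle (N.norm_div_u d e)
  rw [h, exp_angle (N.norm_div_u d f)] at h1
  have := N.u_ne_zero d
  field_simp at h1
  exact h1.symm

theorem exists_next (d : D) : ∃ e, N.base e = N.base d ∧
    ∀ f, N.base f = N.base d → angle (N.u e / N.u d) ≤ angle (N.u f / N.u d) := by
  classical
  obtain ⟨e, he, hmin⟩ := Finset.exists_min_image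
    (Finset.univ.filter fun f => N.base f = N.base d) (fun f => angle (N.u f / N.u d))
    ⟨d, by simp⟩
  exact ⟨e, by simpa using he, fun f hf => hmin f (by simpa using hf)⟩

/-- The next arc in counterclockwise order around the initial point. -/
noncomputable def next (d : D) : D := (N.exists_next d).choose

theorem base_next (d : D) : N.base (N.next d) = N.base d := (N.exists_next d).choose_spec.1

theorem next_le {d f : D} (h : N.base f = N.base d) :
    angle (N.u (N.next d) / N.u d) ≤ angle (N.u f / N.u d) :=
  (N.exists_next d).choose_spec.2 f h

theorem next_lt {d f : D} (h : N.base f = N.base d) (hf : f ≠ N.next d) :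
    angle (N.u (N.next d) / N.u d) < angle (N.u f / N.u d) :=
  lt_of_le_of_ne (N.next_le h) fun he =>
    hf (N.angle_div_u_inj (by rw [base_next, h]) he).symm

theorem base_iterate_next (d : D) (k : ℕ) : N.base (N.next^[k] d) = N.base d := by
  induction k with
  | zero => rfl
  | succ k ih => rw [Function.iterate_succ_apply', base_next, ih]

theorem exists_iterate_next {d d' : D} (h : N.base d' = N.base d) : ∃ k, N.next^[k] d = d' := by
  classical
  by_contra! hne
  obtain ⟨e, he, hmin⟩ := Finset.exists_min_image
    (Finset.univ.filter fun f => ∃ k, N.next^[k] d = f) (fun f => angle (N.u d' / N.u f))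
    ⟨d, by simpa using ⟨0, rfl⟩⟩
  obtain ⟨k, rfl⟩ : ∃ k, N.next^[k] d = e := by simpa using he
  have h1 := hmin (N.next^[k + 1] d) (by simpa using ⟨k + 1, rfl⟩)
  have h2 : d' ≠ N.next (N.next^[k] d) := by
    rw [← Function.iterate_succ_apply' N.next]
    exact (hne _).symm
  have h3 := N.next_lt (d := N.next^[k] d) (f := d') (by rw [h, base_iterate_next]) h2
  rw [Function.iterate_succ_apply', N.angle_div_u_sub h3] at h1
  linarith [angle_pos (N.u (N.next (N.next^[k] d)) / N.u (N.next^[k] d))]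

theorem next_bijective : Function.Bijective N.next := by
  refine Function.Surjective.bijective_of_finite fun d => ?_
  obtain ⟨k, hk⟩ := N.exists_iterate_next (N.base_next d).symm
  exact ⟨N.next^[k] d, by rwa [← Function.iterate_succ_apply' (f := N.next), Function.iterate_succ_apply]⟩

theorem sum_coef_next {z : D → ℝ} (hz : N.IsCirculation z) (d : D) :
    ∑ d', z d' * N.coef (N.next d) d' = ∑ d', z d' * N.coef d d' + 2 * Real.pi * z (N.next d) := by
  classical
  set v := angle (N.u (N.next d) / N.u d)
  have h1 : ∀ d', z d' * N.coef (N.next d) d' = z d' * N.coef d d' +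
      (- v * (if N.base d' = N.base d then z d' else 0) +
        if d' = N.next d then 2 * Real.pi * z (N.next d) else 0) := by
    intro d'
    by_cases h : d' = N.next d
    · rw [h]
      simp [coef, base_next, N.u_ne_zero, angle_one, v]
      ring
    by_cases hb : N.base d' = N.base d
    · simp only [coef, base_next, if_pos hb, if_neg h]
      rw [N.angle_div_u_sub (N.next_lt hb h)]
      ring
    · simp only [coef, base_next, if_neg hb, if_neg h]
      ring
  rw [Finset.sum_congr rfl fun d' _ => h1 d', Finset.sum_add_distrib, Finset.sum_add_distrib,
    ← Finset.mul_sum]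
  have h2 : ∑ d', (if N.base d' = N.base d then z d' else 0) = 0 := by convert hz.div d
  rw [h2]
  simp

/-- The orbits of the face permutation. -/
def Face : Type _ := Quot fun d e : D => e = N.α (N.next d)

instance : Finite N.Face := inferInstanceAs (Finite (Quot _))

theorem sum_coef_face {z : D → ℝ} (hz : N.IsCirculation z) {d e : D}
    (h : (Quot.mk _ d : N.Face) = Quot.mk _ e) :
    ∑ d', z d' * N.coef d d' = ∑ d', z d' * N.coef e d' := by
  let F : N.Face → ℝ := Quot.lift (fun d => ∑ d', z d' * N.coef d d') (by
    rintro d _ rfl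
    rw [sum_coef_α N hz, sum_coef_next N hz]
    ring)
  exact congrArg F h

/-- Euler's inequality for a system of arcs in the plane. -/
theorem card_le : Fintype.card D ≤ 2 * (Nat.card N.Face + (Set.range N.base).ncard) := by
  classical
  have := Fintype.ofFinite N.Face
  let e := Fintype.equivFin D
  let O := {d : D // e d < e (N.α d)}
  let ext : (O → ℝ) →ₗ[ℝ] (D → ℝ) :=
    { toFun := fun y d => if h : e d < e (N.α d) then y ⟨d, h⟩ else
        if h' : e (N.α d) < e (N.α (N.α d)) then - y ⟨N.α d, h'⟩ else 0
      map_add' := by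
        intro x y
        funext d
        simp only [Pi.add_apply]
        split_ifs <;> ring
      map_smul' := by
        intro c y
        funext d
        simp only [Pi.smul_apply, smul_eq_mul, RingHom.id_apply]
        split_ifs <;> ring }
  have htri : ∀ d, ¬ e d < e (N.α d) → e (N.α d) < e d := fun d h =>
    lt_of_le_of_ne (not_lt.1 h) fun h' => N.α_ne d (e.injective h')
  have hanti : ∀ y d, ext y (N.α d) = - ext y d := by
    intro y d
    simp only [ext, LinearMap.coe_mk, AddHom.coe_mk]
    by_cases h : e d < e (N.α d)
    · have h2 : ¬ e (N.α d) < e (N.α (N.α d)) := by rw [N.α_α]; exact h.asymm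
      simp only [h, h2, dif_pos, dif_neg, not_false_iff]
      simp only [N.α_α, h, dif_pos]
    · have h2 : e (N.α d) < e (N.α (N.α d)) := by rw [N.α_α]; exact htri d h
      simp only [h, h2, dif_pos, dif_neg, not_false_iff]
      simp
  have hcard : Fintype.card D = 2 * Fintype.card O := by
    have h1 : Fintype.card {d : D // ¬ e d < e (N.α d)} = Fintype.card O := by
      refine Fintype.card_congr ⟨fun d => ⟨N.α d.1, by rw [N.α_α]; exact htri _ d.2⟩,
        fun d => ⟨N.α d.1, by rw [N.α_α]; exact d.2.asymm⟩, ?_, ?_⟩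
      · intro d; simp [N.α_α]
      · intro d; simp [N.α_α]
    have h2 := Fintype.card_subtype_compl (fun d : D => e d < e (N.α d))
    have h3 := Fintype.card_subtype_le (fun d : D => e d < e (N.α d))
    change _ = 2 * Fintype.card {d : D // e d < e (N.α d)}
    change _ = Fintype.card {d : D // e d < e (N.α d)} at h1
    omega
  let T : (O → ℝ) →ₗ[ℝ] (N.Face → ℝ) × (Set.range N.base → ℝ) :=
    LinearMap.prod
      (LinearMap.pi fun f => ∑ d', N.coef (Quot.out f) d' • (LinearMap.proj d' ∘ₗ ext))
      (LinearMap.pi fun p => ∑ d, (if N.base d = p then (1 : ℝ) else 0) • (LinearMap.proj d ∘ₗ ext))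
  have hT : Function.Injective T := by
    rw [← LinearMap.ker_eq_bot, LinearMap.ker_eq_bot']
    intro y hy
    have hz : N.IsCirculation (ext y) := by
      refine ⟨hanti y, fun d' => ?_⟩
      have := congrFun (congrArg Prod.snd hy) ⟨N.base d', d', rfl⟩
      simp [T] at this
      refine Eq.trans (Finset.sum_congr (by congr!) fun d _ => ?_) this
      split_ifs <;> simp
    have hfst : ∀ f : N.Face, (T y).1 f = ∑ d', ext y d' * N.coef (Quot.out f) d' := by
      intro f
      simp [T, mul_comm]
    have h0 : ∀ d, ∑ d', ext y d' * N.coef d d' = 0 := by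
      intro d
      have := congrFun (congrArg Prod.fst hy) (Quot.mk _ d)
      rw [sum_coef_face N hz (e := Quot.out (Quot.mk _ d : N.Face)) (Quot.out_eq _).symm]
      exact (hfst _).symm.trans this
    have hzero : ∀ d, ext y d = 0 := by
      intro d
      have := sum_coef_α N hz d
      rw [h0, h0] at this
      have hpi := Real.pi_pos
      nlinarith
    funext o
    have := hzero o.1
    simp only [ext, LinearMap.coe_mk, AddHom.coe_mk] at this
    rw [dif_pos o.2] at this
    exact this
  have h := LinearMap.finrank_le_finrank_of_injective hT
  rw [Module.finrank_prod, Module.finrank_pi, Module.finrank_pi, Module.finrank_pi] at h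
  rw [hcard, Nat.card_eq_fintype_card, Set.ncard_eq_toFinset_card', Set.toFinset_card]
  omega

end NiceArcs

open Set

/-- Finitely many oriented arcs in the complex plane, closed under reversal, that meet only at
their endpoints. -/
structure ArcSystem (D : Type*) where
  α : D → D
  α_α : ∀ d, α (α d) = d
  γ : D → ℝ → ℂ
  cont : ∀ d, Continuous (γ d)
  symm : ∀ d t, γ (α d) t = γ d (1 - t)
  inj : ∀ d, InjOn (γ d) (Icc 0 1)
  disj : ∀ d d', d' ≠ d → d' ≠ α d → ∀ s ∈ Icc (0 : ℝ) 1, ∀ t ∈ Icc (0 : ℝ) 1,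
    γ d s = γ d' t → s = 0 ∨ s = 1

namespace ArcSystem

variable {D : Type*} (A : ArcSystem D)

theorem exists_lt_norm {f : ℝ → ℂ} (hf : Continuous f) {a b : ℝ} {p : ℂ}
    (h : ∀ t ∈ Icc a b, f t ≠ p) : ∃ ε > 0, ∀ t ∈ Icc a b, 2 * ε < ‖f t - p‖ := by
  rcases (Icc a b).eq_empty_or_nonempty with he | hne
  · exact ⟨1, one_pos, by simp [he]⟩
  obtain ⟨x, hx, hmin⟩ := isCompact_Icc.exists_isMinOn hne
    (f := fun t => ‖f t - p‖) (Continuous.continuousOn (by fun_prop))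
  have hpos : 0 < ‖f x - p‖ := norm_pos_iff.2 (sub_ne_zero.2 (h x hx))
  refine ⟨‖f x - p‖ / 3, by positivity, fun t ht => ?_⟩
  have : ‖f x - p‖ ≤ ‖f t - p‖ := hmin ht
  linarith

theorem symm_zero (d : D) : A.γ (A.α d) 0 = A.γ d 1 := by simp [A.symm]

theorem zero_ne_one (d : D) : A.γ d 0 ≠ A.γ d 1 := by
  intro h
  have := A.inj d (by norm_num) (by norm_num) h
  norm_num at this

theorem exists_radius [Finite D] : ∃ ε > 0, (∀ d, ∀ t ∈ Icc (1 / 3 : ℝ) 1, 2 * ε < ‖A.γ d t - A.γ d 0‖) ∧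
    ∀ d d', A.γ d' 0 ≠ A.γ d 0 → A.γ d' 0 ≠ A.γ d 1 → ∀ t ∈ Icc (0 : ℝ) 1,
      2 * ε < ‖A.γ d t - A.γ d' 0‖ := by
  classical
  have h1 : ∀ d, ∃ ε > 0, ∀ t ∈ Icc (1 / 3 : ℝ) 1, 2 * ε < ‖A.γ d t - A.γ d 0‖ := fun d =>
    exists_lt_norm (A.cont d) fun t ht he => by
      have := A.inj d ⟨by linarith [ht.1], ht.2⟩ (by norm_num) he
      linarith [ht.1]
  have h2 : ∀ p : D × D, ∃ ε > 0, A.γ p.2 0 ≠ A.γ p.1 0 → A.γ p.2 0 ≠ A.γ p.1 1 →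
      ∀ t ∈ Icc (0 : ℝ) 1, 2 * ε < ‖A.γ p.1 t - A.γ p.2 0‖ := by
    rintro ⟨d, d'⟩
    by_cases h : A.γ d' 0 ≠ A.γ d 0 ∧ A.γ d' 0 ≠ A.γ d 1
    · obtain ⟨ε, hε, hlt⟩ := exists_lt_norm (A.cont d) (a := 0) (b := 1) (p := A.γ d' 0) (by
        intro t ht he
        by_cases hd : d' = d
        · exact h.1 (by rw [hd])
        by_cases hd' : d' = A.α d
        · exact h.2 (by rw [hd', symm_zero])
        rcases A.disj d d' hd hd' t ht 0 (by norm_num) he with h0 | h0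
        · rw [h0] at he; exact h.1 he.symm
        · rw [h0] at he; exact h.2 he.symm)
      exact ⟨ε, hε, fun _ _ => hlt⟩
    · exact ⟨1, one_pos, fun ha hb => absurd ⟨ha, hb⟩ h⟩
  choose f hf hf' using h1
  choose g hg hg' using h2
  have := Fintype.ofFinite D
  obtain ⟨ε, hε, hle⟩ : ∃ ε > 0, ∀ x : D ⊕ D × D, ε ≤ Sum.elim f g x := by
    rcases isEmpty_or_nonempty D with he | he
    · exact ⟨1, one_pos, fun x => by rcases x with x | x <;> exact (he.false (by first | exact x | exact x.1)).elim⟩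
    obtain ⟨x, hx⟩ := Finite.exists_min (Sum.elim f g)
    exact ⟨Sum.elim f g x, by rcases x with x | x; exacts [hf x, hg x], hx⟩
  refine ⟨ε, hε, fun d t ht => ?_, fun d d' h h' t ht => ?_⟩
  · have := hf' d t ht
    have h2 := hle (Sum.inl d)
    simp at h2
    linarith
  · have := hg' (d, d') h h' t ht
    have h2 := hle (Sum.inr (d, d'))
    simp at h2
    simp only at this
    linarith

theorem exists_exit {ε : ℝ} (hε : 0 < ε) (d : D)
    (h : ∀ t ∈ Icc (1 / 3 : ℝ) 1, 2 * ε < ‖A.γ d t - A.γ d 0‖) :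
    ∃ s, 0 < s ∧ s < 1 / 3 ∧ ‖A.γ d s - A.γ d 0‖ = ε ∧
      ∀ t ∈ Icc s 1, ε ≤ ‖A.γ d t - A.γ d 0‖ := by
  have hc : Continuous fun t => ‖A.γ d t - A.γ d 0‖ := by have := A.cont d; fun_prop
  let S := {t | t ∈ Icc (0 : ℝ) 1 ∧ ‖A.γ d t - A.γ d 0‖ ≤ ε}
  have hS : IsCompact S := by
    have : S = Icc 0 1 ∩ {t | ‖A.γ d t - A.γ d 0‖ ≤ ε} := rfl
    rw [this]
    exact isCompact_Icc.inter_right (isClosed_le hc continuous_const)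
  have hne : S.Nonempty := ⟨0, by norm_num, by simpa using hε.le⟩
  obtain ⟨s, hs, hmax⟩ := hS.exists_isGreatest hne
  have hs3 : s < 1 / 3 := by
    by_contra! hcon
    have := h s ⟨hcon, hs.1.2⟩
    linarith [hs.2]
  have hgt : ∀ t ∈ Icc s 1, s < t → ε < ‖A.γ d t - A.γ d 0‖ := by
    intro t ht hlt
    by_contra! hcon
    have := hmax (a := t) ⟨⟨hs.1.1.trans ht.1, ht.2⟩, hcon⟩
    linarith
  have heq : ‖A.γ d s - A.γ d 0‖ = ε := by
    refine le_antisymm hs.2 ?_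
    have hmem : s ∈ closure (Ioc s 1) := by
      rw [closure_Ioc (by linarith)]
      exact ⟨le_rfl, by linarith⟩
    exact (isClosed_le (continuous_const (y := ε)) hc).closure_subset_iff.2
      (fun t ht => (hgt t ⟨ht.1.le, ht.2⟩ ht.1).le) hmem
  refine ⟨s, ?_, hs3, heq, ?_⟩
  · refine lt_of_le_of_ne hs.1.1 fun h0 => ?_
    rw [← h0] at heq
    simp at heq
    linarith
  · intro t ht
    rcases ht.1.eq_or_lt with h | h
    · rw [← h, heq]
    · exact (hgt t ht h).le

theorem exists_niceArcs [Finite D] : ∃ N : NiceArcs D, N.α = A.α ∧ ∀ d, N.base d = A.γ d 0 := by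
  obtain ⟨ε, hε, hfar, haway⟩ := A.exists_radius
  choose s hs0 hs3 hsε hsfar using fun d => A.exists_exit hε d (hfar d)
  let x : D → ℂ := fun d => A.γ d (s d)
  let rad : D → ℝ → ℂ := fun d t => A.γ d 0 + t * (x d - A.γ d 0)
  let mid : D → ℝ → ℝ := fun d t => s d + (3 * t - 1) * (1 - s (A.α d) - s d)
  have hαne : ∀ d, A.α d ≠ d := fun d h => A.zero_ne_one d (by rw [← A.symm_zero, h])
  have hlen : ∀ d, 0 < 1 - s (A.α d) - s d := fun d => by linarith [hs3 d, hs3 (A.α d)]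
  have hmid : ∀ d, ∀ t ∈ Icc (1 / 3 : ℝ) (2 / 3), s d ≤ mid d t ∧ mid d t ≤ 1 - s (A.α d) := by
    intro d t ht
    have := hlen d
    have h1 := ht.1
    have h2 := ht.2
    constructor <;> simp only [mid] <;> nlinarith
  have hrad : ∀ d, ∀ t ∈ Icc (0 : ℝ) 1, ‖rad d t - A.γ d 0‖ = t * ε := by
    intro d t ht
    simp only [rad, x, add_sub_cancel_left, norm_mul, hsε, Complex.norm_real,
      Real.norm_of_nonneg ht.1]
  have hmidfar : ∀ d d', ∀ t, s d ≤ t → t ≤ 1 - s (A.α d) → ε ≤ ‖A.γ d t - A.γ d' 0‖ := by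
    intro d d' t h1 h2
    have h3 := hs0 d
    have h4 := hs0 (A.α d)
    by_cases h : A.γ d' 0 = A.γ d 0
    · rw [h]
      exact hsfar d t ⟨h1, by linarith⟩
    by_cases h' : A.γ d' 0 = A.γ d 1
    · rw [h', ← A.symm_zero]
      have := hsfar (A.α d) (1 - t) ⟨by linarith, by linarith⟩
      rwa [A.symm d, sub_sub_cancel] at this
    · have := haway d d' h h' t ⟨by linarith, by linarith⟩
      linarith
  have hbase : ∀ d d', A.γ d' 0 ≠ A.γ d 0 → 2 * ε < ‖A.γ d 0 - A.γ d' 0‖ := by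
    intro d d' h
    by_cases h' : A.γ d' 0 = A.γ d 1
    · rw [h', norm_sub_rev]
      exact hfar d 1 (by norm_num)
    · exact haway d d' h h' 0 (by norm_num)
  have hrr : ∀ d d', d' ≠ d → ∀ t ∈ Icc (0 : ℝ) 1, ∀ t' ∈ Icc (0 : ℝ) 1, rad d t = rad d' t' →
      A.γ d' 0 = A.γ d 0 ∧ t = 0 := by
    intro d d' hne t ht t' ht' he
    have e1 := hrad d t ht
    have e2 := hrad d' t' ht'
    have hb : A.γ d' 0 = A.γ d 0 := by
      by_contra hb
      have e3 := hbase d d' hb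
      have e4 : A.γ d 0 - A.γ d' 0 = (rad d' t' - A.γ d' 0) - (rad d t - A.γ d 0) := by
        rw [he]; ring
      have e5 := norm_sub_le (rad d' t' - A.γ d' 0) (rad d t - A.γ d 0)
      rw [← e4, e1, e2] at e5
      nlinarith [ht.2, ht'.2]
    refine ⟨hb, ?_⟩
    by_contra ht0
    rw [he, ← hb, e2] at e1
    have e3 : t' = t := by
      have := mul_right_cancel₀ hε.ne' e1
      exact this
    subst e3
    have e4 : x d = x d' := by
      simp only [rad, hb] at he
      have ht0' : (t' : ℂ) ≠ 0 := by exact_mod_cast ht0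
      have := mul_left_cancel₀ ht0' (add_left_cancel he)
      exact sub_left_injective this
    have hd' : d' ≠ A.α d := by
      rintro rfl
      rw [symm_zero] at hb
      exact A.zero_ne_one d hb.symm
    have h0 := hs0 d
    have h3 := hs3 d
    rcases A.disj d d' hne hd' (s d) ⟨by linarith, by linarith⟩ (s d')
      ⟨(hs0 d').le, by linarith [hs3 d']⟩ e4 with h | h <;> linarith
  have hrm : ∀ d d', ∀ t ∈ Icc (0 : ℝ) 1, ∀ t', s d' ≤ t' → t' ≤ 1 - s (A.α d') →
      rad d t = A.γ d' t' → (d' = d ∨ d' = A.α d) ∧ t = 1 := by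
    intro d d' t ht t' h1 h2 he
    have e1 := hmidfar d' d t' h1 h2
    rw [← he, hrad d t ht] at e1
    have ht1 : t = 1 := by
      refine le_antisymm ht.2 ?_
      by_contra! hlt
      nlinarith
    subst ht1
    refine ⟨?_, rfl⟩
    by_contra! hcon
    have h0 := hs0 d
    have h3 := hs3 d
    have e2 : A.γ d (s d) = A.γ d' t' := by
      rw [← he]
      simp [rad, x]
    rcases A.disj d d' hcon.1 hcon.2 (s d) ⟨by linarith, by linarith⟩ t'
      ⟨by linarith [hs0 d'], by linarith [hs0 (A.α d')]⟩ e2 with h | h <;> linarith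
  let Γ : D → ℝ → ℂ := fun d t => if t ≤ 1 / 3 then rad d (3 * t) else
    if t ≤ 2 / 3 then A.γ d (mid d t) else rad (A.α d) (3 * (1 - t))
  have hΓ1 : ∀ d t, t ≤ 1 / 3 → Γ d t = rad d (3 * t) := fun d t h => if_pos h
  have hΓ2 : ∀ d, ∀ t, 1 / 3 ≤ t → t ≤ 2 / 3 → Γ d t = A.γ d (mid d t) := by
    intro d t h h'
    rcases h.eq_or_lt with h | h
    · rw [hΓ1 d t h.ge, ← h]
      norm_num [rad, mid, x]
    · simp only [Γ]
      rw [if_neg (not_le.2 h), if_pos h']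
  have hΓ3 : ∀ d, ∀ t, 2 / 3 ≤ t → Γ d t = rad (A.α d) (3 * (1 - t)) := by
    intro d t h
    rcases h.eq_or_lt with h | h
    · rw [hΓ2 d t (by linarith) h.ge, ← h]
      norm_num [rad, mid, x, A.symm]
    · simp only [Γ]
      rw [if_neg (by linarith), if_neg (by linarith)]
  have hcont : ∀ d, Continuous (Γ d) := by
    intro d
    have := A.cont d
    refine Continuous.if_le (by fun_prop) ?_ continuous_id continuous_const ?_
    · refine Continuous.if_le (by fun_prop) (by fun_prop) continuous_id continuous_const ?_
      intro t ht
      rw [← hΓ2 d t (by linarith) ht.le, hΓ3 d t ht.ge]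
    · intro t ht
      rw [← hΓ1 d t ht.le, hΓ2 d t ht.ge (by linarith), if_pos (by linarith)]
  have hsymm : ∀ d t, Γ (A.α d) t = Γ d (1 - t) := by
    intro d t
    rcases le_total t (1 / 3) with h | h
    · rw [hΓ1 _ _ h, hΓ3 _ _ (by linarith), sub_sub_cancel]
    rcases le_total t (2 / 3) with h' | h'
    · rw [hΓ2 _ _ h h', hΓ2 _ _ (by linarith) (by linarith), A.symm]
      congr 1
      simp only [mid, A.α_α]
      ring
    · rw [hΓ3 _ _ h', hΓ1 _ _ (by linarith), A.α_α]
  have hmem1 : ∀ t : ℝ, 0 ≤ t → t ≤ 1 / 3 → 3 * t ∈ Icc (0 : ℝ) 1 := fun t h h' =>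
    ⟨by linarith, by linarith⟩
  have hmem3 : ∀ t : ℝ, t ≤ 1 → 2 / 3 ≤ t → 3 * (1 - t) ∈ Icc (0 : ℝ) 1 := fun t h h' =>
    ⟨by linarith, by linarith⟩
  refine ⟨{ α := A.α, α_α := A.α_α, γ := Γ, cont := hcont, symm := hsymm, inj := ?_, disj := ?_,
            ε := ε, ε_pos := hε, u := fun d => (x d - A.γ d 0) / ε, norm_u := ?_, radial := ?_,
            far := ?_, away := ?_ }, rfl, ?_⟩
  · intro d t ht t' ht' he
    have hb := A.zero_ne_one d
    rw [← symm_zero] at hb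
    -- reduce to `t ≤ t'`
    wlog hle : t ≤ t' generalizing t t'
    · exact (this ht' ht he.symm (by linarith)).symm
    have h0 := hs0 d
    have h0' := hs0 (A.α d)
    rcases le_total t (1 / 3) with h | h
    · rw [hΓ1 _ _ h] at he
      rcases le_total t' (1 / 3) with h' | h'
      · rw [hΓ1 _ _ h'] at he
        have e1 := hrad d _ (hmem1 t ht.1 h)
        have e2 := hrad d _ (hmem1 t' ht'.1 h')
        rw [he, e2] at e1
        have := mul_right_cancel₀ hε.ne' e1
        linarith
      rcases le_total t' (2 / 3) with h'' | h''
      · rw [hΓ2 _ _ h' h''] at he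
        have hm := hmid d t' ⟨h', h''⟩
        have := (hrm d d _ (hmem1 t ht.1 h) _ hm.1 hm.2 he).2
        have ht3 : t = 1 / 3 := by linarith
        rw [this] at he
        have e2 : A.γ d (s d) = A.γ d (mid d t') := by rw [← he]; simp [rad, x]
        have e3 := A.inj d ⟨h0.le, by linarith⟩ ⟨by linarith, by linarith⟩ e2
        simp only [mid] at e3
        have := hlen d
        have e4 : (3 * t' - 1) * (1 - s (A.α d) - s d) = 0 := by linarith
        rcases mul_eq_zero.1 e4 with h | h <;> linarith
      · rw [hΓ3 _ _ h''] at he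
        exact absurd (hrr d (A.α d) (hαne d) _ (hmem1 t ht.1 h) _ (hmem3 t' ht'.2 h'') he).1 hb.symm
    rcases le_total t (2 / 3) with h2 | h2
    · rw [hΓ2 _ _ h h2] at he
      have hm := hmid d t ⟨h, h2⟩
      rcases le_total t' (2 / 3) with h' | h'
      · rw [hΓ2 _ _ (h.trans hle) h'] at he
        have hm' := hmid d t' ⟨h.trans hle, h'⟩
        have e3 := A.inj d ⟨by linarith, by linarith⟩ ⟨by linarith, by linarith⟩ he
        simp only [mid] at e3
        have := hlen d
        have e4 := mul_right_cancel₀ this.ne' (add_left_cancel e3)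
        linarith
      · rw [hΓ3 _ _ h'] at he
        have := (hrm (A.α d) d _ (hmem3 t' ht'.2 h') _ hm.1 hm.2 he.symm).2
        have ht3 : t' = 2 / 3 := by linarith
        rw [this] at he
        have e2 : A.γ d (mid d t) = A.γ d (1 - s (A.α d)) := by rw [he]; simp [rad, x, A.symm]
        have e3 := A.inj d ⟨by linarith, by linarith⟩ ⟨by linarith [hs3 (A.α d)], by linarith⟩ e2
        simp only [mid] at e3
        have := hlen d
        have e4 : (3 * t - 2) * (1 - s (A.α d) - s d) = 0 := by linarith
        rcases mul_eq_zero.1 e4 with h | h <;> linarith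
    · rw [hΓ3 _ _ h2, hΓ3 _ _ (h2.trans hle)] at he
      have e1 := hrad (A.α d) _ (hmem3 t ht.2 h2)
      have e2 := hrad (A.α d) _ (hmem3 t' ht'.2 (h2.trans hle))
      rw [he, e2] at e1
      have := mul_right_cancel₀ hε.ne' e1
      linarith
  · intro d d' hne hne' t ht t' ht' he
    have hne2 : A.α d' ≠ d := fun h => hne' (by rw [← h, A.α_α])
    have hne3 : A.α d' ≠ A.α d := fun h => hne (by rw [← A.α_α d', h, A.α_α])
    rcases le_total t (1 / 3) with h | h
    · left
      rw [hΓ1 _ _ h] at he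
      rcases le_total t' (1 / 3) with h' | h'
      · rw [hΓ1 _ _ h'] at he
        linarith [(hrr d d' hne _ (hmem1 t ht.1 h) _ (hmem1 t' ht'.1 h') he).2]
      rcases le_total t' (2 / 3) with h'' | h''
      · rw [hΓ2 _ _ h' h''] at he
        have hm := hmid d' t' ⟨h', h''⟩
        exact absurd (hrm d d' _ (hmem1 t ht.1 h) _ hm.1 hm.2 he).1 (by tauto)
      · rw [hΓ3 _ _ h''] at he
        linarith [(hrr d (A.α d') hne2 _ (hmem1 t ht.1 h) _ (hmem3 t' ht'.2 h'') he).2]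
    rcases le_total t (2 / 3) with h2 | h2
    · exfalso
      rw [hΓ2 _ _ h h2] at he
      have hm := hmid d t ⟨h, h2⟩
      rcases le_total t' (1 / 3) with h' | h'
      · rw [hΓ1 _ _ h'] at he
        have := (hrm d' d _ (hmem1 t' ht'.1 h') _ hm.1 hm.2 he.symm).1
        rcases this with h | h
        · exact hne h.symm
        · exact hne2 h.symm
      rcases le_total t' (2 / 3) with h'' | h''
      · rw [hΓ2 _ _ h' h''] at he
        have hm' := hmid d' t' ⟨h', h''⟩
        have h0 := hs0 d
        have h0' := hs0 (A.α d)
        have h1 := hs0 d'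
        have h1' := hs0 (A.α d')
        rcases A.disj d d' hne hne' _ ⟨by linarith, by linarith⟩ _ ⟨by linarith, by linarith⟩ he with
          h | h <;> linarith
      · rw [hΓ3 _ _ h''] at he
        have := (hrm (A.α d') d _ (hmem3 t' ht'.2 h'') _ hm.1 hm.2 he.symm).1
        rw [A.α_α] at this
        rcases this with h | h
        · exact hne2 h.symm
        · exact hne h.symm
    · right
      rw [hΓ3 _ _ h2] at he
      rcases le_total t' (1 / 3) with h' | h'
      · rw [hΓ1 _ _ h'] at he
        linarith [(hrr (A.α d) d' hne' _ (hmem3 t ht.2 h2) _ (hmem1 t' ht'.1 h') he).2]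
      rcases le_total t' (2 / 3) with h'' | h''
      · rw [hΓ2 _ _ h' h''] at he
        have hm := hmid d' t' ⟨h', h''⟩
        have := (hrm (A.α d) d' _ (hmem3 t ht.2 h2) _ hm.1 hm.2 he).1
        rw [A.α_α] at this
        exact absurd this (by tauto)
      · rw [hΓ3 _ _ h''] at he
        linarith [(hrr (A.α d) (A.α d') hne3 _ (hmem3 t ht.2 h2) _ (hmem3 t' ht'.2 h'') he).2]
  · intro d
    rw [norm_div, hsε, Complex.norm_real, Real.norm_of_nonneg hε.le, div_self hε.ne']
  · intro d t ht
    have hε' : (ε : ℂ) ≠ 0 := by exact_mod_cast hε.ne'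
    rw [hΓ1 _ _ ht.2, hΓ1 _ _ (by norm_num)]
    simp only [rad]
    push_cast
    field_simp
    ring
  · intro d t ht
    rw [hΓ1 d 0 (by norm_num)]
    have e0 : rad d (3 * 0) = A.γ d 0 := by simp [rad]
    rw [e0]
    rcases le_total t (2 / 3) with h | h
    · rw [hΓ2 _ _ ht.1 h]
      have hm := hmid d t ⟨ht.1, h⟩
      exact hmidfar d d _ hm.1 hm.2
    · rw [hΓ3 _ _ h]
      have e1 := hrad (A.α d) _ (hmem3 t ht.2 h)
      have e2 := hbase d (A.α d) (by rw [symm_zero]; exact (A.zero_ne_one d).symm)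
      have e3 := norm_sub_le (A.γ (A.α d) 0 - rad (A.α d) (3 * (1 - t)))
        (A.γ d 0 - rad (A.α d) (3 * (1 - t)))
      rw [sub_sub_sub_cancel_right, norm_sub_rev (A.γ (A.α d) 0), norm_sub_rev (A.γ (A.α d) 0), e1,
        norm_sub_rev (A.γ d 0) (rad _ _)] at e3
      have := (hmem3 t ht.2 h).2
      nlinarith
  · intro d d' h h' t ht
    have e0 : ∀ d, Γ d 0 = A.γ d 0 := fun d => by rw [hΓ1 d 0 (by norm_num)]; simp [rad]
    have e1 : Γ d 1 = A.γ d 1 := by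
      have := hsymm d 0
      rw [sub_zero] at this
      rw [← this, e0, symm_zero]
    rw [e0, e0] at h
    rw [e0, e1] at h'
    rw [e0]
    have key : ∀ d, A.γ d' 0 ≠ A.γ d 0 → ∀ t ∈ Icc (0 : ℝ) 1, ε < ‖rad d t - A.γ d' 0‖ := by
      intro d hd t ht
      have e2 := hbase d d' hd
      have e3 := hrad d t ht
      have e4 := norm_sub_le (rad d t - A.γ d' 0) (rad d t - A.γ d 0)
      rw [sub_sub_sub_cancel_left, e3] at e4
      nlinarith [ht.2]
    rcases le_total t (1 / 3) with h1 | h1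
    · rw [hΓ1 _ _ h1]
      exact key d h _ (hmem1 t ht.1 h1)
    rcases le_total t (2 / 3) with h2 | h2
    · rw [hΓ2 _ _ h1 h2]
      have hm := hmid d t ⟨h1, h2⟩
      have := haway d d' h h' (mid d t) ⟨by linarith [hs0 d], by linarith [hs0 (A.α d)]⟩
      linarith
    · rw [hΓ3 _ _ h2]
      exact key (A.α d) (by rw [symm_zero]; exact h') _ (hmem3 t ht.2 h2)
  · intro d
    change Γ d 0 = _
    rw [hΓ1 d 0 (by norm_num)]
    simp [rad]

end ArcSystem

/-- A combinatorial description of a drawing of `G` in which every edge is a strand passing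
through at most three crossings.  Darts are the pieces of the strands, `α` reverses a dart,
`ρ` is the rotation at the initial point of a dart, and `opp` continues a strand backwards
through a crossing. -/
structure StrandMap {V : Type} (G : SimpleGraph V) (n : ℕ) (D Φ : Type) where
  α : D → D
  ρ : Equiv.Perm D
  opp : D → D
  real : D → Prop
  lab : D → G.Dart
  rank : D → ℕ
  face : D → Φ
  α_α : ∀ d, α (α d) = d
  lab_α : ∀ d, lab (α d) = (lab d).symm
  real_ρ : ∀ d, real (ρ d) ↔ real d
  fst_ρ : ∀ d, real d → (lab (ρ d)).fst = (lab d).fst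
  lab_inj : ∀ d d', real d → real d' → lab d = lab d' → d = d'
  exists_real : ∀ a, ∃ d, real d ∧ lab d = a
  opp_opp : ∀ d, ¬ real d → opp (opp d) = d
  opp_ne : ∀ d, ¬ real d → opp d ≠ d
  lab_opp : ∀ d, ¬ real d → lab (opp d) = (lab d).symm
  ρ_four : ∀ d, ¬ real d → ρ (ρ (ρ (ρ d))) = d
  ρ_ne : ∀ d, ρ d ≠ d
  ρ_two_ne : ∀ d, ¬ real d → ρ (ρ d) ≠ d
  opp_near : ∀ d, ¬ real d → opp d = d ∨ opp d = ρ d ∨ opp d = ρ (ρ d) ∨ opp d = ρ (ρ (ρ d))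
  edge_ne : ∀ d d', ¬ real d → (d' = d ∨ d' = ρ d ∨ d' = ρ (ρ d) ∨ d' = ρ (ρ (ρ d))) →
    d' ≠ d → d' ≠ opp d → (lab d').edge ≠ (lab d).edge
  rank_pos : ∀ d, ¬ real d → 0 < rank d
  rank_le : ∀ d, ¬ real d → rank d ≤ 3
  rank_lt : ∀ d, ¬ real (α d) → rank d < rank (opp (α d))
  face_α : ∀ d, face (α (ρ d)) = face d
  euler : 2 * Nat.card D ≤ 4 * (Set.range face).ncard + 4 * n + {d | ¬ real d}.ncard

namespace StrandMap

variable {V : Type} {G : SimpleGraph V} {n : ℕ} {D Φ : Type} (S : StrandMap G n D Φ)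

/-- Two darts starting at the same crossing. -/
def Near (d d' : D) : Prop :=
  d' = d ∨ d' = S.ρ d ∨ d' = S.ρ (S.ρ d) ∨ d' = S.ρ (S.ρ (S.ρ d))

variable {S}

theorem Near.refl (d : D) : S.Near d d := Or.inl rfl

theorem near_ρ (d : D) : S.Near d (S.ρ d) := Or.inr (Or.inl rfl)

theorem near_opp {d : D} (h : ¬ S.real d) : S.Near d (S.opp d) := S.opp_near d h

theorem Near.real_iff {d d' : D} (h : S.Near d d') : S.real d' ↔ S.real d := by
  rcases h with rfl | rfl | rfl | rfl <;> simp [S.real_ρ]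

theorem Near.symm {d d' : D} (h : S.Near d d') (hd : ¬ S.real d) : S.Near d' d := by
  have := S.ρ_four d hd
  unfold Near
  rcases h with rfl | rfl | rfl | rfl <;> grind

theorem Near.trans {d d' d'' : D} (h : S.Near d d') (h' : S.Near d' d'') (hd : ¬ S.real d) :
    S.Near d d'' := by
  have := S.ρ_four d hd
  unfold Near at *
  rcases h with rfl | rfl | rfl | rfl <;> grind

theorem not_real_opp {d : D} (h : ¬ S.real d) : ¬ S.real (S.opp d) := by
  rwa [(near_opp h).real_iff]

theorem Near.edge_ne {d d' : D} (h : S.Near d d') (hd : ¬ S.real d) (h1 : d' ≠ d)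
    (h2 : d' ≠ S.opp d) : (S.lab d').edge ≠ (S.lab d).edge := S.edge_ne d d' hd h h1 h2

theorem edge_α (d : D) : (S.lab (S.α d)).edge = (S.lab d).edge := by
  rw [S.lab_α, SimpleGraph.Dart.edge_symm]

theorem edge_opp {d : D} (h : ¬ S.real d) : (S.lab (S.opp d)).edge = (S.lab d).edge := by
  rw [S.lab_opp d h, SimpleGraph.Dart.edge_symm]

theorem lab_ne_symm (a : G.Dart) : a.symm ≠ a := SimpleGraph.Dart.symm_ne a

theorem α_inj {d d' : D} (h : S.α d = S.α d') : d = d' := by rw [← S.α_α d, h, S.α_α]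

theorem α_ne (d : D) : S.α d ≠ d := fun h => lab_ne_symm (S.lab d) (by rw [← S.lab_α, h])

/-- Relabelling the strands of a map by an involution `ι` exchanging portions of two strands. -/
theorem exists_switch (ι : D → D) (hιι : ∀ d, ι (ι d) = d) (hια : ∀ d, ι (S.α d) = S.α (ι d))
    (hreal : ∀ d, S.real (ι d) ↔ S.real d)
    (hfst : ∀ d, S.real d → (S.lab (ι d)).fst = (S.lab d).fst)
    {A B : Sym2 V} (hAB : A ≠ B)
    (hedge : ∀ d, ι d ≠ d → ((S.lab d).edge = A ∧ (S.lab (ι d)).edge = B) ∨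
      ((S.lab d).edge = B ∧ (S.lab (ι d)).edge = A))
    (hin : ∀ d, ¬ S.real d → ι d ≠ d → ι (S.opp d) ≠ S.opp d → ι (S.opp d) = S.opp (ι d))
    (hend : ∀ d, ¬ S.real d → ι d ≠ d → ι (S.opp d) = S.opp d → S.Near d (ι d))
    (hrung : ∀ d d', ¬ S.real d → ι d ≠ d → ι (S.opp d) ≠ S.opp d → S.Near d d' → d' ≠ d →
      d' ≠ S.opp d → (S.lab d').edge ≠ A ∧ (S.lab d').edge ≠ B) :
    ∃ S' : StrandMap G n D Φ, S'.ρ = S.ρ ∧ S'.real = S.real ∧ ∀ d, S'.opp d = ι (S.opp (ι d)) := by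
  have hnr : ∀ {d}, ¬ S.real d → ¬ S.real (ι d) := fun h => by rwa [hreal]
  have hnear : ∀ d, ¬ S.real d → S.Near d (ι (S.opp (ι d))) := by
    intro d hd
    have ho := not_real_opp hd
    by_cases h1 : ι d = d
    · rw [h1]
      by_cases h2 : ι (S.opp d) = S.opp d
      · rw [h2]; exact near_opp hd
      · have := hend (S.opp d) ho h2 (by rw [S.opp_opp d hd]; exact h1)
        exact (near_opp hd).trans this hd
    · have h1' : ι (ι d) ≠ ι d := by rw [hιι]; exact Ne.symm h1
      by_cases h2 : ι (S.opp d) = S.opp d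
      · by_cases h3 : ι (S.opp (ι d)) = S.opp (ι d)
        · rw [h3]
          exact (hend d hd h1 h2).trans (near_opp (hnr hd)) hd
        · rw [hin (ι d) (hnr hd) h1' h3, hιι]
          exact near_opp hd
      · rw [← hin d hd h1 h2, hιι]
        exact near_opp hd
  have hone : ∀ d d', ¬ S.real d → S.Near d d' → ι d ≠ d → ι d' = d' →
      (S.lab (ι d')).edge = (S.lab (ι d)).edge → d' = ι (S.opp (ι d)) := by
    intro d d' hd hn h1 h2 he
    have hne : d' ≠ d := by rintro rfl; exact h1 h2
    by_cases h3 : ι (S.opp d) = S.opp d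
    · have h4 := hend d hd h1 h3
      rw [h2] at he
      have hn' : S.Near (ι d) d' := (h4.symm hd).trans hn (hnr hd)
      have : d' = S.opp (ι d) := by
        by_contra h5
        exact hn'.edge_ne (hnr hd) (by rintro rfl; rw [hιι] at h2; exact h1 h2.symm) h5 he
      rw [← this, h2]
    · by_cases h5 : d' = S.opp d
      · exact absurd h2 (h5 ▸ h3)
      have := hrung d d' hd h1 h3 hn hne h5
      rw [h2] at he
      rcases hedge d h1 with h | h
      · exact absurd (he.trans h.2) this.2
      · exact absurd (he.trans h.2) this.1
  refine ⟨{ S with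
    opp := fun d => ι (S.opp (ι d)), lab := fun d => S.lab (ι d), rank := fun d => S.rank (ι d),
    lab_α := fun d => by rw [hια, S.lab_α]
    fst_ρ := fun d hd => by rw [hfst _ ((S.real_ρ d).2 hd), S.fst_ρ d hd, hfst d hd]
    lab_inj := fun d d' hd hd' h => by
      have := S.lab_inj _ _ ((hreal d).2 hd) ((hreal d').2 hd') h
      rw [← hιι d, this, hιι]
    exists_real := fun a => by
      obtain ⟨d, hd, rfl⟩ := S.exists_real a
      exact ⟨ι d, (hreal d).2 hd, by rw [hιι]⟩
    opp_opp := fun d hd => by simp only [hιι]; rw [S.opp_opp _ (hnr hd), hιι]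
    opp_ne := fun d hd h => S.opp_ne _ (hnr hd) (by
      rw [← hιι (S.opp (ι d))]; exact congrArg ι h)
    lab_opp := fun d hd => by simp only [hιι]; exact S.lab_opp _ (hnr hd)
    opp_near := hnear
    edge_ne := fun d d' hd hn h1 h2 he => ?_
    rank_pos := fun d hd => S.rank_pos _ (hnr hd)
    rank_le := fun d hd => S.rank_le _ (hnr hd)
    rank_lt := fun d hd => by
      simp only [hιι, hια]
      exact S.rank_lt _ (by rw [← hια, hreal]; exact hd) }, rfl, rfl, fun d => rfl⟩
  have hn : S.Near d d' := hn
  have hd' : ¬ S.real d' := by rwa [hn.real_iff]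
  by_cases h3 : ι d = d
  · by_cases h4 : ι d' = d'
    · rw [h3, h4] at he
      rw [h3] at h2
      by_cases h5 : d' = S.opp d
      · rw [← h5, h4] at h2
        exact h2 rfl
      · exact hn.edge_ne hd h1 h5 he
    · have := hone d' d hd' (hn.symm hd) h4 h3 he.symm
      apply h2
      rw [this]
      simp only [hιι]
      rw [S.opp_opp _ (hnr hd'), hιι]
  · by_cases h4 : ι d' = d'
    · exact h2 (hone d d' hd hn h3 h4 he)
    · have he' : (S.lab d').edge = (S.lab d).edge := by
        rcases hedge d h3 with h | h <;> rcases hedge d' h4 with h' | h'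
        · rw [h.1, h'.1]
        · exact absurd (h'.2.symm.trans (he.trans h.2)) hAB
        · exact absurd (h'.2.symm.trans (he.trans h.2)).symm hAB
        · rw [h.1, h'.1]
      have h5 : d' = S.opp d := by
        by_contra h5
        exact hn.edge_ne hd h1 h5 he'
      rw [h5] at h4
      rw [← hin d hd h3 h4, hιι] at h2
      exact h2 h5

end StrandMap

namespace StrandMap

variable {V : Type} {G : SimpleGraph V} {n : ℕ} {D Φ : Type} (S : StrandMap G n D Φ)

theorem α_ρ_four_ne {d : D} (hd : ¬ S.real d) : S.α d ≠ S.opp d := by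
  intro h
  have := S.rank_lt d (by rw [h]; exact not_real_opp hd)
  rw [h, S.opp_opp d hd] at this
  exact lt_irrefl _ this

variable {S}

theorem not_near_α {d d' : D} (hd : ¬ S.real d) (hn : S.Near d d') : ¬ S.Near d (S.α d') := by
  intro h
  have hd' : ¬ S.real d' := by rwa [hn.real_iff]
  exact ((hn.symm hd).trans h hd').edge_ne hd' (α_ne d') (S.α_ρ_four_ne hd') (edge_α d')

theorem ncard_near {d : D} (hd : ¬ S.real d) : {x | S.Near d x}.ncard = 4 := by
  have h4 := S.ρ_four d hd
  have h0 := S.ρ_ne d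
  have h1 := S.ρ_ne (S.ρ d)
  have h2 := S.ρ_ne (S.ρ (S.ρ d))
  have h3 := S.ρ_ne (S.ρ (S.ρ (S.ρ d)))
  have h5 := S.ρ_two_ne d hd
  have h6 := S.ρ_two_ne (S.ρ d) (by rwa [S.real_ρ])
  have hg : S.ρ (S.ρ (S.ρ d)) ≠ d := fun h => h3 (by rw [h4, h])
  have : {x | S.Near d x} = {d, S.ρ d, S.ρ (S.ρ d), S.ρ (S.ρ (S.ρ d))} := by
    ext x; rfl
  rw [this, Set.ncard_insert_of_notMem, Set.ncard_insert_of_notMem, Set.ncard_pair h2.symm]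
  · rintro (h | h)
    exacts [h1.symm h, h6.symm h]
  · rintro (h | h | h)
    exacts [h0.symm h, h5.symm h, hg.symm h]

theorem card_not_near [Finite D] {d : D} (hd : ¬ S.real d) :
    Nat.card {x // ¬ S.Near d x} + 4 = Nat.card D := by
  rw [← ncard_near hd, add_comm]
  exact Set.ncard_add_ncard_compl {x | S.Near d x}

theorem ncard_not_near [Finite D] {d : D} (hd : ¬ S.real d) :
    {x : {x // ¬ S.Near d x} | ¬ S.real x.1}.ncard + 4 = {x | ¬ S.real x}.ncard := by
  have h : {x | ¬ S.real x} =
      Subtype.val '' {x : {x // ¬ S.Near d x} | ¬ S.real x.1} ∪ {x | S.Near d x} := by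
    ext x
    constructor
    · intro h
      by_cases hx : S.Near d x
      · exact Or.inr hx
      · exact Or.inl ⟨⟨x, hx⟩, h, rfl⟩
    · rintro (⟨y, hy, rfl⟩ | h)
      · exact hy
      · exact (Near.real_iff h).not.2 hd
  have h' : Disjoint (Subtype.val '' {x : {x // ¬ S.Near d x} | ¬ S.real x.1})
      {x | S.Near d x} := by
    rw [Set.disjoint_left]
    rintro _ ⟨x, -, rfl⟩ h
    exact x.2 h
  rw [h, Set.ncard_union_eq h' (Set.toFinite _) (Set.toFinite _), ncard_near hd,
    Set.ncard_image_of_injective _ Subtype.val_injective]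

set_option maxHeartbeats 1000000 in
theorem exists_lt_of_opp_eq [Finite D] {d : D} (hd : ¬ S.real d) (hρ : S.opp d = S.ρ d) :
    ∃ (D' : Type) (_ : StrandMap G n D' Φ), Finite D' ∧ Nat.card D' < Nat.card D := by
  classical
  have h4 := S.ρ_four d hd
  obtain ⟨e, he⟩ : ∃ e, e = S.ρ d := ⟨_, rfl⟩
  obtain ⟨f, hf⟩ : ∃ f, f = S.ρ e := ⟨_, rfl⟩
  obtain ⟨g, hg⟩ : ∃ g, g = S.ρ f := ⟨_, rfl⟩
  have hgd : S.ρ g = d := by rw [hg, hf, he, h4]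
  have hce : ¬ S.real e := by rw [he, S.real_ρ]; exact hd
  have hcf : ¬ S.real f := by rw [hf, S.real_ρ]; exact hce
  have hcg : ¬ S.real g := by rw [hg, S.real_ρ]; exact hcf
  have hod : S.opp d = e := by rw [hρ, he]
  have hoe : S.opp e = d := by rw [← hod, S.opp_opp d hd]
  have hfd : f ≠ d := by rw [hf, he]; exact S.ρ_two_ne d hd
  have hfe : f ≠ e := by rw [hf]; exact S.ρ_ne e
  have hgf : g ≠ f := by rw [hg]; exact S.ρ_ne f
  have hdg : d ≠ g := by rw [← hgd]; exact S.ρ_ne g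
  have hge : g ≠ e := by rw [hg, hf]; exact S.ρ_two_ne e hce
  have hde : e ≠ d := by rw [he]; exact S.ρ_ne d
  have hof : S.opp f = g := by
    rcases S.opp_near f hcf with h | h | h | h
    · exact absurd h (S.opp_ne f hcf)
    · rw [h, hg]
    · rw [← hg, hgd] at h
      exact absurd (by rw [← hod, ← h, S.opp_opp f hcf]) hfe
    · rw [← hg, hgd, ← he] at h
      exact absurd (by rw [← hoe, ← h, S.opp_opp f hcf]) hfd
  have hog : S.opp g = f := by rw [← hof, S.opp_opp f hcf]
  have hN : ∀ x, S.Near d x ↔ x = d ∨ x = e ∨ x = f ∨ x = g := by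
    intro x; unfold Near; rw [← he, ← hf, ← hg]
  have hNρ : ∀ x, S.Near d (S.ρ x) ↔ S.Near d x := by
    intro x
    simp only [hN]
    constructor
    · have : ∀ y, S.ρ x = S.ρ y → x = y := fun y h => S.ρ.injective h
      rintro (h | h | h | h)
      · rw [← hgd] at h; right; right; right; exact this _ h
      · rw [he] at h; left; exact this _ h
      · rw [hf] at h; right; left; exact this _ h
      · rw [hg] at h; right; right; left; exact this _ h
    · rintro (rfl | rfl | rfl | rfl)
      · right; left; exact he.symm
      · right; right; left; exact hf.symm
      · right; right; right; exact hg.symm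
      · left; exact hgd
  have hNo : ∀ x, ¬ S.real x → S.Near d (S.opp x) → S.Near d x := by
    intro x hx h
    rw [← S.opp_opp x hx]
    exact h.trans (near_opp (not_real_opp hx)) hd
  have nd : ¬ S.Near d (S.α d) := not_near_α hd ((hN _).2 (by simp))
  have ne : ¬ S.Near d (S.α e) := not_near_α hd ((hN _).2 (by simp))
  have nf : ¬ S.Near d (S.α f) := not_near_α hd ((hN _).2 (by simp))
  have ng : ¬ S.Near d (S.α g) := not_near_α hd ((hN _).2 (by simp))
  have fd : S.face (S.α e) = S.face d := by rw [he, S.face_α]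
  have fe : S.face (S.α f) = S.face e := by rw [hf, S.face_α]
  have ff : S.face (S.α g) = S.face f := by rw [hg, S.face_α]
  have fg : S.face (S.α d) = S.face g := by rw [← S.face_α g, hgd]
  have ld : S.lab e = (S.lab d).symm := by rw [← S.lab_opp d hd, hod]
  have lf : S.lab g = (S.lab f).symm := by rw [← S.lab_opp f hcf, hof]
  let A : D → D := fun x => if x = S.α d then S.α e else if x = S.α e then S.α d else
    if x = S.α f then S.α g else if x = S.α g then S.α f else S.α x
  have hA : ∀ x, (x = S.α d ∧ A x = S.α e) ∨ (x = S.α e ∧ A x = S.α d) ∨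
      (x = S.α f ∧ A x = S.α g) ∨ (x = S.α g ∧ A x = S.α f) ∨
      (x ≠ S.α d ∧ x ≠ S.α e ∧ x ≠ S.α f ∧ x ≠ S.α g ∧ A x = S.α x) := by
    intro x; simp only [A]; split_ifs <;> tauto
  have inj : ∀ {x y}, S.α x = S.α y → x = y := fun h => S.α_inj h
  have Ad : A (S.α d) = S.α e := by simp [A]
  have Ae : A (S.α e) = S.α d := by
    simp only [A]; rw [if_neg (fun h => hde (inj h)), if_pos trivial]
  have Af : A (S.α f) = S.α g := by
    simp only [A]
    rw [if_neg (fun h => hfd (inj h)), if_neg (fun h => hfe (inj h)), if_pos trivial]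
  have Ag : A (S.α g) = S.α f := by
    simp only [A]
    rw [if_neg (fun h => hdg (inj h).symm), if_neg (fun h => hge (inj h)),
      if_neg (fun h => hgf (inj h)), if_pos trivial]
  have hAN : ∀ x, ¬ S.Near d x → ¬ S.Near d (A x) := by
    intro x hx
    rcases hA x with ⟨-, h⟩ | ⟨-, h⟩ | ⟨-, h⟩ | ⟨-, h⟩ | ⟨h1, h2, h3, h4, h⟩ <;> rw [h]
    · exact ne
    · exact nd
    · exact ng
    · exact nf
    · rw [hN]
      rintro (h | h | h | h)
      · exact h1 (by rw [← h, S.α_α])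
      · exact h2 (by rw [← h, S.α_α])
      · exact h3 (by rw [← h, S.α_α])
      · exact h4 (by rw [← h, S.α_α])
  have hAA : ∀ x, ¬ S.Near d x → A (A x) = x := by
    intro x hx
    rcases hA x with ⟨h', h⟩ | ⟨h', h⟩ | ⟨h', h⟩ | ⟨h', h⟩ | ⟨h1, h2, h3, h4, h⟩
    · rw [h, h', Ae]
    · rw [h, h', Ad]
    · rw [h, h', Ag]
    · rw [h, h', Af]
    · have hx' := hx
      rw [hN] at hx'
      push Not at hx'
      rw [h]
      simp only [A]
      rw [if_neg (fun h => hx'.1 (inj h)), if_neg (fun h => hx'.2.1 (inj h)),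
        if_neg (fun h => hx'.2.2.1 (inj h)), if_neg (fun h => hx'.2.2.2 (inj h)), S.α_α]
  let M : D → Φ := fun x => if S.face x = S.face g then S.face e else S.face x
  have hM : ∀ {x y}, S.face x = S.face y → M x = M y := fun h => by simp only [M]; rw [h]
  have hMge : M g = M e := by simp only [M]; simp
  have card4 := ncard_near hd
  refine ⟨{x // ¬ S.Near d x}, {
    α := fun x => ⟨A x.1, hAN _ x.2⟩
    ρ := S.ρ.subtypePerm (fun x => not_congr (hNρ x))
    opp := fun x => if h : S.real x.1 then x else ⟨S.opp x.1, fun h' => x.2 (hNo _ h h')⟩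
    real := fun x => S.real x.1
    lab := fun x => S.lab x.1
    rank := fun x => S.rank x.1
    face := fun x => M x.1
    α_α := fun x => Subtype.ext (hAA _ x.2)
    lab_α := fun x => ?_
    real_ρ := fun x => S.real_ρ x.1
    fst_ρ := fun x => S.fst_ρ x.1
    lab_inj := fun x y hx hy h => Subtype.ext (S.lab_inj _ _ hx hy h)
    exists_real := fun a => ?_
    opp_opp := fun x hx => ?_
    opp_ne := fun x hx h => ?_
    lab_opp := fun x hx => ?_
    ρ_four := fun x hx => Subtype.ext (S.ρ_four _ hx)
    ρ_ne := fun x h => S.ρ_ne x.1 (congrArg Subtype.val h)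
    ρ_two_ne := fun x hx h => S.ρ_two_ne x.1 hx (congrArg Subtype.val h)
    opp_near := fun x hx => ?_
    edge_ne := fun x y hx hn h1 h2 => ?_
    rank_pos := fun x hx => S.rank_pos _ hx
    rank_le := fun x hx => S.rank_le _ hx
    rank_lt := fun x hx => ?_
    face_α := fun x => ?_
    euler := ?_ }, inferInstance, ?_⟩
  · rcases hA x.1 with ⟨h', h⟩ | ⟨h', h⟩ | ⟨h', h⟩ | ⟨h', h⟩ | ⟨h1, h2, h3, h4, h⟩ <;>
      simp only [h] <;> (try rw [h']) <;> simp only [S.lab_α, ld, lf, SimpleGraph.Dart.symm_symm]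
  · obtain ⟨x, hx, h⟩ := S.exists_real a
    refine ⟨⟨x, fun h' => ?_⟩, hx, h⟩
    exact (h'.real_iff.not.2 hd) hx
  · simp only [hx, dite_false, not_real_opp hx]
    exact Subtype.ext (S.opp_opp _ hx)
  · simp only [hx, dite_false] at h
    exact S.opp_ne _ hx (congrArg Subtype.val h)
  · simp only [hx, dite_false]
    exact S.lab_opp _ hx
  · simp only [hx, dite_false, Subtype.ext_iff]
    exact S.opp_near _ hx
  · simp only [hx, dite_false, Subtype.ext_iff, Ne] at h1 h2 hn
    exact S.edge_ne _ _ hx hn h1 h2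
  · simp only [hx, dite_false]
    rcases hA x.1 with ⟨h', h⟩ | ⟨h', h⟩ | ⟨h', h⟩ | ⟨h', h⟩ | ⟨h1, h2, h3, h4, h⟩ <;>
      simp only [h] at hx ⊢
    · rw [h']
      have := S.rank_lt (S.α d) (by rwa [S.α_α])
      rw [S.α_α, hod] at this
      exact this.trans (S.rank_lt e hx)
    · rw [h']
      have := S.rank_lt (S.α e) (by rwa [S.α_α])
      rw [S.α_α, hoe] at this
      exact this.trans (S.rank_lt d hx)
    · rw [h']
      have := S.rank_lt (S.α f) (by rwa [S.α_α])
      rw [S.α_α, hof] at this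
      exact this.trans (S.rank_lt g hx)
    · rw [h']
      have := S.rank_lt (S.α g) (by rwa [S.α_α])
      rw [S.α_α, hog] at this
      exact this.trans (S.rank_lt f hx)
    · exact S.rank_lt _ hx
  · have h0 := S.face_α x.1
    simp only [Equiv.Perm.subtypePerm_apply]
    rcases hA (S.ρ x.1) with ⟨h', h⟩ | ⟨h', h⟩ | ⟨h', h⟩ | ⟨h', h⟩ | ⟨h1, h2, h3, h4, h⟩ <;>
      rw [h] <;> (try rw [h', S.α_α] at h0)
    · rw [hM fd, hM h0]
    · rw [hM fg, hMge, hM h0]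
    · rw [hM ff, hM h0]
    · rw [hM fe, ← hMge, hM h0]
    · exact hM h0
  · have e1 := card_not_near hd
    have e2 := ncard_not_near hd
    have e3 : (Set.range S.face).ncard ≤
        (Set.range (fun x : {x // ¬ S.Near d x} => M x.1)).ncard + 1 := by
      have hs : Set.range S.face \ {S.face g} ⊆
          Set.range (fun x : {x // ¬ S.Near d x} => M x.1) := by
        rintro _ ⟨⟨x, rfl⟩, hx⟩
        have : ∃ y, ¬ S.Near d y ∧ S.face y = S.face x := by
          by_cases h : S.Near d x
          · rcases (hN x).1 h with rfl | rfl | rfl | rfl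
            exacts [⟨_, ne, fd⟩, ⟨_, nf, fe⟩, ⟨_, ng, ff⟩, ⟨_, nd, fg⟩]
          · exact ⟨x, h, rfl⟩
        obtain ⟨y, hy, hyx⟩ := this
        refine ⟨⟨y, hy⟩, ?_⟩
        simp only [M]
        rw [hyx]
        exact if_neg hx
      have := Set.ncard_le_ncard hs (Set.toFinite _)
      have := Set.ncard_le_ncard_sdiff_add_ncard (Set.range S.face) {S.face g}
      rw [Set.ncard_singleton] at this
      omega
    have := S.euler
    show 2 * Nat.card {x // ¬ S.Near d x} ≤
      4 * (Set.range (fun x : {x // ¬ S.Near d x} => M x.1)).ncard + 4 * n +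
      {x : {x // ¬ S.Near d x} | ¬ S.real x.1}.ncard
    omega
  · have := card_not_near hd
    omega

theorem exists_lt_of_touch [Finite D] {d : D} (hd : ¬ S.real d) (hρ : S.opp d ≠ S.ρ (S.ρ d)) :
    ∃ (D' : Type) (_ : StrandMap G n D' Φ), Finite D' ∧ Nat.card D' < Nat.card D := by
  rcases S.opp_near d hd with h | h | h | h
  · exact absurd h (S.opp_ne d hd)
  · exact exists_lt_of_opp_eq hd h
  · exact absurd h hρ
  · refine exists_lt_of_opp_eq (d := S.opp d) (not_real_opp hd) ?_
    rw [S.opp_opp d hd, h, S.ρ_four d hd]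

/-- Consecutive darts `a 0, …, a k` along a strand. -/
structure IsChain (S : StrandMap G n D Φ) (a : ℕ → D) (k : ℕ) : Prop where
  step : ∀ i < k, a (i + 1) = S.opp (S.α (a i))
  cross : ∀ i ≤ k, ¬ S.real (S.α (a i))

namespace IsChain

variable {a : ℕ → D} {k : ℕ} (h : S.IsChain a k)
include h

theorem lab_eq {i : ℕ} (hi : i ≤ k) : S.lab (a i) = S.lab (a 0) := by
  induction i with
  | zero => rfl
  | succ i ih =>
    rw [h.step i hi, S.lab_opp _ (h.cross i (by omega)), S.lab_α, SimpleGraph.Dart.symm_symm,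
      ih (by omega)]

theorem rank_lt {i j : ℕ} (hij : i < j) (hj : j ≤ k) : S.rank (a i) < S.rank (a j) := by
  induction j with
  | zero => omega
  | succ j ih =>
    have h1 : S.rank (a j) < S.rank (a (j + 1)) := by
      rw [h.step j hj]; exact S.rank_lt _ (h.cross j (by omega))
    rcases Nat.lt_succ_iff_lt_or_eq.1 hij with h2 | rfl
    · exact (ih h2 (by omega)).trans h1
    · exact h1

theorem rank_le {i j : ℕ} (hij : i ≤ j) (hj : j ≤ k) : S.rank (a i) ≤ S.rank (a j) := by
  rcases hij.lt_or_eq with h1 | rfl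
  · exact (h.rank_lt h1 hj).le
  · rfl

theorem injOn {i j : ℕ} (hi : i ≤ k) (hj : j ≤ k) (e : a i = a j) : i = j := by
  rcases lt_trichotomy i j with h1 | h1 | h1
  · have := h.rank_lt h1 hj; rw [e] at this; omega
  · exact h1
  · have := h.rank_lt h1 hi; rw [e] at this; omega

theorem opp_zero_ne (h0 : ¬ S.real (a 0)) {j : ℕ} (hj : j ≤ k) : S.opp (a 0) ≠ S.α (a j) := by
  intro e
  have h1 := S.rank_lt (a j) (h.cross j hj)
  rw [← e, S.opp_opp _ h0] at h1
  have := h.rank_le (Nat.zero_le j) hj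
  omega

theorem opp_last_ne {j : ℕ} (hj : j ≤ k) : S.opp (S.α (a k)) ≠ a j := by
  intro e
  have h1 := S.rank_lt (a k) (h.cross k le_rfl)
  rw [e] at h1
  have := h.rank_le hj le_rfl
  omega

end IsChain

end StrandMap

namespace StrandMap

variable {V : Type} {G : SimpleGraph V} {n : ℕ} {D Φ : Type} {S : StrandMap G n D Φ}

/-- Two strands meeting twice can be switched along the enclosed lens, which makes them touch. -/
theorem exists_touch_of_lens {a b : ℕ → D} {k : ℕ} (ha : S.IsChain a k) (hb : S.IsChain b k)
    (hAB : (S.lab (a 0)).edge ≠ (S.lab (b 0)).edge)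
    (hstart : (S.real (a 0) ∧ S.real (b 0) ∧ (S.lab (a 0)).fst = (S.lab (b 0)).fst) ∨
      (¬ S.real (a 0) ∧ S.Near (a 0) (b 0)))
    (hend : S.Near (S.α (a k)) (S.α (b k)))
    (hra : ∀ i < k, ∀ x, S.Near (S.α (a i)) x → (S.lab x).edge ≠ (S.lab (b 0)).edge)
    (hrb : ∀ i < k, ∀ x, S.Near (S.α (b i)) x → (S.lab x).edge ≠ (S.lab (a 0)).edge)
    (halt : ∀ d, ¬ S.real d → S.opp d = S.ρ (S.ρ d)) :
    ∃ (S' : StrandMap G n D Φ) (d : D), ¬ S'.real d ∧ S'.opp d ≠ S'.ρ (S'.ρ d) := by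
  classical
  obtain ⟨A, hA⟩ : ∃ A, A = (S.lab (a 0)).edge := ⟨_, rfl⟩
  obtain ⟨B, hB⟩ : ∃ B, B = (S.lab (b 0)).edge := ⟨_, rfl⟩
  have hAB' : A ≠ B := by rwa [hA, hB]
  have ea : ∀ i ≤ k, (S.lab (a i)).edge = A := fun i hi => by rw [ha.lab_eq hi, hA]
  have eb : ∀ i ≤ k, (S.lab (b i)).edge = B := fun i hi => by rw [hb.lab_eq hi, hB]
  have ea' : ∀ i ≤ k, (S.lab (S.α (a i))).edge = A := fun i hi => by rw [edge_α, ea i hi]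
  have eb' : ∀ i ≤ k, (S.lab (S.α (b i))).edge = B := fun i hi => by rw [edge_α, eb i hi]
  have hchain : ∀ {c : ℕ → D}, S.IsChain c k → ∀ i ≤ k, ∀ j ≤ k, c i ≠ S.α (c j) := by
    intro c hc i hi j hj e
    have := congrArg S.lab e
    rw [S.lab_α, hc.lab_eq hi, hc.lab_eq hj] at this
    exact lab_ne_symm _ this.symm
  let ι : D → D := fun d =>
    if h : ∃ i, i ≤ k ∧ d = a i then b h.choose else
    if h : ∃ i, i ≤ k ∧ d = b i then a h.choose else
    if h : ∃ i, i ≤ k ∧ d = S.α (a i) then S.α (b h.choose) else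
    if h : ∃ i, i ≤ k ∧ d = S.α (b i) then S.α (a h.choose) else d
  have ia : ∀ i ≤ k, ι (a i) = b i := by
    intro i hi
    have h : ∃ j, j ≤ k ∧ a i = a j := ⟨i, hi, rfl⟩
    simp only [ι]
    rw [dif_pos h, ← ha.injOn hi h.choose_spec.1 h.choose_spec.2]
  have ib : ∀ i ≤ k, ι (b i) = a i := by
    intro i hi
    have h : ∃ j, j ≤ k ∧ b i = b j := ⟨i, hi, rfl⟩
    simp only [ι]
    rw [dif_neg, dif_pos h, ← hb.injOn hi h.choose_spec.1 h.choose_spec.2]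
    rintro ⟨j, hj, e⟩
    exact hAB' (by rw [← ea j hj, ← e, eb i hi])
  have ia' : ∀ i ≤ k, ι (S.α (a i)) = S.α (b i) := by
    intro i hi
    have h : ∃ j, j ≤ k ∧ S.α (a i) = S.α (a j) := ⟨i, hi, rfl⟩
    simp only [ι]
    rw [dif_neg, dif_neg, dif_pos h, ← ha.injOn hi h.choose_spec.1 (S.α_inj h.choose_spec.2)]
    · rintro ⟨j, hj, e⟩
      exact hAB' (by rw [← eb j hj, ← e, ea' i hi])
    · rintro ⟨j, hj, e⟩
      exact hchain ha j hj i hi e.symm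
  have ib' : ∀ i ≤ k, ι (S.α (b i)) = S.α (a i) := by
    intro i hi
    have h : ∃ j, j ≤ k ∧ S.α (b i) = S.α (b j) := ⟨i, hi, rfl⟩
    simp only [ι]
    rw [dif_neg, dif_neg, dif_neg, dif_pos h,
      ← hb.injOn hi h.choose_spec.1 (S.α_inj h.choose_spec.2)]
    · rintro ⟨j, hj, e⟩
      exact hAB' (by rw [← ea' j hj, ← e, eb' i hi])
    · rintro ⟨j, hj, e⟩
      exact hchain hb j hj i hi e.symm
    · rintro ⟨j, hj, e⟩
      exact hAB' (by rw [← ea j hj, ← e, eb' i hi])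
  have hcase : ∀ d, (∃ i ≤ k, d = a i) ∨ (∃ i ≤ k, d = b i) ∨ (∃ i ≤ k, d = S.α (a i)) ∨
      (∃ i ≤ k, d = S.α (b i)) ∨ (ι d = d ∧ ι (S.α d) = S.α d) := by
    intro d
    by_cases h1 : ∃ i, i ≤ k ∧ d = a i
    · exact Or.inl h1
    by_cases h2 : ∃ i, i ≤ k ∧ d = b i
    · exact Or.inr (Or.inl h2)
    by_cases h3 : ∃ i, i ≤ k ∧ d = S.α (a i)
    · exact Or.inr (Or.inr (Or.inl h3))
    by_cases h4 : ∃ i, i ≤ k ∧ d = S.α (b i)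
    · exact Or.inr (Or.inr (Or.inr (Or.inl h4)))
    refine Or.inr (Or.inr (Or.inr (Or.inr ⟨?_, ?_⟩)))
    · simp only [ι]
      rw [dif_neg h1, dif_neg h2, dif_neg h3, dif_neg h4]
    · simp only [ι]
      rw [dif_neg, dif_neg, dif_neg, dif_neg]
      · rintro ⟨i, hi, e⟩; exact h2 ⟨i, hi, S.α_inj e⟩
      · rintro ⟨i, hi, e⟩; exact h1 ⟨i, hi, S.α_inj e⟩
      · rintro ⟨i, hi, e⟩; exact h4 ⟨i, hi, by rw [← e, S.α_α]⟩
      · rintro ⟨i, hi, e⟩; exact h3 ⟨i, hi, by rw [← e, S.α_α]⟩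
  have real_zero : S.real (a 0) ↔ S.real (b 0) := by
    rcases hstart with h | ⟨h, h'⟩
    · simp [h.1, h.2.1]
    · exact h'.real_iff.symm
  have real_succ : ∀ {c : ℕ → D}, S.IsChain c k → ∀ i < k, ¬ S.real (c (i + 1)) := by
    intro c hc i hi
    rw [hc.step i hi]
    exact not_real_opp (hc.cross i hi.le)
  have fixed : ∀ {d}, (∀ i ≤ k, d ≠ a i) → (∀ i ≤ k, d ≠ b i) → (∀ i ≤ k, d ≠ S.α (a i)) →
      (∀ i ≤ k, d ≠ S.α (b i)) → ι d = d := by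
    intro d h1 h2 h3 h4
    rcases hcase d with ⟨i, hi, h⟩ | ⟨i, hi, h⟩ | ⟨i, hi, h⟩ | ⟨i, hi, h⟩ | h
    exacts [absurd h (h1 i hi), absurd h (h2 i hi), absurd h (h3 i hi), absurd h (h4 i hi), h.1]
  have fa0 : ¬ S.real (a 0) → ι (S.opp (a 0)) = S.opp (a 0) := by
    intro h0
    have e0 : (S.lab (S.opp (a 0))).edge = A := by rw [edge_opp h0, hA]
    refine fixed (fun i hi e => ?_) (fun i hi e => ?_) (fun i hi => ha.opp_zero_ne h0 hi)
      (fun i hi e => ?_)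
    · have := congrArg S.lab e
      rw [S.lab_opp _ h0, ha.lab_eq hi] at this
      exact lab_ne_symm _ this
    · exact hAB' (by rw [← e0, e, eb i hi])
    · exact hAB' (by rw [← e0, e, eb' i hi])
  have fb0 : ¬ S.real (b 0) → ι (S.opp (b 0)) = S.opp (b 0) := by
    intro h0
    have e0 : (S.lab (S.opp (b 0))).edge = B := by rw [edge_opp h0, hB]
    refine fixed (fun i hi e => ?_) (fun i hi e => ?_) (fun i hi e => ?_)
      (fun i hi => hb.opp_zero_ne h0 hi)
    · exact hAB' (by rw [← e0, e, ea i hi])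
    · have := congrArg S.lab e
      rw [S.lab_opp _ h0, hb.lab_eq hi] at this
      exact lab_ne_symm _ this
    · exact hAB' (by rw [← e0, e, ea' i hi])
  have fak : ι (S.opp (S.α (a k))) = S.opp (S.α (a k)) := by
    have h0 := ha.cross k le_rfl
    have e0 : (S.lab (S.opp (S.α (a k)))).edge = A := by rw [edge_opp h0, ea' k le_rfl]
    refine fixed (fun i hi => ha.opp_last_ne hi) (fun i hi e => ?_) (fun i hi e => ?_)
      (fun i hi e => ?_)
    · exact hAB' (by rw [← e0, e, eb i hi])
    · have := congrArg S.lab e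
      rw [S.lab_opp _ h0, S.lab_α, S.lab_α, ha.lab_eq hi, ha.lab_eq le_rfl] at this
      exact lab_ne_symm _ this
    · exact hAB' (by rw [← e0, e, eb' i hi])
  have fbk : ι (S.opp (S.α (b k))) = S.opp (S.α (b k)) := by
    have h0 := hb.cross k le_rfl
    have e0 : (S.lab (S.opp (S.α (b k)))).edge = B := by rw [edge_opp h0, eb' k le_rfl]
    refine fixed (fun i hi e => ?_) (fun i hi => hb.opp_last_ne hi) (fun i hi e => ?_)
      (fun i hi e => ?_)
    · exact hAB' (by rw [← e0, e, ea i hi])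
    · exact hAB' (by rw [← e0, e, ea' i hi])
    · have := congrArg S.lab e
      rw [S.lab_opp _ h0, S.lab_α, S.lab_α, hb.lab_eq hi, hb.lab_eq le_rfl] at this
      exact lab_ne_symm _ this
  have oa : ∀ i < k, S.opp (S.α (a i)) = a (i + 1) := fun i hi => (ha.step i hi).symm
  have ob : ∀ i < k, S.opp (S.α (b i)) = b (i + 1) := fun i hi => (hb.step i hi).symm
  have oa' : ∀ i < k, S.opp (a (i + 1)) = S.α (a i) := fun i hi => by
    rw [ha.step i hi, S.opp_opp _ (ha.cross i hi.le)]
  have ob' : ∀ i < k, S.opp (b (i + 1)) = S.α (b i) := fun i hi => by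
    rw [hb.step i hi, S.opp_opp _ (hb.cross i hi.le)]
  obtain ⟨S', hρ', hr', ho'⟩ := S.exists_switch ι
    (by
      intro d
      rcases hcase d with ⟨i, hi, rfl⟩ | ⟨i, hi, rfl⟩ | ⟨i, hi, rfl⟩ | ⟨i, hi, rfl⟩ | ⟨h, -⟩
      · rw [ia i hi, ib i hi]
      · rw [ib i hi, ia i hi]
      · rw [ia' i hi, ib' i hi]
      · rw [ib' i hi, ia' i hi]
      · rw [h, h])
    (by
      intro d
      rcases hcase d with ⟨i, hi, rfl⟩ | ⟨i, hi, rfl⟩ | ⟨i, hi, rfl⟩ | ⟨i, hi, rfl⟩ | ⟨h, h'⟩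
      · rw [ia i hi, ia' i hi]
      · rw [ib i hi, ib' i hi]
      · rw [ia' i hi, S.α_α, S.α_α, ia i hi]
      · rw [ib' i hi, S.α_α, S.α_α, ib i hi]
      · rw [h, h'])
    (by
      intro d
      rcases hcase d with ⟨i, hi, rfl⟩ | ⟨i, hi, rfl⟩ | ⟨i, hi, rfl⟩ | ⟨i, hi, rfl⟩ | ⟨h, -⟩
      · rw [ia i hi]
        cases i with
        | zero => exact real_zero.symm
        | succ i => simp [real_succ ha i hi, real_succ hb i hi]
      · rw [ib i hi]
        cases i with
        | zero => exact real_zero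
        | succ i => simp [real_succ ha i hi, real_succ hb i hi]
      · rw [ia' i hi]; simp [ha.cross i hi, hb.cross i hi]
      · rw [ib' i hi]; simp [ha.cross i hi, hb.cross i hi]
      · rw [h])
    (by
      intro d hd
      rcases hcase d with ⟨i, hi, rfl⟩ | ⟨i, hi, rfl⟩ | ⟨i, hi, rfl⟩ | ⟨i, hi, rfl⟩ | ⟨h, -⟩
      · cases i with
        | zero =>
          rw [ia 0 hi]
          rcases hstart with h | h
          · exact h.2.2.symm
          · exact absurd hd h.1
        | succ i => exact absurd hd (real_succ ha i hi)
      · cases i with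
        | zero =>
          rw [ib 0 hi]
          rcases hstart with h | h
          · exact h.2.2
          · exact absurd (real_zero.2 hd) h.1
        | succ i => exact absurd hd (real_succ hb i hi)
      · exact absurd hd (ha.cross i hi)
      · exact absurd hd (hb.cross i hi)
      · rw [h]) hAB'
    (by
      intro d hd
      rcases hcase d with ⟨i, hi, rfl⟩ | ⟨i, hi, rfl⟩ | ⟨i, hi, rfl⟩ | ⟨i, hi, rfl⟩ | ⟨h, -⟩
      · rw [ia i hi]; exact Or.inl ⟨ea i hi, eb i hi⟩
      · rw [ib i hi]; exact Or.inr ⟨eb i hi, ea i hi⟩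
      · rw [ia' i hi]; exact Or.inl ⟨ea' i hi, eb' i hi⟩
      · rw [ib' i hi]; exact Or.inr ⟨eb' i hi, ea' i hi⟩
      · exact absurd h hd)
    (by
      intro d hd h1 h2
      rcases hcase d with ⟨i, hi, rfl⟩ | ⟨i, hi, rfl⟩ | ⟨i, hi, rfl⟩ | ⟨i, hi, rfl⟩ | ⟨h, -⟩
      · cases i with
        | zero => exact absurd (fa0 hd) h2
        | succ i => rw [oa' i hi, ia _ hi, ob' i hi, ia' i (by omega)]
      · cases i with
        | zero => exact absurd (fb0 hd) h2
        | succ i => rw [ob' i hi, ib _ hi, oa' i hi, ib' i (by omega)]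
      · rcases hi.lt_or_eq with h | rfl
        · rw [oa i h, ia' i hi, ob i h, ia _ h]
        · exact absurd fak h2
      · rcases hi.lt_or_eq with h | rfl
        · rw [ob i h, ib' i hi, oa i h, ib _ h]
        · exact absurd fbk h2
      · exact absurd h h1)
    (by
      intro d hd h1 h2
      rcases hcase d with ⟨i, hi, rfl⟩ | ⟨i, hi, rfl⟩ | ⟨i, hi, rfl⟩ | ⟨i, hi, rfl⟩ | ⟨h, -⟩
      · cases i with
        | zero =>
          rw [ia 0 hi]
          rcases hstart with h | h
          · exact absurd h.1 hd
          · exact h.2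
        | succ i =>
          rw [oa' i hi, ia' i (by omega)] at h2
          exact absurd (by rw [← ea' i (by omega), ← h2, eb' i (by omega)]) hAB'
      · cases i with
        | zero =>
          rw [ib 0 hi]
          rcases hstart with h | h
          · exact absurd h.2.1 hd
          · exact h.2.symm h.1
        | succ i =>
          rw [ob' i hi, ib' i (by omega)] at h2
          exact absurd (by rw [← ea' i (by omega), h2, eb' i (by omega)]) hAB'
      · rcases hi.lt_or_eq with h | rfl
        · rw [oa i h, ia _ h] at h2
          exact absurd (by rw [← ea _ h, ← h2, eb _ h]) hAB'
        · rw [ia' i hi]; exact hend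
      · rcases hi.lt_or_eq with h | rfl
        · rw [ob i h, ib _ h] at h2
          exact absurd (by rw [← ea _ h, h2, eb _ h]) hAB'
        · rw [ib' i hi]; exact hend.symm (ha.cross i hi)
      · exact absurd h h1)
    (by
      intro d d' hd h1 h2 hn h3 h4
      have h5 := hn.edge_ne hd h3 h4
      rcases hcase d with ⟨i, hi, rfl⟩ | ⟨i, hi, rfl⟩ | ⟨i, hi, rfl⟩ | ⟨i, hi, rfl⟩ | ⟨h, -⟩
      · cases i with
        | zero => exact absurd (fa0 hd) h2
        | succ i =>
          rw [ea _ hi] at h5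
          refine ⟨h5, ?_⟩
          have h6 := near_opp (S := S) (ha.cross i (by omega))
          rw [oa i hi] at h6
          rw [hB]; exact hra i hi d' (h6.trans hn (ha.cross i (by omega)))
      · cases i with
        | zero => exact absurd (fb0 hd) h2
        | succ i =>
          rw [eb _ hi] at h5
          refine ⟨?_, h5⟩
          have h6 := near_opp (S := S) (hb.cross i (by omega))
          rw [ob i hi] at h6
          rw [hA]; exact hrb i hi d' (h6.trans hn (hb.cross i (by omega)))
      · rcases hi.lt_or_eq with h | rfl
        · rw [ea' i hi] at h5
          exact ⟨h5, by rw [hB]; exact hra i h d' hn⟩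
        · exact absurd fak h2
      · rcases hi.lt_or_eq with h | rfl
        · rw [eb' i hi] at h5
          exact ⟨by rw [hA]; exact hrb i h d' hn, h5⟩
        · exact absurd fbk h2
      · exact absurd h h1)
  refine ⟨S', S.α (a k), by rw [hr']; exact ha.cross k le_rfl, ?_⟩
  rw [ho', ia' k le_rfl, fbk, hρ', halt _ (hb.cross k le_rfl)]
  intro e
  have := S.ρ.injective (S.ρ.injective e)
  exact hAB' (by rw [← ea' k le_rfl, ← this, eb' k le_rfl])

/-- A map in which all crossings are transversal and there are no short lenses. -/
structure IsReduced (S : StrandMap G n D Φ) : Prop where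
  opp_eq : ∀ d, ¬ S.real d → S.opp d = S.ρ (S.ρ d)
  no_lens : ∀ (a b : ℕ → D) (k : ℕ), S.IsChain a k → S.IsChain b k →
    (S.lab (a 0)).edge ≠ (S.lab (b 0)).edge →
    ((S.real (a 0) ∧ S.real (b 0) ∧ (S.lab (a 0)).fst = (S.lab (b 0)).fst) ∨
      (¬ S.real (a 0) ∧ S.Near (a 0) (b 0))) →
    S.Near (S.α (a k)) (S.α (b k)) →
    (∀ i < k, ∀ x, S.Near (S.α (a i)) x → (S.lab x).edge ≠ (S.lab (b 0)).edge) →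
    (∀ i < k, ∀ x, S.Near (S.α (b i)) x → (S.lab x).edge ≠ (S.lab (a 0)).edge) → False

theorem exists_isReduced (n : ℕ) (Φ : Type) (N : ℕ) : ∀ (D : Type) (_ : StrandMap G n D Φ),
    Finite D → Nat.card D ≤ N →
    ∃ (D' : Type) (S' : StrandMap G n D' Φ), Finite D' ∧ S'.IsReduced := by
  induction N using Nat.strong_induction_on with
  | _ N ih =>
    intro D S hD hN
    have touch : ∀ (T : StrandMap G n D Φ) (d : D), ¬ T.real d → T.opp d ≠ T.ρ (T.ρ d) →
        ∃ (D' : Type) (S' : StrandMap G n D' Φ), Finite D' ∧ S'.IsReduced := by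
      intro T d hd h
      obtain ⟨D', S', hD', hlt⟩ := exists_lt_of_touch hd h
      exact ih (Nat.card D') (by omega) D' S' hD' le_rfl
    by_cases h1 : ∀ d, ¬ S.real d → S.opp d = S.ρ (S.ρ d)
    · by_contra hno
      refine hno ⟨D, S, hD, h1, ?_⟩
      intro a b k ha hb hAB hs he hra hrb
      obtain ⟨S', d, hd, hne⟩ := exists_touch_of_lens ha hb hAB hs he hra hrb h1
      exact hno (touch S' d hd hne)
    · push Not at h1
      obtain ⟨d, hd, h⟩ := h1
      exact touch S d hd h

end StrandMap

namespace StrandMap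

variable {V : Type} {G : SimpleGraph V} {n : ℕ} {D Φ : Type} (S : StrandMap G n D Φ)

/-- The permutation walking along the boundaries of the faces. -/
def φ : Equiv.Perm D := (Function.Involutive.toPerm S.α S.α_α).trans S.ρ.symm

/-- The next dart along a strand. -/
def nx (d : D) : D := S.φ (S.α (S.φ d))

variable {S}

theorem φ_apply (d : D) : S.φ d = S.ρ.symm (S.α d) := rfl

theorem φ_symm (d : D) : S.φ.symm d = S.α (S.ρ d) := rfl

theorem ρ_eq (d : D) : S.ρ d = S.α (S.φ.symm d) := by rw [φ_symm, S.α_α]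

theorem ρ_φ (d : D) : S.ρ (S.φ d) = S.α d := by simp [φ_apply]

theorem ρ_φα (d : D) : S.ρ (S.φ (S.α d)) = d := by rw [ρ_φ, S.α_α]

theorem real_φ (d : D) : S.real (S.φ d) ↔ S.real (S.α d) := by
  rw [← ρ_φ, S.real_ρ]

theorem real_φα (d : D) : S.real (S.φ (S.α d)) ↔ S.real d := by rw [real_φ, S.α_α]

theorem face_φ (d : D) : S.face (S.φ d) = S.face d := by
  rw [← S.face_α, ρ_φ, S.α_α]

theorem real_nx (d : D) : S.real (S.nx d) ↔ S.real (S.φ d) := by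
  rw [nx, real_φα]

theorem nx_symm (d : D) : S.nx (S.φ.symm d) = S.φ (S.α d) := by
  rw [nx, Equiv.apply_symm_apply]

theorem near_φα {d : D} (h : ¬ S.real d) : S.Near d (S.φ (S.α d)) := by
  refine Near.symm (S := S) ?_ ((real_φα d).not.2 h)
  exact Or.inr (Or.inl (ρ_φα d).symm)

theorem fst_φ {d : D} (h : S.real (S.φ d)) : (S.lab (S.φ d)).fst = (S.lab d).snd := by
  have := S.fst_ρ (S.φ d) h
  rw [ρ_φ, S.lab_α] at this
  exact this.symm

theorem fst_φα {d : D} (h : S.real d) : (S.lab (S.φ (S.α d))).fst = (S.lab d).fst := by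
  rw [fst_φ ((real_φα d).2 h), S.lab_α]; rfl

theorem edge_ne_of_real {d d' : D} (hd : S.real d) (hd' : S.real d')
    (hf : (S.lab d).fst = (S.lab d').fst) (hne : d ≠ d') :
    (S.lab d).edge ≠ (S.lab d').edge := by
  intro h
  rcases SimpleGraph.dart_edge_eq_iff _ _ |>.1 h with h | h
  · exact hne (S.lab_inj d d' hd hd' h)
  · have := (S.lab d').adj.ne
    rw [h] at hf
    exact this hf.symm

theorem lab_snd_ne {d d' : D} (hd : S.real d) (hd' : S.real d')
    (hf : (S.lab d).fst = (S.lab d').fst) (hne : d ≠ d') : (S.lab d).snd ≠ (S.lab d').snd :=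
  fun h => hne (S.lab_inj d d' hd hd' (SimpleGraph.Dart.ext _ _ (Prod.ext hf h)))

namespace IsReduced

variable (hS : S.IsReduced)
include hS

theorem opp_α {d : D} (h : ¬ S.real (S.φ d)) : S.opp (S.α d) = S.nx d := by
  have h' : ¬ S.real (S.α d) := (real_φ d).not.1 h
  rw [hS.opp_eq _ h', nx, φ_apply (S.α _), S.α_α]
  apply S.ρ.injective
  rw [Equiv.apply_symm_apply, φ_apply]
  apply S.ρ.injective
  rw [Equiv.apply_symm_apply, S.ρ_four _ h']

theorem lab_nx {d : D} (h : ¬ S.real (S.φ d)) : S.lab (S.nx d) = S.lab d := by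
  have h' : ¬ S.real (S.α d) := (real_φ d).not.1 h
  rw [← hS.opp_α h, S.lab_opp _ h', S.lab_α, SimpleGraph.Dart.symm_symm]

theorem rank_nx {d : D} (h : ¬ S.real (S.φ d)) : S.rank d < S.rank (S.nx d) := by
  rw [← hS.opp_α h]
  exact S.rank_lt d ((real_φ d).not.1 h)

theorem lab_φα {d : D} (h : ¬ S.real d) : S.lab (S.φ (S.α d)) = S.lab (S.φ.symm d) := by
  rw [← nx_symm, hS.lab_nx (by rwa [Equiv.apply_symm_apply])]

theorem edge_ne_of_near {d d' : D} (h : ¬ S.real d) (hn : S.Near d d') :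
    (S.lab d').edge = (S.lab d).edge ∨ (S.lab d').edge = (S.lab (S.φ.symm d)).edge := by
  have e : (S.lab (S.ρ d)).edge = (S.lab (S.φ.symm d)).edge := by rw [ρ_eq, edge_α]
  have h' : ¬ S.real (S.ρ d) := by rwa [S.real_ρ]
  rcases hn with rfl | rfl | rfl | rfl
  · exact Or.inl rfl
  · exact Or.inr e
  · left; rw [← hS.opp_eq d h, edge_opp h]
  · right; rw [← hS.opp_eq _ h', edge_opp h', e]

theorem edge_symm_ne {d : D} (h : ¬ S.real d) :
    (S.lab (S.φ.symm d)).edge ≠ (S.lab d).edge := by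
  have e : (S.lab (S.ρ d)).edge = (S.lab (S.φ.symm d)).edge := by rw [ρ_eq, edge_α]
  rw [← e]
  refine (near_ρ d).edge_ne h (S.ρ_ne d) ?_
  rw [hS.opp_eq d h]
  exact (S.ρ_ne (S.ρ d)).symm

theorem edge_φ_ne {d : D} (h : ¬ S.real (S.φ d)) :
    (S.lab d).edge ≠ (S.lab (S.φ d)).edge := by
  have := hS.edge_symm_ne h
  rwa [Equiv.symm_apply_apply] at this

theorem no_four {d : D} (h0 : ¬ S.real d) (h1 : ¬ S.real (S.φ d)) (h2 : ¬ S.real (S.φ (S.nx d)))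
    (h3 : ¬ S.real (S.φ (S.nx (S.nx d)))) : False := by
  have := S.rank_pos d h0
  have := hS.rank_nx h1
  have := hS.rank_nx h2
  have := hS.rank_nx h3
  have := S.rank_le (S.nx (S.nx (S.nx d))) ((real_nx _).not.2 h3)
  omega

theorem isChain {d : D} {k : ℕ} (h : ∀ i ≤ k, ¬ S.real (S.φ (S.nx^[i] d))) :
    S.IsChain (fun i => S.nx^[i] d) k where
  step i hi := by
    rw [Function.iterate_succ_apply', hS.opp_α (h i hi.le)]
  cross i hi := (real_φ _).not.1 (h i hi)

theorem φ_ne (d : D) : S.φ d ≠ d := by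
  intro h
  by_cases hd : S.real d
  · have := fst_φ (S := S) (d := d) (by rwa [h])
    rw [h] at this
    exact (S.lab d).adj.ne this
  · exact hS.edge_φ_ne (d := d) (by rwa [h]) (by rw [h])

theorem φ_φ_ne (d : D) : S.φ (S.φ d) ≠ d := by
  intro h
  have key : ∀ d, S.φ (S.φ d) = d → ¬ S.real (S.φ d) → False := by
    intro d h h1
    have hρ : S.α (S.φ d) = S.ρ d := by rw [ρ_eq, ← h, Equiv.symm_apply_apply, h]
    refine hS.no_lens (fun _ => d) (fun _ => S.ρ d) 0 ⟨by omega, fun _ _ => (real_φ d).not.1 h1⟩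
      ⟨by omega, fun _ _ => by rw [← hρ, S.α_α]; exact h1⟩ ?_ ?_ ?_ (by omega) (by omega)
    · by_cases hd : S.real d
      · exact edge_ne_of_real hd ((S.real_ρ d).2 hd) (S.fst_ρ d hd).symm (S.ρ_ne d).symm
      · rw [← hρ, edge_α]
        have := hS.edge_φ_ne (d := S.φ d) (by rwa [h])
        rw [h] at this
        exact this.symm
    · by_cases hd : S.real d
      · exact Or.inl ⟨hd, (S.real_ρ d).2 hd, (S.fst_ρ d hd).symm⟩
      · exact Or.inr ⟨hd, near_ρ d⟩
    · simp only [← hρ, S.α_α]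
      have := near_φα (S := S) ((real_φ d).not.1 h1)
      rwa [S.α_α] at this
  by_cases h1 : S.real (S.φ d)
  · by_cases h0 : S.real d
    · have e1 := fst_φ h1
      have e2 := fst_φ (S := S) (d := S.φ d) (by rwa [h])
      rw [h] at e2
      have hr : S.real (S.α (S.φ d)) := by rw [← real_φ, h]; exact h0
      have := lab_snd_ne hr h0 (by rw [S.lab_α]; exact e2.symm)
        (fun h' => S.ρ_ne (S.φ d) (by rw [ρ_φ, ← congrArg S.α h', S.α_α]))
      rw [S.lab_α] at this
      exact this e1
    · exact key (S.φ d) (by rw [h]) (by rwa [h])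
  · exact key d h h1

end IsReduced

end StrandMap

namespace StrandMap

variable {V : Type} {G : SimpleGraph V} {n : ℕ} {D Φ : Type} (S : StrandMap G n D Φ)

/-- `d` is the side, opposite to the vertex, of a triangular face with exactly one vertex. -/
def IsT1 (d : D) : Prop :=
  S.φ (S.φ (S.φ d)) = d ∧ ¬ S.real d ∧ ¬ S.real (S.φ d) ∧ S.real (S.φ (S.φ d))

/-- `d` is a side of a triangular face without vertices. -/
def IsT0 (d : D) : Prop :=
  S.φ (S.φ (S.φ d)) = d ∧ ¬ S.real d ∧ ¬ S.real (S.φ d) ∧ ¬ S.real (S.φ (S.φ d))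

/-- `d` is a side of a quadrangular face without vertices. -/
def IsQ0 (d : D) : Prop :=
  S.φ (S.φ (S.φ (S.φ d))) = d ∧ ¬ S.real d ∧ ¬ S.real (S.φ d) ∧ ¬ S.real (S.φ (S.φ d)) ∧
    ¬ S.real (S.φ (S.φ (S.φ d)))

/-- `d` is the last side of a strip of `k` quadrangles attached to a triangle with one vertex. -/
def Strip : ℕ → D → Prop
  | 0, d => S.IsT1 d
  | k + 1, d => S.IsQ0 d ∧ Strip k (S.α (S.φ (S.φ d)))

variable {S}

theorem symm_of_three {d : D} (h : S.φ (S.φ (S.φ d)) = d) : S.φ.symm d = S.φ (S.φ d) := by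
  rw [Equiv.symm_apply_eq, h]

theorem symm_of_four {d : D} (h : S.φ (S.φ (S.φ (S.φ d))) = d) :
    S.φ.symm d = S.φ (S.φ (S.φ d)) := by
  rw [Equiv.symm_apply_eq, h]

theorem near_α_symm (d : D) : S.Near d (S.α (S.φ.symm d)) := by
  rw [← ρ_eq]; exact near_ρ d

theorem nx_α_φ {g : D} (h : ¬ S.real (S.φ g)) : S.nx (S.α (S.φ g)) = S.α (S.φ.symm (S.α g)) := by
  have hρ (x : D) : S.φ (S.α x) = S.ρ.symm x := by rw [φ_apply, S.α_α]
  have e : S.α g = S.ρ (S.φ g) := (ρ_φ g).symm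
  rw [← ρ_eq, e, nx, hρ, hρ, Equiv.symm_apply_eq, Equiv.symm_apply_eq]
  exact (S.ρ_four _ h).symm

theorem Strip.not_real {k : ℕ} {d : D} (h : S.Strip k d) :
    ¬ S.real d ∧ ¬ S.real (S.φ d) := by
  cases k with
  | zero => exact ⟨h.2.1, h.2.2.1⟩
  | succ k => exact ⟨h.1.2.1, h.1.2.2.1⟩

namespace IsReduced

variable (hS : S.IsReduced)
include hS

theorem lab_α_symm_α {d : D} (h : ¬ S.real (S.φ d)) :
    S.lab (S.α (S.φ.symm (S.α d))) = S.lab (S.α (S.φ d)) := by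
  have := hS.lab_φα (d := S.α d) ((real_φ d).not.1 h)
  rw [S.α_α] at this
  rw [S.lab_α, S.lab_α, this]

theorem lab_iterate {d : D} {k : ℕ} (h : ∀ i < k, ¬ S.real (S.φ (S.nx^[i] d))) :
    S.lab (S.nx^[k] d) = S.lab d := by
  induction k with
  | zero => rfl
  | succ k ih =>
    rw [Function.iterate_succ_apply', hS.lab_nx (h k (by omega)), ih (fun i hi => h i (by omega))]

theorem exists_of_strip (k : ℕ) (g : D) (hg : S.Strip k g) :
    ∃ r₁ r₂, S.real r₁ ∧ S.real r₂ ∧ (S.lab r₁).fst = (S.lab r₂).fst ∧ r₁ ≠ r₂ ∧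
      S.nx^[k + 1] r₁ = S.φ (S.α g) ∧ S.nx^[k + 1] r₂ = S.α (S.φ.symm (S.α g)) ∧
      (∀ i ≤ k, ¬ S.real (S.φ (S.nx^[i] r₁))) ∧ (∀ i ≤ k, ¬ S.real (S.φ (S.nx^[i] r₂))) ∧
      (∀ i ≤ k, ∀ x, S.Near (S.α (S.nx^[i] r₁)) x → (S.lab x).edge ≠ (S.lab r₂).edge) ∧
      (∀ i ≤ k, ∀ x, S.Near (S.α (S.nx^[i] r₂)) x → (S.lab x).edge ≠ (S.lab r₁).edge) := by
  induction k generalizing g with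
  | zero =>
    obtain ⟨h3, hC0, hC1, hR⟩ := hg
    have hs := symm_of_three h3
    have hr2 : S.real (S.α (S.φ g)) := (real_φ _).1 hR
    have hne : S.φ (S.φ g) ≠ S.α (S.φ g) := by
      rw [← ρ_φ]; exact (S.ρ_ne _).symm
    have hf : (S.lab (S.φ (S.φ g))).fst = (S.lab (S.α (S.φ g))).fst := by
      rw [fst_φ hR, S.lab_α]; rfl
    have hedge := edge_ne_of_real hR hr2 hf hne
    have e1 : (S.lab g).edge ≠ (S.lab (S.φ (S.φ g))).edge := by
      rw [← hs]; exact (hS.edge_symm_ne hC0).symm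
    have e2 : (S.lab g).edge ≠ (S.lab (S.φ g)).edge := hS.edge_φ_ne hC1
    have hC1' : ¬ S.real (S.α g) := (real_φ g).not.1 hC1
    have hC0' : ¬ S.real (S.α (S.φ (S.φ g))) := by rw [← real_φ, h3]; exact hC0
    refine ⟨S.φ (S.φ g), S.α (S.φ g), hR, hr2, hf, hne, ?_, ?_, ?_, ?_, ?_, ?_⟩
    · show S.nx _ = _
      rw [← hs, nx_symm]
    · show S.nx _ = _
      exact nx_α_φ hC1
    · intro i hi
      obtain rfl : i = 0 := by omega
      show ¬ S.real (S.φ (S.φ (S.φ g)))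
      rwa [h3]
    · intro i hi
      obtain rfl : i = 0 := by omega
      show ¬ S.real (S.φ (S.α (S.φ g)))
      rwa [real_φα]
    · intro i hi x hx
      obtain rfl : i = 0 := by omega
      have hx : S.Near (S.α (S.φ (S.φ g))) x := hx
      have hn := near_α_symm (S := S) g
      rw [hs] at hn
      have := hS.edge_ne_of_near hC0 (hn.trans hx hC0)
      rw [hs] at this
      rw [edge_α]
      rcases this with h | h <;> rw [h]
      · exact e2
      · rwa [edge_α] at hedge
    · intro i hi x hx
      obtain rfl : i = 0 := by omega
      have hx : S.Near (S.α (S.α (S.φ g))) x := hx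
      rw [S.α_α] at hx
      have := hS.edge_ne_of_near hC1 hx
      rw [Equiv.symm_apply_apply] at this
      rcases this with h | h <;> rw [h]
      · rw [edge_α] at hedge; exact hedge.symm
      · exact e1
  | succ k ih =>
    obtain ⟨⟨h4, hC0, hC1, hC2, hC3⟩, hk⟩ := hg
    obtain ⟨r₁, r₂, hr₁, hr₂, hf, hne, hn1, hn2, hc1, hc2, hx1, hx2⟩ := ih _ hk
    have hs := symm_of_four h4
    rw [S.α_α] at hn1 hn2
    rw [Equiv.symm_apply_apply] at hn2
    rw [← hs] at hn1
    have hl1 : S.lab (S.φ.symm g) = S.lab r₁ := by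
      rw [← hn1]; exact hS.lab_iterate (fun i hi => hc1 i (by omega))
    have hl2 : S.lab (S.α (S.φ g)) = S.lab r₂ := by
      rw [← hn2]; exact hS.lab_iterate (fun i hi => hc2 i (by omega))
    have hedge := edge_ne_of_real hr₁ hr₂ hf hne
    have e1 : (S.lab g).edge ≠ (S.lab r₁).edge := by
      rw [← hl1]; exact (hS.edge_symm_ne hC0).symm
    have e2 : (S.lab g).edge ≠ (S.lab r₂).edge := by
      rw [← hl2, edge_α]; exact hS.edge_φ_ne hC1
    refine ⟨r₁, r₂, hr₁, hr₂, hf, hne, ?_, ?_, ?_, ?_, ?_, ?_⟩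
    · rw [Function.iterate_succ_apply', hn1, nx_symm]
    · rw [Function.iterate_succ_apply', hn2]
      exact nx_α_φ hC1
    · intro i hi
      rcases Nat.lt_or_eq_of_le hi with hi | rfl
      · exact hc1 i (by omega)
      · rw [hn1, Equiv.apply_symm_apply]; exact hC0
    · intro i hi
      rcases Nat.lt_or_eq_of_le hi with hi | rfl
      · exact hc2 i (by omega)
      · rw [hn2, real_φα]; exact hC1
    · intro i hi x hx
      rcases Nat.lt_or_eq_of_le hi with hi | rfl
      · exact hx1 i (by omega) x hx
      · rw [hn1] at hx
        rcases hS.edge_ne_of_near hC0 ((near_α_symm g).trans hx hC0) with h | h <;> rw [h]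
        · exact e2
        · rwa [hl1]
    · intro i hi x hx
      rcases Nat.lt_or_eq_of_le hi with hi | rfl
      · exact hx2 i (by omega) x hx
      · rw [hn2, S.α_α] at hx
        have := hS.edge_ne_of_near hC1 hx
        rw [Equiv.symm_apply_apply] at this
        rcases this with h | h <;> rw [h]
        · rw [← edge_α, hl2]; exact hedge.symm
        · exact e1

end IsReduced

end StrandMap

namespace StrandMap

variable {V : Type} {G : SimpleGraph V} {n : ℕ} {D Φ : Type} {S : StrandMap G n D Φ}

namespace IsReduced

variable (hS : S.IsReduced)
include hS

theorem not_isT0_of_strip {k : ℕ} {g : D} (hg : S.Strip k g) : ¬ S.IsT0 (S.α g) := by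
  rintro ⟨h3, hC0, hC1, hC2⟩
  obtain ⟨r₁, r₂, hr₁, hr₂, hf, hne, hn1, hn2, hc1, hc2, hx1, hx2⟩ := hS.exists_of_strip k g hg
  have hs := symm_of_three h3
  rw [hs] at hn2
  refine hS.no_lens (fun i => S.nx^[i] r₁) (fun i => S.nx^[i] r₂) (k + 1) (hS.isChain ?_)
    (hS.isChain ?_) (edge_ne_of_real hr₁ hr₂ hf hne) (Or.inl ⟨hr₁, hr₂, hf⟩) ?_
    (fun i hi => hx1 i (by omega)) (fun i hi => hx2 i (by omega))
  · intro i hi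
    rcases Nat.lt_or_eq_of_le hi with hi | rfl
    · exact hc1 i (by omega)
    · rwa [hn1]
  · intro i hi
    rcases Nat.lt_or_eq_of_le hi with hi | rfl
    · exact hc2 i (by omega)
    · rw [hn2, real_φα]; exact hC2
  · simp only [hn1, hn2, S.α_α]
    have := near_φα (S := S) (d := S.α (S.φ (S.α g))) ((real_φ _).not.1 hC2)
    rwa [S.α_α] at this

theorem not_strip_α {j k : ℕ} {g : D} (hg : S.Strip k g) : ¬ S.Strip j (S.α g) := by
  intro hg'
  obtain ⟨r₁, r₂, hr₁, hr₂, hf, hne, hn1, hn2, hc1, hc2, -, -⟩ := hS.exists_of_strip k g hg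
  obtain ⟨s₁, s₂, hs₁, hs₂, hf', hne', hm1, hm2, hd1, hd2, -, -⟩ := hS.exists_of_strip j _ hg'
  have l1 := hS.lab_iterate (k := k + 1) (fun i hi => hc1 i (by omega))
  have l2 := hS.lab_iterate (k := k + 1) (fun i hi => hc2 i (by omega))
  have m1 := hS.lab_iterate (k := j + 1) (fun i hi => hd1 i (by omega))
  have m2 := hS.lab_iterate (k := j + 1) (fun i hi => hd2 i (by omega))
  rw [hn1] at l1
  rw [hn2] at l2
  rw [hm1, S.α_α] at m1
  rw [hm2, S.α_α] at m2
  have h0 := hg.not_real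
  have h1 := hg'.not_real
  have e1 := hS.lab_α_symm_α (d := g) h0.2
  have e2 := hS.lab_α_symm_α (d := S.α g) h1.2
  rw [S.α_α, S.lab_α (S.φ (S.α g)), l1] at e2
  rw [S.lab_α (S.φ g), l2, m1] at e1
  rw [m2] at e2
  have : (S.lab r₁).snd = (S.lab r₂).snd := by
    have a := congrArg (fun x : G.Dart => x.fst) e2
    have b := congrArg (fun x : G.Dart => x.snd) e1
    simp at a b
    rw [← a, b, hf']
  exact lab_snd_ne hr₁ hr₂ hf hne this

theorem not_strip_three {g : D} : ¬ S.Strip 3 g := by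
  intro hg
  obtain ⟨r₁, r₂, hr₁, hr₂, hf, hne, hn1, hn2, hc1, hc2, -, -⟩ := hS.exists_of_strip 3 g hg
  have h0 := hS.rank_nx (hc1 0 (by omega))
  have h1 := hS.rank_nx (hc1 1 (by omega))
  have h2 := hS.rank_nx (hc1 2 (by omega))
  have h3 := hS.rank_nx (hc1 3 (by omega))
  have := S.rank_le (S.nx (S.nx^[3] r₁)) ((real_nx _).not.2 (hc1 3 (by omega)))
  simp only [Function.iterate_succ_apply', Function.iterate_zero, id] at *
  omega

end IsReduced

end StrandMap

namespace StrandMap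

variable {V : Type} {G : SimpleGraph V} {n : ℕ} {D Φ : Type} (S : StrandMap G n D Φ)

/-- The strand through the end of the side `e`, beyond `e`, ends at a vertex. -/
def RealAfter (e : D) : Prop := S.real (S.φ (S.φ (S.α e)))

/-- The strand through the start of the side `e`, beyond `e`, ends at a vertex. -/
def RealBefore (e : D) : Prop := S.real (S.φ.symm (S.α e))

/-- The side `e` of a triangle sees a quadrangle that also has to support a triangle with
one vertex. -/
def Bad (e : D) : Prop :=
  S.φ (S.φ (S.φ (S.φ (S.α e)))) = S.α e ∧
    ((S.RealAfter e ∧ S.IsT1 (S.α (S.φ (S.φ (S.φ (S.α e)))))) ∨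
      (S.RealBefore e ∧ S.IsT1 (S.α (S.φ (S.α e)))))

/-- No side of the triangle of `e` sees vertices in both directions. -/
def NoDouble (e : D) : Prop :=
  ¬ (S.RealAfter e ∧ S.RealBefore e) ∧ ¬ (S.RealAfter (S.φ e) ∧ S.RealBefore (S.φ e)) ∧
    ¬ (S.RealAfter (S.φ (S.φ e)) ∧ S.RealBefore (S.φ (S.φ e)))

/-- `d` starts at a vertex on a face with at least four sides, two steps before a vertex. -/
def Big (d : D) : Prop := S.real (S.φ (S.φ d)) ∧ S.φ (S.φ (S.φ d)) ≠ d

/-- `d` ends at a vertex on a face with at least four sides, one step after a vertex. -/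
def Big' (d : D) : Prop := S.real (S.φ.symm d) ∧ S.φ (S.φ (S.φ d)) ≠ d

open Classical in
/-- The charge sent through `d` to the face of `d`. -/
noncomputable def dem (d : D) : ℕ :=
  if S.real d then
    if S.real (S.φ d) then 0
    else if S.IsT1 (S.φ d) then
      if S.IsT1 (S.φ.symm (S.α d)) then (if S.Big' (S.α (S.φ (S.α d))) then 1 else 0)
      else if S.Big' (S.α d) then 3 else 1
    else 0
  else if S.real (S.φ d) then
    if S.IsT1 (S.φ.symm d) then
      if S.IsT1 (S.φ (S.α d)) then (if S.Big (S.α (S.φ.symm (S.α d))) then 1 else 0)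
      else if S.Big (S.α d) then 3 else 1
    else 0
  else if S.Strip 0 d ∨ S.Strip 1 d ∨ S.Strip 2 d then 2
  else if S.IsT0 d then
    if S.RealAfter d ∧ S.RealBefore d then 10
    else if S.NoDouble d ∧ (S.RealAfter d ∨ S.RealBefore d) then (if S.Bad d then 3 else 4)
    else 0
  else 0

variable {S}

theorem dem_of_real_of_real {d : D} (h : S.real d) (h' : S.real (S.φ d)) : S.dem (S.α d) = 0 := by
  rw [dem, if_pos ((real_φ d).1 h'), if_pos ((real_φα d).2 h)]

theorem dem_of_real {d : D} (h : S.real d) (h' : ¬ S.real (S.φ d)) :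
    S.dem (S.α d) ≤ 3 ∧ (¬ S.Big d → S.dem (S.α d) ≤ 1) ∧
      (¬ S.IsT1 (S.φ.symm (S.α d)) → S.dem (S.α d) = 0) := by
  rw [dem, if_neg ((real_φ d).not.1 h'), if_pos ((real_φα d).2 h), S.α_α]
  refine ⟨?_, ?_, ?_⟩ <;> intros <;> split_ifs <;> omega

theorem dem_of_real_φ {d : D} (h : ¬ S.real d) (h' : S.real (S.φ d)) :
    S.dem (S.α d) ≤ 3 ∧ (¬ S.Big' d → S.dem (S.α d) ≤ 1) ∧
      (¬ S.IsT1 (S.φ (S.α d)) → S.dem (S.α d) = 0) := by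
  rw [dem, if_pos ((real_φ d).1 h'), if_neg ((real_φα d).not.2 h), S.α_α]
  refine ⟨?_, ?_, ?_⟩ <;> intros <;> split_ifs <;> omega

theorem dem_le_of_not_real {d : D} (h : ¬ S.real d) (h' : ¬ S.real (S.φ d)) :
    S.dem (S.α d) ≤ 10 ∧
      (¬ (S.real (S.φ (S.φ d)) ∧ S.real (S.φ.symm d)) → S.dem (S.α d) ≤ 4) ∧
      (¬ S.real (S.φ (S.φ d)) → ¬ S.real (S.φ.symm d) → S.dem (S.α d) ≤ 2) := by
  rw [dem, if_neg ((real_φ d).not.1 h'), if_neg ((real_φα d).not.2 h), RealAfter, RealBefore,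
    S.α_α]
  refine ⟨?_, ?_, ?_⟩ <;> intros <;> split_ifs <;> first | omega | tauto

theorem IsT1.dem_eq {d : D} (h : S.IsT1 d) : S.dem d = 2 := by
  rw [dem, if_neg h.2.1, if_neg h.2.2.1, if_pos (Or.inl (show S.Strip 0 d from h))]

namespace IsReduced

variable (hS : S.IsReduced)
include hS

theorem dem_α_of_isT1 {d : D} (h : S.IsT1 d) : S.dem (S.α d) = 0 := by
  have hs : S.Strip 0 d := h
  have hn (k : ℕ) : ¬ S.Strip k (S.α d) := hS.not_strip_α hs
  rw [dem, if_neg ((real_φ d).not.1 h.2.2.1), if_neg ((real_φα d).not.2 h.2.1),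
    if_neg (by simp [hn]), if_neg (hS.not_isT0_of_strip hs)]

variable (hT : ∀ u v w, G.Adj u v → G.Adj v w → G.Adj w u → False)

include hT in
theorem adjacent_T1 {d : D} (h : S.IsT1 d) (h' : S.IsT1 (S.φ (S.α (S.φ d)))) :
    S.real (S.φ.symm (S.α (S.φ (S.φ d)))) ∧
    S.real (S.φ (S.φ (S.α (S.φ.symm (S.α (S.φ d)))))) ∧
    ¬ (S.φ (S.φ (S.φ (S.α (S.φ (S.φ d))))) = S.α (S.φ (S.φ d)) ∧
      S.φ (S.φ (S.φ (S.α (S.φ.symm (S.α (S.φ d)))))) = S.α (S.φ.symm (S.α (S.φ d)))) := by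
  obtain ⟨h3, c0, c1, r2⟩ := h
  obtain ⟨h3', c0', c1', r2'⟩ := h'
  set d' := S.φ (S.α (S.φ d)) with hd'
  have e1 : S.φ.symm (S.α (S.φ d)) = S.φ d' := by
    rw [Equiv.symm_apply_eq]; apply S.φ.injective; rw [h3']
  have e1' : S.α (S.φ d) = S.φ (S.φ d') := by apply S.φ.injective; rw [h3']
  rw [e1]
  set y := S.φ.symm (S.α (S.φ (S.φ d))) with hy
  have hφy : S.φ y = S.α (S.φ (S.φ d)) := by rw [hy, Equiv.apply_symm_apply]
  have cφy : ¬ S.real (S.φ y) := by rw [hφy, ← real_φ, h3]; exact c0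
  have nxy : S.nx y = d := by rw [nx, hφy, S.α_α, h3]
  have nxd : S.nx d = d' := rfl
  have ry : S.real y := by
    by_contra hc
    exact hS.no_four hc cφy (by rwa [nxy]) (by rwa [nxy, nxd])
  have rz : S.real (S.φ (S.φ (S.α (S.φ d')))) := by
    by_contra hc
    exact hS.no_four c0 c1 c1' hc
  refine ⟨ry, rz, ?_⟩
  rintro ⟨t1, t2⟩
  have ly : S.lab y = S.lab d := by rw [← nxy, hS.lab_nx cφy]
  have ld : S.lab d' = S.lab d := hS.lab_nx c1
  have lz : S.lab (S.φ (S.α (S.φ d'))) = S.lab y := by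
    rw [ly, ← ld]; exact hS.lab_nx c1'
  have hy2 : y = S.φ (S.φ (S.α (S.φ (S.φ d)))) := by rw [hy, Equiv.symm_apply_eq, t1]
  have rx : S.real (S.φ (S.α (S.φ (S.φ d)))) := (real_φα _).2 r2
  have f1 := fst_φ (S := S) (d := S.φ (S.α (S.φ (S.φ d)))) (by rw [← hy2]; exact ry)
  rw [← hy2] at f1
  have f2 := fst_φα r2
  have f3 := fst_φ rz
  have f4 := fst_φ (S := S) (d := S.φ (S.φ (S.α (S.φ d')))) (by rw [t2, ← real_φ]; exact r2')
  rw [t2, S.lab_α] at f4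
  have f5 := fst_φ r2'
  have f6 := fst_φ r2
  rw [← e1', S.lab_α] at f5
  rw [lz] at f3
  have a1 := (S.lab (S.φ (S.α (S.φ (S.φ d))))).adj
  have a2 := (S.lab y).adj
  have a3 := (S.lab (S.φ (S.φ (S.α (S.φ d'))))).adj
  rw [f3, ← f4] at a3
  rw [← f1, f2] at a1
  refine hT _ _ _ a1 a2 ?_
  convert a3 using 1
  simp only [SimpleGraph.Dart.symm_toProd, Prod.fst_swap] at f5 ⊢
  rw [← f5, f6]

include hT in
theorem charge_isT1 {d : D} (h : S.IsT1 d) :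
    4 + (S.dem (S.α d) + S.dem (S.α (S.φ d)) + S.dem (S.α (S.φ (S.φ d)))) ≤
      S.dem d + S.dem (S.φ d) + S.dem (S.φ (S.φ d)) := by
  rw [hS.dem_α_of_isT1 h, h.dem_eq]
  classical
  have h0 := h
  obtain ⟨h3, c0, c1, r2⟩ := h
  have ra : S.real (S.α (S.φ d)) := (real_φ _).1 r2
  have ca : ¬ S.real (S.φ (S.α (S.φ d))) := by rwa [real_φα]
  have cb : ¬ S.real (S.α (S.φ (S.φ d))) := by rwa [← real_φ, h3]
  have rb : S.real (S.φ (S.α (S.φ (S.φ d)))) := by rwa [real_φα]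
  have s2 : S.φ.symm (S.φ (S.φ d)) = S.φ d := by simp
  have e1 : S.dem (S.φ d) =
      if S.IsT1 (S.φ (S.α (S.φ d))) then (if S.Big (S.α (S.φ.symm (S.α (S.φ d)))) then 1 else 0)
      else if S.Big (S.α (S.φ d)) then 3 else 1 := by
    rw [dem, if_neg c1, if_pos r2, Equiv.symm_apply_apply, if_pos h0]
  have e2 : S.dem (S.φ (S.φ d)) = if S.IsT1 (S.φ.symm (S.α (S.φ (S.φ d)))) then
      (if S.Big' (S.α (S.φ (S.α (S.φ (S.φ d))))) then 1 else 0)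
      else if S.Big' (S.α (S.φ (S.φ d))) then 3 else 1 := by
    rw [dem, if_pos r2, if_neg (by rwa [h3]), if_pos (by rwa [h3])]
  have p1 : S.dem (S.α (S.φ d)) = if S.IsT1 (S.φ (S.α (S.φ d))) then
      (if S.Big' (S.α (S.φ (S.φ d))) then 1 else 0) else 0 := by
    rw [dem, if_pos ra, if_neg ca, S.α_α, Equiv.symm_apply_apply, if_pos h0]
  have p2 : S.dem (S.α (S.φ (S.φ d))) = if S.IsT1 (S.φ.symm (S.α (S.φ (S.φ d)))) then
      (if S.Big (S.α (S.φ d)) then 1 else 0) else 0 := by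
    rw [dem, if_neg cb, if_pos rb, S.α_α, h3, if_pos h0, s2]
  by_cases X1 : S.IsT1 (S.φ (S.α (S.φ d)))
  · obtain ⟨k1, k2, k3⟩ := hS.adjacent_T1 hT h0 X1
    have X2 : ¬ S.IsT1 (S.φ.symm (S.α (S.φ (S.φ d)))) := fun h => h.2.1 k1
    rw [e1, e2, p1, p2]
    simp only [X1, X2, Big, Big', k1, k2, if_true, if_false, true_and]
    split_ifs <;> first | omega | (exfalso; tauto)
  · by_cases X2 : S.IsT1 (S.φ.symm (S.α (S.φ (S.φ d))))
    · obtain ⟨k1, k2, k3⟩ := hS.adjacent_T1 hT X2 (by rwa [Equiv.apply_symm_apply, S.α_α, h3])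
      rw [Equiv.apply_symm_apply] at k1 k2 k3
      rw [S.α_α, s2] at k2 k3
      rw [e1, e2, p1, p2]
      simp only [X1, X2, Big, Big', k1, k2, if_true, if_false, true_and]
      split_ifs <;> first | omega | (exfalso; tauto)
    · rw [e1, e2, p1, p2]
      simp only [X1, X2, if_false]
      split_ifs <;> omega

end IsReduced

end StrandMap

namespace StrandMap

variable {V : Type} {G : SimpleGraph V} {n : ℕ} {D Φ : Type} {S : StrandMap G n D Φ}

theorem IsT0.rotate {d : D} (h : S.IsT0 d) : S.IsT0 (S.φ d) :=
  ⟨by rw [h.1], h.2.2.1, h.2.2.2, by rw [h.1]; exact h.2.1⟩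

theorem IsT0.noDouble_iff {d : D} (h : S.IsT0 d) : S.NoDouble (S.φ d) ↔ S.NoDouble d := by
  unfold NoDouble
  rw [h.1]
  tauto

theorem dem_eq_of_isT0 {d : D} (h : S.IsT0 d)
    (hn : ¬ (S.Strip 0 d ∨ S.Strip 1 d ∨ S.Strip 2 d)) :
    (S.RealAfter d → S.RealBefore d → S.dem d = 10) ∧
    (S.NoDouble d → S.RealAfter d ∨ S.RealBefore d → 3 ≤ S.dem d ∧ S.dem d ≤ 4 ∧
      (S.dem d = 3 ↔ S.Bad d)) ∧
    (S.dem d ≠ 0 → ¬ (S.RealAfter d ∧ S.RealBefore d) → S.NoDouble d ∧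
      (S.RealAfter d ∨ S.RealBefore d)) := by
  rw [dem, if_neg h.2.1, if_neg h.2.2.1, if_neg hn, if_pos h]
  refine ⟨?_, ?_, ?_⟩
  · intro h1 h2
    rw [if_pos ⟨h1, h2⟩]
  · intro h1 h2
    rw [if_neg h1.1, if_pos ⟨h1, h2⟩]
    split_ifs with hb <;> simp [hb]
  · intro h1 h2
    rw [if_neg h2] at h1
    split_ifs at h1 <;> first | assumption | omega

namespace IsReduced

variable (hS : S.IsReduced)
include hS

theorem not_strip_of_isT0 {k : ℕ} {d : D} (h : S.IsT0 d) : ¬ S.Strip k d := by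
  cases k with
  | zero => exact fun h' => h.2.2.2 h'.2.2.2
  | succ k =>
    intro h'
    have h1 := h'.1.1
    rw [h.1] at h1
    exact hS.φ_ne d h1

theorem realAfter_or {d : D} (h : S.IsT0 d) :
    S.RealAfter (S.φ d) ∨ S.RealBefore (S.φ.symm d) := by
  by_contra hc
  rw [not_or] at hc
  obtain ⟨h1, h2⟩ := hc
  have e : S.nx (S.φ.symm (S.α (S.φ.symm d))) = d := by rw [nx, Equiv.apply_symm_apply, S.α_α]; simp
  refine hS.no_four h2 ?_ (by rw [e]; exact h.2.2.1) (by rw [e]; exact h1)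
  rw [Equiv.apply_symm_apply, ← real_φ, Equiv.apply_symm_apply]
  exact h.2.1

theorem real_of_noDouble {d : D} (h : S.IsT0 d) (hN : S.NoDouble d) :
    (S.RealAfter d ∧ S.RealAfter (S.φ d) ∧ S.RealAfter (S.φ (S.φ d)) ∧
      ¬ S.RealBefore d ∧ ¬ S.RealBefore (S.φ d) ∧ ¬ S.RealBefore (S.φ (S.φ d))) ∨
    (S.RealBefore d ∧ S.RealBefore (S.φ d) ∧ S.RealBefore (S.φ (S.φ d)) ∧
      ¬ S.RealAfter d ∧ ¬ S.RealAfter (S.φ d) ∧ ¬ S.RealAfter (S.φ (S.φ d))) := by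
  have h0 := hS.realAfter_or h
  have h1 := hS.realAfter_or h.rotate
  have h2 := hS.realAfter_or h.rotate.rotate
  rw [symm_of_three h.1] at h0
  rw [h.1] at h2
  rw [Equiv.symm_apply_apply] at h1 h2
  obtain ⟨n0, n1, n2⟩ := hN
  tauto

theorem adj_of_bad_after {e : D} (hb : S.Bad e)
    (hn : ¬ S.RealBefore e) :
    G.Adj (S.lab (S.φ (S.φ (S.α e)))).fst (S.lab e).snd := by
  obtain ⟨h4, hb⟩ := hb
  rcases hb with hb | hb
  swap
  · exact absurd hb.1 hn
  set q := S.α e with hq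
  obtain ⟨t3, tc0, tc1, tr2⟩ := hb.2
  set t := S.α (S.φ (S.φ (S.φ q))) with ht
  have cq3 : ¬ S.real (S.φ (S.φ (S.φ q))) := by
    have := (real_φ t).not.1 tc1
    rwa [ht, S.α_α] at this
  have l1 : S.lab (S.φ t) = S.lab (S.φ (S.φ q)) := by
    rw [ht, hS.lab_φα cq3, Equiv.symm_apply_apply]
  have l2 := hS.lab_φα tc0
  rw [symm_of_three t3, ht, S.α_α, ← ht, h4] at l2
  have f := fst_φ tr2
  rw [← l2, l1, hq, S.lab_α] at f
  have := (S.lab (S.φ (S.φ q))).adj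
  rw [hq, ← f] at this
  exact this

theorem adj_of_bad_before {e : D} (hb : S.Bad e)
    (ha : S.RealBefore e) (hn : ¬ S.RealAfter e) :
    G.Adj (S.lab e).fst (S.lab (S.φ.symm (S.α e))).fst := by
  obtain ⟨h4, hb⟩ := hb
  rcases hb with hb | hb
  · exact absurd hb.1 hn
  unfold RealAfter at hn
  unfold RealBefore at ha
  rw [symm_of_four h4] at ha ⊢
  set q := S.α e with hq
  obtain ⟨t3, tc0, tc1, tr2⟩ := hb.2
  set t := S.α (S.φ q) with ht
  have cq1 : ¬ S.real (S.φ q) := by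
    have := (real_φ t).not.1 tc1
    rwa [ht, S.α_α] at this
  have l1 : S.lab (S.φ t) = S.lab q := by
    rw [ht, hS.lab_φα cq1, Equiv.symm_apply_apply]
  have l2 := hS.lab_φα tc0
  rw [symm_of_three t3, ht, S.α_α, ← ht] at l2
  have f := fst_φ tr2
  have f2 := fst_φ ha
  rw [l2] at f2
  rw [l1, hq, S.lab_α] at f
  have := (S.lab (S.φ (S.φ t))).adj
  rw [← f2, f] at this
  exact this

theorem dem_α_isT0 {e : D} (h : S.IsT0 e) : S.dem (S.α e) = 0 := by
  have hn (k : ℕ) : ¬ S.Strip k (S.α e) := by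
    intro h'
    have := hS.not_isT0_of_strip h'
    rw [S.α_α] at this
    exact this h
  have hr : S.φ.symm e = _ := symm_of_three h.1
  obtain ⟨h3, c0, c1, c2⟩ := h
  rw [dem, if_neg ((real_φ e).not.1 c1), if_neg ((real_φα e).not.2 c0), if_neg (by simp [hn])]
  have n1 : ¬ S.RealAfter (S.α e) := by rwa [RealAfter, S.α_α]
  have n2 : ¬ S.RealBefore (S.α e) := by rwa [RealBefore, S.α_α, hr]
  simp [n1, n2]

theorem charge_isT0 (hT : ∀ u v w, G.Adj u v → G.Adj v w → G.Adj w u → False) {e : D}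
    (h : S.IsT0 e) : 10 ≤ S.dem e + S.dem (S.φ e) + S.dem (S.φ (S.φ e)) := by
  have h1 := h.rotate
  have h2 := h1.rotate
  have hn {e : D} (h : S.IsT0 e) : ¬ (S.Strip 0 e ∨ S.Strip 1 e ∨ S.Strip 2 e) := by
    simp [hS.not_strip_of_isT0 h]
  have d0 := dem_eq_of_isT0 h (hn h)
  have d1 := dem_eq_of_isT0 h1 (hn h1)
  have d2 := dem_eq_of_isT0 h2 (hn h2)
  rw [h1.noDouble_iff] at d2
  rw [h.noDouble_iff] at d1 d2
  by_cases hN : S.NoDouble e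
  · have hr := hS.real_of_noDouble h hN
    have m0 := d0.2.1 hN (by rcases hr with hr | hr <;> simp [hr])
    have m1 := d1.2.1 hN (by rcases hr with hr | hr <;> simp [hr])
    have m2 := d2.2.1 hN (by rcases hr with hr | hr <;> simp [hr])
    by_contra hlt
    have b0 : S.Bad e := m0.2.2.1 (by omega)
    have b1 : S.Bad (S.φ e) := m1.2.2.1 (by omega)
    have b2 : S.Bad (S.φ (S.φ e)) := m2.2.2.1 (by omega)
    have c0 := h.2.1
    have c1 := h.2.2.1
    have c2 := h.2.2.2
    rcases hr with ⟨r0, r1, r2, n0, n1, n2⟩ | ⟨r0, r1, r2, n0, n1, n2⟩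
    · have a0 := hS.adj_of_bad_after b0 n0
      have a1 := hS.adj_of_bad_after b1 n1
      have a2 := hS.adj_of_bad_after b2 n2
      have key {x : D} (hx : ¬ S.real (S.φ x)) (hr : S.RealAfter (S.φ x)) :
          (S.lab (S.φ (S.φ (S.α (S.φ x))))).fst = (S.lab x).snd := by
        rw [fst_φ hr]
        exact congrArg (fun a : G.Dart => a.snd) (hS.lab_nx hx)
      rw [← key c1 r1] at a0
      rw [← key c2 r2] at a1
      have k := key (x := S.φ (S.φ e)) (by rwa [h.1]) (by rwa [h.1])
      rw [h.1] at k
      rw [← k] at a2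
      exact hT _ _ _ a0 a1 a2
    · have a0 := hS.adj_of_bad_before b0 r0 n0
      have a1 := hS.adj_of_bad_before b1 r1 n1
      have a2 := hS.adj_of_bad_before b2 r2 n2
      have key {x : D} (hx : ¬ S.real (S.φ x)) :
          (S.lab (S.φ.symm (S.α x))).fst = (S.lab (S.φ x)).fst := by
        have := hS.lab_nx (d := S.φ.symm (S.α x)) (by
          rwa [Equiv.apply_symm_apply, ← real_φ])
        rw [nx, Equiv.apply_symm_apply, S.α_α] at this
        rw [this]
      rw [key c1] at a0
      rw [key c2] at a1
      rw [key (by rwa [h.1]), h.1] at a2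
      exact hT _ _ _ a0 a1 a2
  · by_cases hd0 : S.RealAfter e ∧ S.RealBefore e
    · have := d0.1 hd0.1 hd0.2
      omega
    by_cases hd1 : S.RealAfter (S.φ e) ∧ S.RealBefore (S.φ e)
    · have := d1.1 hd1.1 hd1.2
      omega
    by_cases hd2 : S.RealAfter (S.φ (S.φ e)) ∧ S.RealBefore (S.φ (S.φ e))
    · have := d2.1 hd2.1 hd2.2
      omega
    exact absurd ⟨hd0, hd1, hd2⟩ hN

theorem dem_isQ0 {q : D} (h : S.IsQ0 q) : S.dem (S.α (S.φ (S.φ q))) ≤ S.dem q := by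
  have hs : S.φ.symm (S.φ (S.φ q)) = S.φ q := by simp
  have h' := h
  obtain ⟨h4, c0, c1, c2, c3⟩ := h'
  by_cases hs2 : S.Strip 0 (S.α (S.φ (S.φ q))) ∨ S.Strip 1 (S.α (S.φ (S.φ q))) ∨
      S.Strip 2 (S.α (S.φ (S.φ q)))
  · have : S.Strip 0 q ∨ S.Strip 1 q ∨ S.Strip 2 q := by
      rcases hs2 with hs2 | hs2 | hs2
      · exact Or.inr (Or.inl ⟨h, hs2⟩)
      · exact Or.inr (Or.inr ⟨h, hs2⟩)
      · exact absurd ⟨h, hs2⟩ (hS.not_strip_three (g := q))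
    rw [dem, if_neg ((real_φ _).not.1 c3), if_neg ((real_φα _).not.2 c2), if_pos hs2,
      dem, if_neg c0, if_neg c1, if_pos this]
  · rw [dem, if_neg ((real_φ _).not.1 c3), if_neg ((real_φα _).not.2 c2), if_neg hs2]
    have n1 : ¬ S.RealAfter (S.α (S.φ (S.φ q))) := by rwa [RealAfter, S.α_α, h4]
    have n2 : ¬ S.RealBefore (S.α (S.φ (S.φ q))) := by rwa [RealBefore, S.α_α, hs]
    simp [n1, n2]

end IsReduced

end StrandMap

namespace StrandMap

variable {V : Type} {G : SimpleGraph V} {n : ℕ} {D Φ : Type} {S : StrandMap G n D Φ}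

theorem dem_cases {d : D} (c0 : ¬ S.real d) (c1 : ¬ S.real (S.φ d)) (h : 0 < S.dem d)
    (hd : ¬ (S.RealAfter d ∧ S.RealBefore d)) :
    (∃ k, S.Strip k d) ∨ (S.IsT0 d ∧ S.NoDouble d) := by
  rw [dem, if_neg c0, if_neg c1] at h
  split_ifs at h with h1 h2 h3
  · left
    rcases h1 with h1 | h1 | h1 <;> exact ⟨_, h1⟩
  · exact Or.inr ⟨h2, h3.1⟩
  · exact Or.inr ⟨h2, h3.1⟩
  · omega
  · omega

theorem dem_of_strip {k : ℕ} {d : D} (h : S.Strip k d) (h3 : ¬ S.IsT0 d) : S.dem d ≤ 2 := by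
  have := h.not_real
  rw [dem, if_neg this.1, if_neg this.2, if_neg h3]
  split_ifs <;> omega

theorem not_isT0_of_dem {d : D} (c0 : ¬ S.real d) (c1 : ¬ S.real (S.φ d)) (h : 2 < S.dem d)
    (hd : ¬ (S.RealAfter d ∧ S.RealBefore d)) : S.IsT0 d ∧ S.NoDouble d := by
  rw [dem, if_neg c0, if_neg c1] at h
  split_ifs at h with h1 h2 h3
  · omega
  · exact ⟨h2, h3.1⟩
  · exact ⟨h2, h3.1⟩
  · omega
  · omega

namespace IsReduced

variable (hS : S.IsReduced)
include hS

section

variable {r : D} (h4 : S.φ (S.φ (S.φ (S.φ r))) = r) (hr : S.real r) (c1 : ¬ S.real (S.φ r))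
  (c2 : ¬ S.real (S.φ (S.φ r))) (c3 : ¬ S.real (S.φ (S.φ (S.φ r))))
include h4 hr c1 c2 c3

theorem charge_second (h : 2 < S.dem (S.α (S.φ (S.φ r)))) :
    S.dem (S.α r) + S.dem (S.α (S.φ r)) + S.dem (S.α (S.φ (S.φ r))) ≤ 5 := by
  set q := S.φ (S.φ r) with hq
  set e := S.α q with he
  have hs1 : S.φ.symm (S.φ r) = r := by simp
  have hsq : S.φ.symm q = S.φ r := by simp [hq]
  have ce : ¬ S.real e := (real_φ q).not.1 c3
  have ce' : ¬ S.real (S.φ e) := (real_φα q).not.2 c2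
  have ua : S.RealAfter e := by rw [RealAfter, he, S.α_α, h4]; exact hr
  have ub : ¬ S.RealBefore e := by rw [RealBefore, he, S.α_α, hsq]; exact c1
  obtain ⟨hT0, hN⟩ := not_isT0_of_dem ce ce' h (fun h => ub h.2)
  have hc := hS.real_of_noDouble hT0 hN
  have hc : S.RealAfter e ∧ S.RealAfter (S.φ e) ∧ S.RealAfter (S.φ (S.φ e)) ∧
      ¬ S.RealBefore e ∧ ¬ S.RealBefore (S.φ e) ∧ ¬ S.RealBefore (S.φ (S.φ e)) := by
    rcases hc with hc | hc
    · exact hc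
    · exact absurd hc.1 ub
  have ry : S.real (S.φ.symm (S.α r)) := by
    by_contra hy
    have e1 : S.nx (S.φ.symm (S.α r)) = S.φ r := by rw [nx_symm, S.α_α]
    refine hS.no_four hy ?_ (by rwa [e1]) ?_
    · rwa [Equiv.apply_symm_apply, ← real_φ]
    · rw [e1]; exact hT0.2.2.2
  have p0 : S.dem (S.α r) = 0 := (dem_of_real hr c1).2.2 (fun h => h.2.1 ry)
  have hle := ((dem_eq_of_isT0 hT0 (by simp [hS.not_strip_of_isT0 hT0])).2.1 hN (Or.inl ua)).2
  set f := S.α (S.φ r) with hf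
  have cf : ¬ S.real f := (real_φ _).not.1 c2
  have cf' : ¬ S.real (S.φ f) := (real_φα _).not.2 c1
  by_cases hp : S.dem f = 0
  · omega
  by_cases hfT : S.IsT0 f
  · exfalso
    have ub' : S.RealBefore f := by rw [RealBefore, hf, S.α_α, hs1]; exact hr
    have ua' : S.RealAfter (S.φ f) := by
      have e2 : S.nx f = S.α (S.φ.symm (S.α r)) := nx_α_φ c1
      show S.real (S.φ (S.nx f))
      rw [e2, real_φα]
      exact ry
    have hua : ¬ S.RealAfter f := by rw [RealAfter, hf, S.α_α]; exact c3
    rcases dem_cases cf cf' (by omega) (fun h => hua h.1) with ⟨k, hk⟩ | ⟨-, hN'⟩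
    · exact hS.not_strip_of_isT0 hfT hk
    · rcases hS.real_of_noDouble hfT hN' with hc | hc
      · exact hua hc.1
      · exact hc.2.2.2.2.1 ua'
  have hle2 : ∃ k, S.Strip k f := by
    rcases dem_cases cf cf' (by omega) (fun h => c3 (by have := h.1; rwa [RealAfter, hf, S.α_α] at this)) with h | h
    · exact h
    · exact absurd h.1 hfT
  obtain ⟨k, hk⟩ := hle2
  have := dem_of_strip hk hfT
  suffices S.Bad e by
    have := hle.2.2 this
    omega
  have hT1 : S.IsT1 f := by
    cases k with
    | zero => exact hk
    | succ k =>
      exfalso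
      obtain ⟨g4, g0, g1, g2, g3⟩ := hk.1
      have e1 : S.nx (S.φ.symm f) = q := by rw [nx_symm, hf, S.α_α]
      have e2 : S.nx q = S.α (S.φ.symm (S.α (S.φ (S.φ e)))) := by
        have := nx_α_φ (S := S) (g := S.φ (S.φ e)) (by rw [hT0.1]; exact ce)
        rwa [hT0.1, he, S.α_α] at this
      refine hS.no_four (d := S.φ.symm f) ?_ ?_ ?_ ?_
      · rw [symm_of_four g4]; exact g3
      · rwa [Equiv.apply_symm_apply]
      · rw [e1]; exact c3
      · rw [e1, e2, real_φα]; exact hc.2.2.2.2.2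
  refine ⟨?_, Or.inl ⟨ua, ?_⟩⟩
  · rw [he, S.α_α, hq, h4]
  · rw [he, S.α_α, h4]; exact hT1

theorem charge_first (h : 2 < S.dem (S.α (S.φ r))) :
    S.dem (S.α (S.φ r)) + S.dem (S.α (S.φ (S.φ r))) + S.dem (S.α (S.φ (S.φ (S.φ r)))) ≤ 5 := by
  set q := S.φ r with hq
  set e := S.α q with he
  have hs1 : S.φ.symm q = r := by simp [hq]
  have hsq : S.φ.symm (S.φ q) = q := by simp
  have ce : ¬ S.real e := (real_φ q).not.1 c2
  have ce' : ¬ S.real (S.φ e) := (real_φα q).not.2 c1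
  have ua : ¬ S.RealAfter e := by rw [RealAfter, he, S.α_α]; exact c3
  have ub : S.RealBefore e := by rw [RealBefore, he, S.α_α, hs1]; exact hr
  obtain ⟨hT0, hN⟩ := not_isT0_of_dem ce ce' h (fun h => ua h.1)
  have hc := hS.real_of_noDouble hT0 hN
  have hc : S.RealBefore e ∧ S.RealBefore (S.φ e) ∧ S.RealBefore (S.φ (S.φ e)) ∧
      ¬ S.RealAfter e ∧ ¬ S.RealAfter (S.φ e) ∧ ¬ S.RealAfter (S.φ (S.φ e)) := by
    rcases hc with hc | hc
    · exact absurd hc.1 ua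
    · exact hc
  have e1 : S.nx (S.φ (S.φ e)) = S.φ q := by rw [nx, hT0.1, he, S.α_α]
  have ry : S.real (S.φ (S.nx (S.φ q))) := by
    by_contra hy
    refine hS.no_four (d := S.φ (S.φ e)) hT0.2.2.2 (by rw [hT0.1]; exact ce) ?_ ?_
    · rw [e1]; exact c3
    · rw [e1]; exact hy
  have p0 : S.dem (S.α (S.φ (S.φ q))) = 0 :=
    (dem_of_real_φ c3 (by rwa [h4])).2.2 (fun h => h.2.2.1 ry)
  have hle := ((dem_eq_of_isT0 hT0 (by simp [hS.not_strip_of_isT0 hT0])).2.1 hN (Or.inr ub)).2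
  set f := S.α (S.φ q) with hf
  have cf : ¬ S.real f := (real_φ _).not.1 c3
  have cf' : ¬ S.real (S.φ f) := (real_φα _).not.2 c2
  have hub : ¬ S.RealBefore f := by rw [RealBefore, hf, S.α_α, hsq]; exact c1
  by_cases hp : S.dem f = 0
  · omega
  by_cases hfT : S.IsT0 f
  · exfalso
    have ua' : S.RealAfter f := by rw [RealAfter, hf, S.α_α, h4]; exact hr
    have ub' : S.RealBefore (S.φ.symm f) := by
      have := nx_α_φ (S := S) (g := S.φ.symm f) (by rwa [Equiv.apply_symm_apply])
      rw [Equiv.apply_symm_apply, hf, S.α_α, ← hf] at this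
      rw [this, real_φα] at ry
      exact ry
    rcases dem_cases cf cf' (by omega) (fun h => hub h.2) with ⟨k, hk⟩ | ⟨-, hN'⟩
    · exact hS.not_strip_of_isT0 hfT hk
    · rw [symm_of_three hfT.1] at ub'
      rcases hS.real_of_noDouble hfT hN' with hc | hc
      · exact hc.2.2.2.2.2 ub'
      · exact hub hc.1
  have hle2 : ∃ k, S.Strip k f := by
    rcases dem_cases cf cf' (by omega) (fun h => hub h.2) with h | h
    · exact h
    · exact absurd h.1 hfT
  obtain ⟨k, hk⟩ := hle2
  have := dem_of_strip hk hfT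
  suffices S.Bad e by
    have := hle.2.2 this
    omega
  have hT1 : S.IsT1 f := by
    cases k with
    | zero => exact hk
    | succ k =>
      exfalso
      obtain ⟨g4, g0, g1, g2, g3⟩ := hk.1
      have c' : ¬ S.real (S.φ (S.α (S.φ e))) := by rwa [real_φα]
      have e1 : S.nx (S.α (S.φ (S.α (S.φ e)))) = q := by
        rw [nx_α_φ c', S.α_α, Equiv.symm_apply_apply, he, S.α_α]
      refine hS.no_four (d := S.α (S.φ (S.α (S.φ e)))) ?_ ?_ ?_ ?_
      · rw [← real_φ]; exact hc.2.2.2.2.1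
      · rwa [real_φα]
      · rw [e1]; exact c2
      · rw [e1]; exact g2
  refine ⟨?_, Or.inr ⟨ub, ?_⟩⟩
  · rw [he, S.α_α, hq, h4]
  · rw [he, S.α_α]; exact hT1

theorem charge_quad : S.dem (S.α r) + S.dem (S.α (S.φ r)) + S.dem (S.α (S.φ (S.φ r))) +
    S.dem (S.α (S.φ (S.φ (S.φ r)))) ≤ 6 := by
  have p0 := (dem_of_real hr c1).2.1 (fun h => c2 h.1)
  have p3 := (dem_of_real_φ c3 (by rwa [h4])).2.1 (fun h => by
    have := h.1
    rw [Equiv.symm_apply_apply] at this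
    exact c2 this)
  by_cases h1 : 2 < S.dem (S.α (S.φ r))
  · have := hS.charge_first h4 hr c1 c2 c3 h1
    omega
  by_cases h2 : 2 < S.dem (S.α (S.φ (S.φ r)))
  · have := hS.charge_second h4 hr c1 c2 c3 h2
    omega
  omega

end

end IsReduced

end StrandMap

namespace StrandMap

variable {V : Type} {G : SimpleGraph V} {n : ℕ} {D Φ : Type} {S : StrandMap G n D Φ}

/-- `O` is the orbit of `d` under the face permutation. -/
def IsOrbit (S : StrandMap G n D Φ) (O : Finset D) (d : D) : Prop :=
  ∀ x, x ∈ O ↔ S.φ.SameCycle d x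

namespace IsOrbit

variable {O : Finset D} {d : D} (hO : S.IsOrbit O d)
include hO

theorem self_mem : d ∈ O := (hO d).2 (Equiv.Perm.SameCycle.refl _ _)

theorem of_mem {x : D} (hx : x ∈ O) : S.IsOrbit O x := fun y => by
  rw [hO y]
  have := (hO x).1 hx
  exact ⟨fun h => this.symm.trans h, fun h => this.trans h⟩

theorem φ_mem {x : D} : S.φ x ∈ O ↔ x ∈ O := by
  rw [hO, hO, Equiv.Perm.sameCycle_apply_right]

theorem subset [Finite D] {T : Finset D} (hT : ∀ x ∈ T, S.φ x ∈ T) (hd : d ∈ T) : O ⊆ T := by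
  intro x hx
  obtain ⟨i, -, rfl⟩ := ((hO x).1 hx).exists_pow_eq'
  clear hx
  induction i with
  | zero => exact hd
  | succ i ih => rw [pow_succ', Equiv.Perm.mul_apply]; exact hT _ ih

theorem eq_three [Finite D] [DecidableEq D] (h : S.φ (S.φ (S.φ d)) = d) :
    O = {d, S.φ d, S.φ (S.φ d)} := by
  apply Finset.Subset.antisymm
  · refine hO.subset ?_ (by simp)
    intro x hx
    simp only [Finset.mem_insert, Finset.mem_singleton] at hx ⊢
    rcases hx with rfl | rfl | rfl <;> simp [h]
  · intro x hx
    simp only [Finset.mem_insert, Finset.mem_singleton] at hx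
    rcases hx with rfl | rfl | rfl <;> simp [hO.φ_mem, hO.self_mem]

theorem eq_four [Finite D] [DecidableEq D] (h : S.φ (S.φ (S.φ (S.φ d))) = d) :
    O = {d, S.φ d, S.φ (S.φ d), S.φ (S.φ (S.φ d))} := by
  apply Finset.Subset.antisymm
  · refine hO.subset ?_ (by simp)
    intro x hx
    simp only [Finset.mem_insert, Finset.mem_singleton] at hx ⊢
    rcases hx with rfl | rfl | rfl | rfl <;> simp [h]
  · intro x hx
    simp only [Finset.mem_insert, Finset.mem_singleton] at hx
    rcases hx with rfl | rfl | rfl | rfl <;> simp [hO.φ_mem, hO.self_mem]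

theorem sum_φ (f : D → ℕ) : ∑ x ∈ O, f (S.φ x) = ∑ x ∈ O, f x :=
  Finset.sum_equiv S.φ (fun _ => hO.φ_mem.symm) (fun _ _ => rfl)

variable (hS : S.IsReduced)
include hS

theorem sum_three [Finite D] (h : S.φ (S.φ (S.φ d)) = d) (f : D → ℕ) :
    ∑ x ∈ O, f x = f d + f (S.φ d) + f (S.φ (S.φ d)) := by
  classical
  have h1 := hS.φ_ne d
  have h2 := hS.φ_φ_ne d
  rw [hO.eq_three h, Finset.sum_insert, Finset.sum_insert, Finset.sum_singleton, add_assoc]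
  · simpa using h1.symm
  · simpa using ⟨h1.symm, h2.symm⟩

theorem sum_four [Finite D] (h : S.φ (S.φ (S.φ (S.φ d))) = d) (f : D → ℕ) :
    ∑ x ∈ O, f x = f d + f (S.φ d) + f (S.φ (S.φ d)) + f (S.φ (S.φ (S.φ d))) := by
  classical
  have h1 := hS.φ_ne d
  have h2 := hS.φ_φ_ne d
  have h3 : S.φ (S.φ (S.φ d)) ≠ d := by
    intro h'
    rw [h'] at h
    exact h1 h
  rw [hO.eq_four h, Finset.sum_insert, Finset.sum_insert, Finset.sum_insert, Finset.sum_singleton]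
  · omega
  · simpa using h1.symm
  · simpa using ⟨h1.symm, h2.symm⟩
  · simpa using ⟨h1.symm, h2.symm, h3.symm⟩

theorem five_le_card (h3 : S.φ (S.φ (S.φ d)) ≠ d) (h4 : S.φ (S.φ (S.φ (S.φ d))) ≠ d) :
    5 ≤ O.card := by
  classical
  have h1 := hS.φ_ne d
  have h2 := hS.φ_φ_ne d
  have : ({d, S.φ d, S.φ (S.φ d), S.φ (S.φ (S.φ d)), S.φ (S.φ (S.φ (S.φ d)))} : Finset D) ⊆ O := by
    intro x hx
    simp only [Finset.mem_insert, Finset.mem_singleton] at hx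
    rcases hx with rfl | rfl | rfl | rfl | rfl <;> simp [hO.φ_mem, hO.self_mem]
  refine le_trans (le_of_eq ?_) (Finset.card_le_card this)
  rw [Finset.card_insert_of_notMem, Finset.card_insert_of_notMem, Finset.card_insert_of_notMem,
    Finset.card_insert_of_notMem, Finset.card_singleton]
  · simpa using h1.symm
  · simpa using ⟨h1.symm, h2.symm⟩
  · simpa using ⟨h1.symm, h2.symm, h3.symm⟩
  · simpa using ⟨h1.symm, h2.symm, h3.symm, h4.symm⟩

end IsOrbit

end StrandMap

namespace StrandMap

variable {V : Type} {G : SimpleGraph V} {n : ℕ} {D Φ : Type} {S : StrandMap G n D Φ}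

open Classical in
/-- The initial charge of a corner of a face. -/
noncomputable def base (S : StrandMap G n D Φ) (d : D) : ℕ := if S.real d then 16 else 10

theorem base_real {d : D} (h : S.real d) : S.base d = 16 := by simp [base, h]

theorem base_not_real {d : D} (h : ¬ S.real d) : S.base d = 10 := by simp [base, h]

theorem dem_step {d : D} (h : ¬ S.real (S.φ (S.φ d)) ∨ S.φ (S.φ (S.φ d)) = d) (hd : S.real d) :
    S.dem (S.α d) ≤ 1 := by
  by_cases h' : S.real (S.φ d)
  · rw [dem_of_real_of_real hd h']; omega
  · exact (dem_of_real hd h').2.1 (fun hb => by rcases h with h | h; exacts [h hb.1, hb.2 h])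

theorem dem_step' {d : D} (h : ¬ S.real (S.φ.symm d) ∨ S.φ (S.φ (S.φ d)) = d)
    (hd : S.real (S.φ d)) : S.dem (S.α d) ≤ 1 := by
  by_cases h' : S.real d
  · rw [dem_of_real_of_real h' hd]; omega
  · exact (dem_of_real_φ h' hd).2.1 (fun hb => by rcases h with h | h; exacts [h hb.1, hb.2 h])

theorem IsOrbit.sum_dem_le {O : Finset D} {d : D} (hO : S.IsOrbit O d) :
    2 * ∑ x ∈ O, S.dem (S.α x) ≤ ∑ x ∈ O, (open Classical in if S.real x then 0 else 12) := by
  classical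
  set A : D → ℕ := fun x => if S.real x then 0 else
    if S.real (S.φ x) then 2 * S.dem (S.α x) else S.dem (S.α x) with hA
  set B : D → ℕ := fun x => if S.real (S.φ x) then 0 else
    if S.real x then 2 * S.dem (S.α x) else S.dem (S.α x) with hB
  have h1 : ∑ x ∈ O, B (S.φ.symm x) = ∑ x ∈ O, B x := by
    rw [← hO.sum_φ]; simp
  calc 2 * ∑ x ∈ O, S.dem (S.α x) = ∑ x ∈ O, 2 * S.dem (S.α x) := Finset.mul_sum _ _ _
    _ ≤ ∑ x ∈ O, (A x + B x) := by
        refine Finset.sum_le_sum (fun x _ => ?_)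
        simp only [hA, hB]
        by_cases h : S.real x <;> by_cases h' : S.real (S.φ x)
        · simp [dem_of_real_of_real h h']
        all_goals simp [h, h']
        omega
    _ = ∑ x ∈ O, (A x + B (S.φ.symm x)) := by
        rw [Finset.sum_add_distrib, Finset.sum_add_distrib, h1]
    _ ≤ _ := by
        refine Finset.sum_le_sum (fun x _ => ?_)
        simp only [hA, hB, Equiv.apply_symm_apply]
        split_ifs with c0 c1 c2 c2
        · omega
        · have e1 := (dem_of_real_φ c0 c1).1
          have e2 := (dem_of_real c2 (by simpa using c0)).1
          omega
        · have e1 := (dem_of_real_φ c0 c1).2.1 (fun h => c2 h.1)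
          have e2 := (dem_le_of_not_real c2 (by simpa using c0)).1
          omega
        · have e1 := (dem_le_of_not_real c0 c1).1
          have e2 := (dem_of_real c2 (by simpa using c0)).2.1
            (fun h => c1 (by simpa using h.1))
          omega
        · have e1 := (dem_le_of_not_real c0 c1).2.1 (fun h => c2 h.2)
          have e2 := (dem_le_of_not_real c2 (by simpa using c0)).2.1
            (fun h => c1 (by simpa using h.1))
          omega

namespace IsReduced

variable (hS : S.IsReduced) (hT : ∀ u v w, G.Adj u v → G.Adj v w → G.Adj w u → False)
include hS hT

theorem charge_three {d : D} (h : S.φ (S.φ (S.φ d)) = d) :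
    40 + (S.dem (S.α d) + S.dem (S.α (S.φ d)) + S.dem (S.α (S.φ (S.φ d)))) ≤
      (S.base d + S.dem d) + (S.base (S.φ d) + S.dem (S.φ d)) +
        (S.base (S.φ (S.φ d)) + S.dem (S.φ (S.φ d))) := by
  have h' : S.φ (S.φ (S.φ (S.φ d))) = S.φ d := by rw [h]
  have h'' : S.φ (S.φ (S.φ (S.φ (S.φ d)))) = S.φ (S.φ d) := by rw [h]
  by_cases c0 : S.real d <;> by_cases c1 : S.real (S.φ d) <;> by_cases c2 : S.real (S.φ (S.φ d)) <;>
    simp only [base_real, base_not_real, c0, c1, c2, not_false_eq_true]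
  · have := dem_step (Or.inr h) c0
    have := dem_step (Or.inr h') c1
    have := dem_step (Or.inr h'') c2
    omega
  · have := dem_of_real_of_real c0 c1
    have := dem_step (Or.inr h') c1
    have := dem_step' (Or.inr h'') (by rwa [h])
    omega
  · have := dem_of_real_of_real c2 (by rwa [h])
    have := dem_step (Or.inr h) c0
    have := dem_step' (Or.inr h') c2
    omega
  · have := hS.charge_isT1 hT (d := S.φ d) ⟨h', c1, c2, by rwa [h]⟩
    rw [h] at this
    omega
  · have := dem_of_real_of_real c1 c2
    have := dem_step' (Or.inr h) c1
    have := dem_step (Or.inr h'') c2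
    omega
  · have := hS.charge_isT1 hT (d := S.φ (S.φ d)) ⟨h'', c2, by rwa [h], by rwa [h]⟩
    rw [h] at this
    omega
  · have := hS.charge_isT1 hT (d := d) ⟨h, c0, c1, c2⟩
    omega
  · have hT0 : S.IsT0 d := ⟨h, c0, c1, c2⟩
    have := hS.charge_isT0 hT hT0
    have := hS.dem_α_isT0 hT0
    have := hS.dem_α_isT0 hT0.rotate
    have := hS.dem_α_isT0 hT0.rotate.rotate
    omega

theorem charge [Finite D] {O : Finset D} {d : D} (hO : S.IsOrbit O d) :
    40 + ∑ x ∈ O, S.dem (S.α x) ≤ ∑ x ∈ O, (S.base x + S.dem x) := by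
  classical
  by_cases h3 : ∃ x ∈ O, S.φ (S.φ (S.φ x)) = x
  · obtain ⟨x, hx, h3⟩ := h3
    have hO' := hO.of_mem hx
    rw [hO'.sum_three hS h3, hO'.sum_three hS h3]
    exact hS.charge_three hT h3
  push Not at h3
  have hc4 : 4 ≤ O.card := by
    by_cases h4 : S.φ (S.φ (S.φ (S.φ d))) = d
    · rw [Finset.card_eq_sum_ones, hO.sum_four hS h4]
    · have := hO.five_le_card hS (h3 d hO.self_mem) h4
      omega
  have hv : (O.filter (fun x => S.real x)).card + (O.filter (fun x => ¬ S.real x)).card = O.card :=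
    Finset.card_filter_add_card_filter_not _
  have hb : ∑ x ∈ O, S.base x = 16 * (O.filter (fun x => S.real x)).card +
      10 * (O.filter (fun x => ¬ S.real x)).card := by
    simp only [base]
    rw [Finset.sum_ite, Finset.sum_const, Finset.sum_const]
    simp only [smul_eq_mul]
    ring
  have hp : 2 * ∑ x ∈ O, S.dem (S.α x) ≤ 12 * (O.filter (fun x => ¬ S.real x)).card := by
    refine hO.sum_dem_le.trans ?_
    rw [Finset.sum_ite, Finset.sum_const, Finset.sum_const]
    simp only [smul_eq_mul]
    omega
  rw [Finset.sum_add_distrib, hb]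
  rcases Nat.lt_or_ge 1 (O.filter (fun x => S.real x)).card with h2 | h2
  · omega
  rcases Nat.eq_zero_or_pos (O.filter (fun x => S.real x)).card with h0 | h0
  · have hr : ∀ x ∈ O, ¬ S.real x := by
      rw [Finset.card_eq_zero, Finset.filter_eq_empty_iff] at h0
      exact fun x hx => h0 hx
    by_cases h4 : S.φ (S.φ (S.φ (S.φ d))) = d
    · have hm := hO.self_mem
      have c0 := hr _ hm
      have c1 := hr _ (hO.φ_mem.2 hm)
      have c2 := hr _ (hO.φ_mem.2 (hO.φ_mem.2 hm))
      have c3 := hr _ (hO.φ_mem.2 (hO.φ_mem.2 (hO.φ_mem.2 hm)))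
      have q0 := hS.dem_isQ0 ⟨h4, c0, c1, c2, c3⟩
      have q1 := hS.dem_isQ0 (q := S.φ d) ⟨by rw [h4], c1, c2, c3, by rwa [h4]⟩
      have q2 := hS.dem_isQ0 (q := S.φ (S.φ d)) ⟨by rw [h4], c2, c3, by rwa [h4], by rwa [h4]⟩
      have q3 := hS.dem_isQ0 (q := S.φ (S.φ (S.φ d)))
        ⟨by rw [h4], c3, by rwa [h4], by rwa [h4], by rwa [h4]⟩
      rw [h4] at q2 q3
      rw [hO.sum_four hS h4, hO.sum_four hS h4]
      omega
    · have := hO.five_le_card hS (h3 d hO.self_mem) h4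
      have hs : ∑ x ∈ O, S.dem (S.α x) ≤ ∑ x ∈ O, 2 := by
        refine Finset.sum_le_sum (fun x hx => ?_)
        refine (dem_le_of_not_real (hr x hx) (hr _ (hO.φ_mem.2 hx))).2.2
          (hr _ (hO.φ_mem.2 (hO.φ_mem.2 hx))) (hr _ ?_)
        rw [← hO.φ_mem, Equiv.apply_symm_apply]
        exact hx
      rw [Finset.sum_const, smul_eq_mul] at hs
      omega
  · have h1 : (O.filter (fun x => S.real x)).card = 1 := by omega
    obtain ⟨r, hr⟩ := Finset.card_eq_one.1 h1
    have hr' : ∀ x ∈ O, S.real x ↔ x = r := fun x hx => by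
      have := Finset.ext_iff.1 hr x
      simpa [hx] using this
    have hrm : r ∈ O ∧ S.real r := by
      have := Finset.ext_iff.1 hr r
      simpa using this
    have hO' := hO.of_mem hrm.1
    by_cases h4 : S.φ (S.φ (S.φ (S.φ r))) = r
    · have hm := hO'.self_mem
      have c1 : ¬ S.real (S.φ r) := by
        rw [hr' _ (hO.φ_mem.2 hm)]; exact hS.φ_ne r
      have c2 : ¬ S.real (S.φ (S.φ r)) := by
        rw [hr' _ (hO.φ_mem.2 (hO.φ_mem.2 hm))]; exact hS.φ_φ_ne r
      have c3 : ¬ S.real (S.φ (S.φ (S.φ r))) := by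
        rw [hr' _ (hO.φ_mem.2 (hO.φ_mem.2 (hO.φ_mem.2 hm)))]; exact h3 r hm
      have hq := hS.charge_quad h4 hrm.2 c1 c2 c3
      rw [hO'.sum_four hS h4, hO'.sum_four hS h4]
      omega
    · have := hO'.five_le_card hS (h3 r hO'.self_mem) h4
      have hs : ∑ x ∈ O, (S.dem (S.α x) + (if x = r then 3 else 0) +
          (if S.φ x = r then 3 else 0)) ≤ ∑ x ∈ O, 4 := by
        refine Finset.sum_le_sum (fun x hx => ?_)
        have hx1 := hO.φ_mem.2 hx
        have hx2 := hO.φ_mem.2 hx1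
        have hx0 : S.φ.symm x ∈ O := by rwa [← hO.φ_mem, Equiv.apply_symm_apply]
        split_ifs with e0 e1 e1
        · exact absurd (by rw [e1, e0]) (hS.φ_ne x)
        · subst e0
          have := dem_step (Or.inl (by rw [hr' _ hx2]; exact hS.φ_φ_ne x)) hrm.2
          omega
        · have := dem_step' (d := x) (Or.inl (by
            rw [hr' _ hx0, ← e1]
            intro h
            rw [Equiv.symm_apply_eq] at h
            exact hS.φ_φ_ne x h.symm)) (by rw [e1]; exact hrm.2)
          omega
        · refine (dem_le_of_not_real (by rwa [hr' _ hx]) (by rwa [hr' _ hx1])).2.1 ?_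
          rw [hr' _ hx2, hr' _ hx0]
          rintro ⟨a, b⟩
          rw [Equiv.symm_apply_eq] at b
          rw [b] at a
          exact h3 r hrm.1 a
      rw [Finset.sum_add_distrib, Finset.sum_add_distrib,
        hO.sum_φ (fun x => if x = r then 3 else 0), Finset.sum_ite_eq', if_pos hrm.1,
        Finset.sum_const, smul_eq_mul] at hs
      omega

theorem card_real_le [Finite D] : {d | S.real d}.ncard ≤ 10 * n := by
  classical
  have := Fintype.ofFinite D
  let q : D → Quotient (Equiv.Perm.SameCycle.setoid S.φ) := Quotient.mk _
  have : Fintype (Quotient (Equiv.Perm.SameCycle.setoid S.φ)) := Fintype.ofFinite _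
  have hsum (f : D → ℕ) : ∑ x, f x = ∑ y, ∑ x with q x = y, f x :=
    (Finset.sum_fiberwise _ _ _).symm
  have key : 40 * Fintype.card (Quotient (Equiv.Perm.SameCycle.setoid S.φ)) +
      ∑ x, S.dem (S.α x) ≤ ∑ x, (S.base x + S.dem x) := by
    rw [hsum, hsum, mul_comm, ← smul_eq_mul, Fintype.card, ← Finset.sum_const,
      ← Finset.sum_add_distrib]
    refine Finset.sum_le_sum (fun y _ => ?_)
    obtain ⟨d, rfl⟩ := Quotient.exists_rep y
    refine hS.charge hT (d := d) (fun x => ?_)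
    simp only [Finset.mem_filter, Finset.mem_univ, true_and]
    rw [show (q x = Quotient.mk _ d) ↔ S.φ.SameCycle x d from Quotient.eq]
    exact ⟨fun h => h.symm, fun h => h.symm⟩
  have hα : ∑ x, S.dem (S.α x) = ∑ x, S.dem x :=
    Equiv.sum_comp (Function.Involutive.toPerm S.α S.α_α) S.dem
  have hface : (Set.range S.face).ncard ≤
      Fintype.card (Quotient (Equiv.Perm.SameCycle.setoid S.φ)) := by
    have hlift : ∀ a b : D, S.φ.SameCycle a b → S.face a = S.face b := by
      intro a b h
      obtain ⟨i, -, rfl⟩ := h.exists_pow_eq'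
      clear h
      induction i with
      | zero => rfl
      | succ i ih => rw [pow_succ', Equiv.Perm.mul_apply, face_φ, ih]
    have : Set.range S.face =
        Set.range (Quotient.lift (s := Equiv.Perm.SameCycle.setoid S.φ) S.face hlift) := by
      ext z
      constructor
      · rintro ⟨d, rfl⟩
        exact ⟨q d, rfl⟩
      · rintro ⟨y, rfl⟩
        obtain ⟨d, rfl⟩ := Quotient.exists_rep y
        exact ⟨d, rfl⟩
    rw [this, ← Set.image_univ, ← Nat.card_eq_fintype_card, ← Set.ncard_univ]
    exact Set.ncard_image_le
  have e1 : {d | S.real d}.ncard = (Finset.univ.filter (fun x => S.real x)).card := by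
    rw [← Set.ncard_coe_finset]; simp
  have e2 : {d | ¬ S.real d}.ncard = (Finset.univ.filter (fun x => ¬ S.real x)).card := by
    rw [← Set.ncard_coe_finset]; simp
  have hv : (Finset.univ.filter (fun x => S.real x)).card +
      (Finset.univ.filter (fun x => ¬ S.real x)).card = (Finset.univ : Finset D).card :=
    Finset.card_filter_add_card_filter_not _
  have hb : ∑ x, S.base x = 16 * (Finset.univ.filter (fun x => S.real x)).card +
      10 * (Finset.univ.filter (fun x => ¬ S.real x)).card := by
    simp only [base]
    rw [Finset.sum_ite, Finset.sum_const, Finset.sum_const]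
    simp only [smul_eq_mul]
    ring
  have he := S.euler
  rw [Finset.sum_add_distrib, hb, hα] at key
  rw [Nat.card_eq_fintype_card, Fintype.card, ← hv, e2] at he
  rw [e1]
  omega

end IsReduced

theorem card_dart_le [Finite D] (S : StrandMap G n D Φ)
    (hT : ∀ u v w, G.Adj u v → G.Adj v w → G.Adj w u → False) : Nat.card G.Dart ≤ 10 * n := by
  obtain ⟨D', S', _, hS'⟩ := exists_isReduced n Φ (Nat.card D) D S inferInstance le_rfl
  refine le_trans ?_ (hS'.card_real_le hT)
  rw [← Nat.card_coe_set_eq]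
  refine Nat.card_le_card_of_surjective (fun d : {d | S'.real d} => S'.lab d) (fun a => ?_)
  obtain ⟨d, hd, rfl⟩ := S'.exists_real a
  exact ⟨⟨d, hd⟩, rfl⟩

end StrandMap

open Set unitInterval

/-- A drawing of a graph in the complex plane with at most three crossings on each edge, the
arcs being parametrized by real numbers. -/
structure Curves {V : Type} (G : SimpleGraph V) where
  pos : V → ℂ
  pos_inj : Function.Injective pos
  c : G.Dart → ℝ → ℂ
  cont : ∀ a, Continuous (c a)
  symm : ∀ a t, c a.symm t = c a (1 - t)
  zero : ∀ a, c a 0 = pos a.fst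
  inj : ∀ a, InjOn (c a) (Icc 0 1)
  vertex : ∀ a w, ∀ t ∈ Icc (0 : ℝ) 1, c a t = pos w → t = 0 ∨ t = 1
  K : G.Dart → Finset ℝ
  mem_K : ∀ a t, t ∈ K a ↔ t ∈ Ioo (0 : ℝ) 1 ∧
    ∃ b : G.Dart, b.edge ≠ a.edge ∧ ∃ s ∈ Ioo (0 : ℝ) 1, c b s = c a t
  card_K : ∀ a, (K a).card ≤ 3
  triple : ∀ a b e : G.Dart, a.edge ≠ b.edge → a.edge ≠ e.edge → b.edge ≠ e.edge →
    ∀ s ∈ Ioo (0 : ℝ) 1, ∀ t ∈ Ioo (0 : ℝ) 1, ∀ r ∈ Ioo (0 : ℝ) 1,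
    c a s = c b t → c b t = c e r → False

namespace PlaneDrawing

variable {V : Type} {G : SimpleGraph V} (P : PlaneDrawing G)

theorem arc_mem_Ioo {u v : V} (h : G.Adj u v) {p : ℝ × ℝ} :
    P.IsInteriorPoint h p ↔ ∃ t ∈ Ioo (0 : ℝ) 1, (P.arc h).extend t = p := by
  constructor
  · rintro ⟨t, h0, h1, rfl⟩
    refine ⟨t, ⟨lt_of_le_of_ne t.2.1 fun h => h0 (Subtype.ext h.symm),
      lt_of_le_of_ne t.2.2 fun h => h1 (Subtype.ext h)⟩, ?_⟩
    simp
  · rintro ⟨t, ht, rfl⟩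
    have ht' : t ∈ I := ⟨ht.1.le, ht.2.le⟩
    refine ⟨⟨t, ht'⟩, fun h => ?_, fun h => ?_, ?_⟩
    · exact ht.1.ne' (congrArg Subtype.val h)
    · exact ht.2.ne (congrArg Subtype.val h)
    · rw [Path.extend_apply _ ht']

theorem finite_edgeCrossings [Finite V] {u v : V} (h : G.Adj u v) :
    (P.edgeCrossings h).Finite := by
  have : Finite G.Dart := Finite.of_injective _ SimpleGraph.Dart.toProd_injective
  have hfin : (⋃ b : {b : G.Dart // s(u, v) ≠ b.edge},
      Set.range (P.arc h) ∩ Set.range (P.arc b.1.adj)).Finite :=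
    Set.finite_iUnion fun b => P.finite_inter h b.1.adj b.2
  refine hfin.subset ?_
  rintro p ⟨⟨t, -, -, rfl⟩, x, y, h₂, hne, ⟨s, -, -, hs⟩⟩
  exact Set.mem_iUnion.2 ⟨⟨⟨(x, y), h₂⟩, hne⟩, ⟨t, rfl⟩, ⟨s, hs⟩⟩

theorem extend_injOn {u v : V} (h : G.Adj u v) : InjOn (P.arc h).extend (Icc 0 1) := by
  intro s hs t ht hst
  rw [Path.extend_apply _ hs, Path.extend_apply _ ht] at hst
  exact congrArg Subtype.val (P.arc_inj h hst)

/-- The parameters of the crossings on an edge. -/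
def crossTimes (a : G.Dart) : Set ℝ :=
  {t | t ∈ Ioo (0 : ℝ) 1 ∧ ∃ b : G.Dart, b.edge ≠ a.edge ∧
    ∃ s ∈ Ioo (0 : ℝ) 1, (P.arc b.adj).extend s = (P.arc a.adj).extend t}

theorem image_crossTimes (a : G.Dart) :
    (P.arc a.adj).extend '' P.crossTimes a = P.edgeCrossings a.adj := by
  ext p
  constructor
  · rintro ⟨t, ⟨ht, b, hb, s, hs, h⟩, rfl⟩
    exact ⟨(P.arc_mem_Ioo _).2 ⟨t, ht, rfl⟩, b.fst, b.snd, b.adj, hb.symm,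
      (P.arc_mem_Ioo _).2 ⟨s, hs, h⟩⟩
  · rintro ⟨h, x, y, h₂, hne, h'⟩
    obtain ⟨t, ht, rfl⟩ := (P.arc_mem_Ioo _).1 h
    obtain ⟨s, hs, hst⟩ := (P.arc_mem_Ioo _).1 h'
    exact ⟨t, ⟨ht, ⟨(x, y), h₂⟩, hne.symm, s, hs, hst⟩, rfl⟩

theorem injOn_crossTimes (a : G.Dart) : InjOn (P.arc a.adj).extend (P.crossTimes a) :=
  (P.extend_injOn a.adj).mono fun _ h => Ioo_subset_Icc_self h.1

theorem finite_crossTimes [Finite V] (a : G.Dart) : (P.crossTimes a).Finite :=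
  Set.Finite.of_finite_image (by rw [image_crossTimes]; exact P.finite_edgeCrossings _)
    (P.injOn_crossTimes a)

/-- The curves of a `3`-plane drawing. -/
noncomputable def curves [Finite V] (h3 : P.IsKPlane 3) : Curves G where
  pos v := Complex.equivRealProdCLM.symm (P.pos v)
  pos_inj _ _ h := P.pos_inj (Complex.equivRealProdCLM.symm.injective h)
  c a t := Complex.equivRealProdCLM.symm ((P.arc a.adj).extend t)
  cont a := Complex.equivRealProdCLM.symm.continuous.comp (P.arc a.adj).continuous_extend
  symm a t := by
    congr 1
    exact (congrArg (fun p : Path (P.pos a.snd) (P.pos a.fst) => p.extend t)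
      (P.arc_symm a.adj)).trans (Path.extend_symm_apply _ _)
  zero a := by simp
  inj a s hs t ht h := P.extend_injOn a.adj hs ht (Complex.equivRealProdCLM.symm.injective h)
  vertex a w t ht h := by
    have h := Complex.equivRealProdCLM.symm.injective h
    have h' := h
    rw [Path.extend_apply _ ht] at h
    rcases P.no_vertex_mem a.adj w _ h with rfl | rfl
    · left
      exact P.extend_injOn a.adj ht (by norm_num) (h'.trans (by simp))
    · right
      exact P.extend_injOn a.adj ht (by norm_num) (h'.trans (by simp))
  K a := (P.finite_crossTimes a).toFinset
  mem_K a t := by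
    simp [crossTimes]
  card_K a := by
    rw [← Set.ncard_eq_toFinset_card _ (P.finite_crossTimes a),
      ← (P.injOn_crossTimes a).ncard_image, image_crossTimes]
    exact h3 a.adj
  triple a b e hab hae hbe s hs t ht r hr h h' := by
    have h := Complex.equivRealProdCLM.symm.injective h
    have h' := Complex.equivRealProdCLM.symm.injective h'
    obtain ⟨s', s0, s1, es⟩ := (P.arc_mem_Ioo a.adj).2 ⟨s, hs, rfl⟩
    obtain ⟨t', t0, t1, et⟩ := (P.arc_mem_Ioo b.adj).2 ⟨t, ht, rfl⟩
    obtain ⟨r', r0, r1, er⟩ := (P.arc_mem_Ioo e.adj).2 ⟨r, hr, rfl⟩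
    exact P.no_triple_point a.adj b.adj e.adj hab hae hbe s' t' r' s0 s1 t0 t1 r0 r1
      (by rw [es, et, h]) (by rw [et, er, h'])

end PlaneDrawing

open Set unitInterval

namespace Curves

variable {V : Type} {G : SimpleGraph V} (C : Curves G)

theorem one (a : G.Dart) : C.c a 1 = C.pos a.snd := by
  have := C.zero a.symm
  rw [C.symm] at this
  simpa using this

theorem mem_K_symm (a : G.Dart) (t : ℝ) : t ∈ C.K a.symm ↔ 1 - t ∈ C.K a := by
  rw [C.mem_K, C.mem_K, SimpleGraph.Dart.edge_symm, C.symm]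
  refine and_congr_left' ?_
  simp only [mem_Ioo]
  constructor <;> rintro ⟨h, h'⟩ <;> constructor <;> linarith

open Classical in
/-- The parameters of the crossings and of the ends of an edge. -/
noncomputable def stops (a : G.Dart) : Finset ℝ := insert 0 (insert 1 (C.K a))

theorem mem_stops {a : G.Dart} {t : ℝ} : t ∈ C.stops a ↔ t = 0 ∨ t = 1 ∨ t ∈ C.K a := by
  simp [stops]

theorem mem_stops_symm {a : G.Dart} {t : ℝ} : t ∈ C.stops a.symm ↔ 1 - t ∈ C.stops a := by
  simp only [mem_stops, mem_K_symm]
  have h0 : t = 0 ↔ 1 - t = 1 := by constructor <;> intro h <;> linarith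
  have h1 : t = 1 ↔ 1 - t = 0 := by constructor <;> intro h <;> linarith
  rw [← h0, ← h1]
  tauto

theorem stops_subset {a : G.Dart} {t : ℝ} (h : t ∈ C.stops a) : t ∈ Icc (0 : ℝ) 1 := by
  rcases C.mem_stops.1 h with rfl | rfl | h
  · simp
  · simp
  · exact Ioo_subset_Icc_self ((C.mem_K a t).1 h).1

/-- The pieces into which the crossings divide the edges, given by the oriented edge and the
parameter of the initial point. -/
@[ext] structure Piece where
  lab : G.Dart
  start : ℝ
  start_mem : start ∈ C.stops lab
  start_ne : start ≠ 1

instance [Finite V] : Finite C.Piece := by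
  have : Finite G.Dart := Finite.of_injective _ SimpleGraph.Dart.toProd_injective
  have h : (⋃ a : G.Dart, (fun t => (a, t)) '' (C.stops a : Set ℝ)).Finite :=
    Set.finite_iUnion fun a => (C.stops a).finite_toSet.image _
  have := h.to_subtype
  refine Finite.of_injective (β := (⋃ a : G.Dart, (fun t => (a, t)) '' (C.stops a : Set ℝ) : Set _))
    (fun d => ⟨(d.lab, d.start), Set.mem_iUnion.2 ⟨d.lab, d.start, d.start_mem, rfl⟩⟩) ?_
  intro d d' h
  have h := congrArg Subtype.val h
  exact Piece.ext (congrArg Prod.fst h) (congrArg Prod.snd h)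

namespace Piece

variable {C}

theorem start_nonneg (d : C.Piece) : 0 ≤ d.start := (C.stops_subset d.start_mem).1

theorem start_lt_one (d : C.Piece) : d.start < 1 :=
  lt_of_le_of_ne (C.stops_subset d.start_mem).2 d.start_ne

theorem start_mem_Icc (d : C.Piece) : d.start ∈ Icc (0 : ℝ) 1 := C.stops_subset d.start_mem

theorem exists_finish (d : C.Piece) : ∃ t ∈ C.stops d.lab, d.start < t ∧
    ∀ u ∈ C.stops d.lab, d.start < u → t ≤ u := by
  classical
  have hne : ((C.stops d.lab).filter (d.start < ·)).Nonempty :=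
    ⟨1, by simp [mem_stops, d.start_lt_one]⟩
  obtain ⟨t, ht, hmin⟩ := Finset.exists_min_image _ id hne
  rw [Finset.mem_filter] at ht
  exact ⟨t, ht.1, ht.2, fun u hu hlt => hmin u (Finset.mem_filter.2 ⟨hu, hlt⟩)⟩

/-- The parameter of the final point of a piece. -/
noncomputable def finish (d : C.Piece) : ℝ := d.exists_finish.choose

theorem finish_mem (d : C.Piece) : d.finish ∈ C.stops d.lab := d.exists_finish.choose_spec.1

theorem start_lt_finish (d : C.Piece) : d.start < d.finish := d.exists_finish.choose_spec.2.1

theorem finish_le (d : C.Piece) {u : ℝ} (h : u ∈ C.stops d.lab) (h' : d.start < u) : d.finish ≤ u :=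
  d.exists_finish.choose_spec.2.2 u h h'

theorem finish_le_one (d : C.Piece) : d.finish ≤ 1 := (C.stops_subset d.finish_mem).2

/-- The reversed piece. -/
noncomputable def rev (d : C.Piece) : C.Piece :=
  ⟨d.lab.symm, 1 - d.finish, C.mem_stops_symm.2 (by simpa using d.finish_mem), by
    have h1 := d.start_lt_finish
    have h2 := d.start_nonneg
    linarith⟩

@[simp] theorem lab_rev (d : C.Piece) : d.rev.lab = d.lab.symm := rfl

@[simp] theorem start_rev (d : C.Piece) : d.rev.start = 1 - d.finish := rfl

@[simp] theorem finish_rev (d : C.Piece) : d.rev.finish = 1 - d.start := by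
  apply le_antisymm
  · refine d.rev.finish_le (C.mem_stops_symm.2 (by simpa using d.start_mem)) ?_
    have := d.start_lt_finish
    rw [start_rev]
    linarith
  · by_contra! h
    have h1 := d.rev.finish_mem
    have h2 := d.rev.start_lt_finish
    rw [start_rev] at h2
    have := d.finish_le (C.mem_stops_symm.1 h1) (by linarith)
    linarith

@[simp] theorem rev_rev (d : C.Piece) : d.rev.rev = d :=
  Piece.ext (by simp) (by simp)

open Classical in
/-- The piece that starts where `d` starts and continues `d` backwards. -/
noncomputable def opp (d : C.Piece) : C.Piece :=
  if h : d.start = 0 then d else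
    ⟨d.lab.symm, 1 - d.start, C.mem_stops_symm.2 (by simpa using d.start_mem), by
      simpa using h⟩

theorem lab_opp {d : C.Piece} (h : d.start ≠ 0) : d.opp.lab = d.lab.symm := by
  rw [opp, dif_neg h]

theorem start_opp {d : C.Piece} (h : d.start ≠ 0) : d.opp.start = 1 - d.start := by
  rw [opp, dif_neg h]

theorem start_opp_ne {d : C.Piece} (h : d.start ≠ 0) : d.opp.start ≠ 0 := by
  rw [start_opp h]
  have := d.start_lt_one
  linarith

theorem opp_opp {d : C.Piece} (h : d.start ≠ 0) : d.opp.opp = d := by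
  have h' := start_opp_ne h
  exact Piece.ext (by rw [lab_opp h', lab_opp h]; simp) (by rw [start_opp h', start_opp h]; ring)

theorem opp_ne {d : C.Piece} (h : d.start ≠ 0) : d.opp ≠ d := fun he => by
  have := congrArg lab he
  rw [lab_opp h] at this
  exact d.lab.symm_ne this

theorem start_mem_K {d : C.Piece} (h : d.start ≠ 0) : d.start ∈ C.K d.lab := by
  rcases C.mem_stops.1 d.start_mem with h' | h' | h'
  · exact absurd h' h
  · exact absurd h' d.start_lt_one.ne
  · exact h'

/-- The initial point of a piece. -/
noncomputable def base (d : C.Piece) : ℂ := C.c d.lab d.start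

theorem base_opp (d : C.Piece) : d.opp.base = d.base := by
  by_cases h : d.start = 0
  · rw [opp, dif_pos h]
  · rw [base, start_opp h, lab_opp h, C.symm, base]
    simp

theorem base_of_start_eq {d : C.Piece} (h : d.start = 0) : d.base = C.pos d.lab.fst := by
  rw [base, h, C.zero]

theorem start_of_base_eq {d d' : C.Piece} (h : d.start = 0) (hb : d'.base = d.base) :
    d'.start = 0 :=
  (C.vertex d'.lab d.lab.fst d'.start d'.start_mem_Icc
    (by rw [← base_of_start_eq h, ← hb, base])).resolve_right d'.start_lt_one.ne

theorem edge_ne {d d' : C.Piece} (h : d.start ≠ 0) (hb : d'.base = d.base) (h1 : d' ≠ d)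
    (h2 : d' ≠ d.opp) : d'.lab.edge ≠ d.lab.edge := by
  intro he
  rcases SimpleGraph.dart_edge_eq_iff _ _ |>.1 he with he | he
  · refine h1 (Piece.ext he (C.inj d.lab d'.start_mem_Icc d.start_mem_Icc ?_))
    rw [← he, ← base, hb, base, he]
  · refine h2 (Piece.ext (by rw [he, lab_opp h]) ?_)
    have h3 : C.c d.lab (1 - d'.start) = C.c d.lab d.start := by
      rw [← C.symm, ← he, ← base, hb, base]
    have h4 := d'.start_mem_Icc
    have := C.inj d.lab ⟨by linarith [h4.2], by linarith [h4.1]⟩ d.start_mem_Icc h3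
    rw [start_opp h]
    linarith

theorem exists_cross {d : C.Piece} (h : d.start ≠ 0) : ∃ e : C.Piece, e.start ≠ 0 ∧
    e.base = d.base ∧ e.lab.edge ≠ d.lab.edge := by
  obtain ⟨hs, b, hb, s, hs', hsd⟩ := (C.mem_K _ _).1 (start_mem_K h)
  have hK : s ∈ C.K b := (C.mem_K b s).2 ⟨hs', d.lab, hb.symm, d.start, hs, hsd.symm⟩
  exact ⟨⟨b, s, C.mem_stops.2 (Or.inr (Or.inr hK)), hs'.2.ne⟩, hs'.1.ne', hsd, hb⟩

theorem start_mem_Ioo {d : C.Piece} (h : d.start ≠ 0) : d.start ∈ Ioo (0 : ℝ) 1 :=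
  ⟨lt_of_le_of_ne d.start_nonneg h.symm, d.start_lt_one⟩

theorem base_class {d e f : C.Piece} (h : d.start ≠ 0) (he : e.start ≠ 0) (hed : e.base = d.base)
    (hne : e.lab.edge ≠ d.lab.edge) (hf : f.base = d.base) :
    f = d ∨ f = d.opp ∨ f = e ∨ f = e.opp := by
  by_contra! hc
  obtain ⟨h1, h2, h3, h4⟩ := hc
  have hf0 : f.start ≠ 0 := fun h0 => h (start_of_base_eq h0 hf.symm)
  exact C.triple f.lab d.lab e.lab (edge_ne h hf h1 h2) (edge_ne he (hf.trans hed.symm) h3 h4)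
    hne.symm f.start (start_mem_Ioo hf0) d.start (start_mem_Ioo h) e.start (start_mem_Ioo he)
    hf hed.symm

theorem eq_of_mem {d d' : C.Piece} (h : d'.lab = d.lab) {u : ℝ} (hu : u ∈ Ioo d.start d.finish)
    (hu' : u ∈ Icc d'.start d'.finish) : d' = d := by
  refine Piece.ext h (le_antisymm ?_ ?_)
  · by_contra! hlt
    have := d.finish_le (by rw [← h]; exact d'.start_mem) hlt
    linarith [hu.2, hu'.1]
  · by_contra! hlt
    have := d'.finish_le (by rw [h]; exact d.start_mem) hlt
    linarith [hu.1, hu'.2]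

end Piece

/-- The pieces of a drawing meet only at their endpoints. -/
noncomputable def arcSystem : ArcSystem C.Piece where
  α := Piece.rev
  α_α := Piece.rev_rev
  γ d t := C.c d.lab (d.start + t * (d.finish - d.start))
  cont d := (C.cont d.lab).comp (by fun_prop)
  symm d t := by
    simp only [Piece.lab_rev, Piece.start_rev, Piece.finish_rev, C.symm]
    congr 1
    ring
  inj d s hs t ht h := by
    have h1 := d.start_lt_finish
    have h2 := d.start_nonneg
    have h3 := d.finish_le_one
    have key : ∀ r ∈ Icc (0 : ℝ) 1, d.start + r * (d.finish - d.start) ∈ Icc (0 : ℝ) 1 := by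
      rintro r ⟨hr0, hr1⟩
      constructor <;> nlinarith
    have := C.inj d.lab (key s hs) (key t ht) h
    have : (s - t) * (d.finish - d.start) = 0 := by linarith
    rcases mul_eq_zero.1 this with h | h <;> linarith
  disj d d' hne hne' s hs t ht h := by
    by_contra! hc
    have hs0 : 0 < s := lt_of_le_of_ne hs.1 hc.1.symm
    have hs1 : s < 1 := lt_of_le_of_ne hs.2 hc.2
    have h1 := d.start_lt_finish
    have h2 := d.start_nonneg
    have h3 := d.finish_le_one
    have h1' := d'.start_lt_finish
    have h2' := d'.start_nonneg
    have h3' := d'.finish_le_one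
    have hu : d.start + s * (d.finish - d.start) ∈ Ioo d.start d.finish := by
      constructor <;> nlinarith
    have hu' : d'.start + t * (d'.finish - d'.start) ∈ Icc d'.start d'.finish := by
      obtain ⟨ht0, ht1⟩ := ht
      constructor <;> nlinarith
    set u := d.start + s * (d.finish - d.start)
    set u' := d'.start + t * (d'.finish - d'.start)
    have huI : u ∈ Ioo (0 : ℝ) 1 := ⟨by linarith [hu.1], by linarith [hu.2]⟩
    by_cases he : d'.lab.edge = d.lab.edge
    · rcases SimpleGraph.dart_edge_eq_iff _ _ |>.1 he with he | he
      · have : u = u' := C.inj d.lab (Ioo_subset_Icc_self huI)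
          ⟨by linarith [hu'.1], by linarith [hu'.2]⟩ (by rw [h, he])
        exact hne (Piece.eq_of_mem he hu (this ▸ hu'))
      · have : u = 1 - u' := C.inj d.lab (Ioo_subset_Icc_self huI)
          ⟨by linarith [hu'.2], by linarith [hu'.1]⟩ (by rw [h, he, C.symm])
        have : d'.rev = d := Piece.eq_of_mem (by simp [he]) hu
          ⟨by simp; linarith [hu'.2], by simp; linarith [hu'.1]⟩
        exact hne' (by rw [← this, Piece.rev_rev])
    · have hv : ∀ w, C.c d'.lab u' ≠ C.pos w := fun w hw => by
        rcases C.vertex d.lab w u (Ioo_subset_Icc_self huI) (h.trans hw) with h0 | h0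
        · exact huI.1.ne' h0
        · exact huI.2.ne h0
      have hu0 : u' ≠ 0 := fun h0 => hv _ (by rw [h0, C.zero])
      have hu1 : u' ≠ 1 := fun h0 => hv _ (by rw [h0, C.one])
      have huK : u ∈ C.K d.lab := (C.mem_K _ _).2 ⟨huI, d'.lab, he, u',
        ⟨lt_of_le_of_ne (by linarith [hu'.1]) hu0.symm, lt_of_le_of_ne (by linarith [hu'.2]) hu1⟩,
        h.symm⟩
      have := d.finish_le (C.mem_stops.2 (Or.inr (Or.inr huK))) hu.1
      linarith [hu.2]

end Curves

open Set unitInterval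

namespace NiceArcs

variable {D : Type*} [Fintype D] (N : NiceArcs D)

/-- The rotation at the initial point of an arc. -/
noncomputable def rotation : Equiv.Perm D := Equiv.ofBijective N.next N.next_bijective

theorem rotation_apply (d : D) : N.rotation d = N.next d := rfl

theorem isCycleOn_rotation (d : D) : N.rotation.IsCycleOn {e | N.base e = N.base d} := by
  refine ⟨⟨fun e he => ?_, N.rotation.injective.injOn, fun e he => ?_⟩, fun e he f hf => ?_⟩
  · exact (N.base_next e).trans he
  · refine ⟨N.rotation.symm e, ?_, N.rotation.apply_symm_apply e⟩
    have := N.base_next (N.rotation.symm e)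
    rw [← rotation_apply, Equiv.apply_symm_apply] at this
    exact this.symm.trans he
  · obtain ⟨k, hk⟩ := N.exists_iterate_next (Eq.trans hf (Eq.symm he))
    refine ⟨k, ?_⟩
    rw [zpow_natCast, ← Equiv.Perm.iterate_eq_pow]
    exact hk

end NiceArcs

namespace Curves

variable {V : Type} {G : SimpleGraph V} (C : Curves G)

namespace Piece

variable {C}

open Classical in
theorem exists_base_class {d : C.Piece} (h : d.start ≠ 0) : ∃ T : Finset C.Piece, T.card = 4 ∧
    ∀ f, f ∈ T ↔ f.base = d.base := by
  obtain ⟨e, he, hb, hne⟩ := exists_cross h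
  have hdo : d.opp.lab.edge = d.lab.edge := by simp [lab_opp h]
  have heo : e.opp.lab.edge = e.lab.edge := by simp [lab_opp he]
  refine ⟨{d, d.opp, e, e.opp}, ?_, fun f => ?_⟩
  · have h1 : d ∉ ({d.opp, e, e.opp} : Finset C.Piece) := by
      simp only [Finset.mem_insert, Finset.mem_singleton, not_or]
      refine ⟨(opp_ne h).symm, ?_, ?_⟩
      · rintro rfl; exact hne rfl
      · intro h'; exact hne (by rw [← heo, ← h'])
    have h2 : d.opp ∉ ({e, e.opp} : Finset C.Piece) := by
      simp only [Finset.mem_insert, Finset.mem_singleton, not_or]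
      refine ⟨?_, ?_⟩
      · intro h'; exact hne (by rw [← hdo, h'])
      · intro h'; exact hne (by rw [← heo, ← h', hdo])
    have h3 : e ∉ ({e.opp} : Finset C.Piece) := by
      simpa using (opp_ne he).symm
    rw [Finset.card_insert_of_notMem h1, Finset.card_insert_of_notMem h2,
      Finset.card_insert_of_notMem h3, Finset.card_singleton]
  · simp only [Finset.mem_insert, Finset.mem_singleton]
    refine ⟨?_, base_class h he hb hne⟩
    rintro (rfl | rfl | rfl | rfl)
    · rfl
    · exact base_opp _
    · exact hb
    · rw [base_opp, hb]

/-- The number of stops before the initial point of a piece. -/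
noncomputable def rank (d : C.Piece) : ℕ := ((C.stops d.lab).filter (· < d.start)).card

theorem rank_pos {d : C.Piece} (h : d.start ≠ 0) : 0 < d.rank :=
  Finset.card_pos.2 ⟨0, Finset.mem_filter.2 ⟨C.mem_stops.2 (Or.inl rfl), (start_mem_Ioo h).1⟩⟩

theorem rank_le {d : C.Piece} (h : d.start ≠ 0) : d.rank ≤ 3 := by
  classical
  have hsub : (C.stops d.lab).filter (· < d.start) ⊆ insert 0 ((C.K d.lab).erase d.start) := by
    intro t ht
    obtain ⟨ht, hlt⟩ := Finset.mem_filter.1 ht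
    rcases C.mem_stops.1 ht with rfl | rfl | ht
    · simp
    · exact absurd hlt d.start_lt_one.not_gt
    · exact Finset.mem_insert_of_mem (Finset.mem_erase.2 ⟨hlt.ne, ht⟩)
  have h1 := Finset.card_erase_lt_of_mem (start_mem_K h)
  have h2 := C.card_K d.lab
  have h3 := (Finset.card_le_card hsub).trans (Finset.card_insert_le _ _)
  unfold rank
  omega

theorem rank_lt {d : C.Piece} (h : d.rev.start ≠ 0) : d.rank < d.rev.opp.rank := by
  refine Finset.card_lt_card ?_
  rw [lab_opp h, start_opp h]
  simp only [lab_rev, start_rev, SimpleGraph.Dart.symm_symm, sub_sub_cancel]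
  refine Finset.ssubset_iff_subset_ne.2 ⟨?_, fun he => ?_⟩
  · exact Finset.monotone_filter_right _ fun t _ ht => lt_trans ht d.start_lt_finish
  · have : d.start ∈ (C.stops d.lab).filter (· < d.finish) :=
      Finset.mem_filter.2 ⟨d.start_mem, d.start_lt_finish⟩
    rw [← he, Finset.mem_filter] at this
    exact lt_irrefl _ this.2

end Piece

theorem ncard_range_base_le [Finite V] :
    4 * (range (Piece.base : C.Piece → ℂ)).ncard ≤
      4 * G.support.ncard + {d : C.Piece | ¬ d.start = 0}.ncard := by
  classical
  have := Fintype.ofFinite C.Piece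
  have h1 : range (Piece.base : C.Piece → ℂ) ⊆
      (C.pos '' G.support) ∪ Piece.base '' {d : C.Piece | ¬ d.start = 0} := by
    rintro _ ⟨d, rfl⟩
    by_cases h : d.start = 0
    · exact Or.inl ⟨d.lab.fst, ⟨d.lab.snd, d.lab.adj⟩, (Piece.base_of_start_eq h).symm⟩
    · exact Or.inr ⟨d, h, rfl⟩
  have h2 : (range (Piece.base : C.Piece → ℂ)).ncard ≤ G.support.ncard +
      (Piece.base '' {d : C.Piece | ¬ d.start = 0}).ncard :=
    (Set.ncard_le_ncard h1 (Set.toFinite _)).trans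
      ((Set.ncard_union_le _ _).trans (Nat.add_le_add_right (Set.ncard_image_le (Set.toFinite _)) _))
  have h3 : 4 * (Piece.base '' {d : C.Piece | ¬ d.start = 0}).ncard ≤
      {d : C.Piece | ¬ d.start = 0}.ncard := by
    have := Finset.mul_card_image_le_card (f := (Piece.base : C.Piece → ℂ))
      (Finset.univ.filter fun d : C.Piece => ¬ d.start = 0) 4 fun p hp => by
        obtain ⟨d, hd, rfl⟩ := Finset.mem_image.1 hp
        have hd := (Finset.mem_filter.1 hd).2
        obtain ⟨T, hT, hmem⟩ := Piece.exists_base_class hd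
        rw [← hT]
        refine Finset.card_le_card fun f hf => ?_
        have hf := (hmem f).1 hf
        simp only [Finset.mem_filter, Finset.mem_univ, true_and]
        exact ⟨fun h0 => hd (Piece.start_of_base_eq h0 hf.symm), hf⟩
    rw [← Set.ncard_coe_finset, ← Set.ncard_coe_finset, Finset.coe_image] at this
    simpa using this
  omega

theorem exists_strandMap [Finite V] (hdeg : ∀ a : G.Dart, ∃ b : G.Dart, b.fst = a.fst ∧ b ≠ a) :
    ∃ Φ : Type, Nonempty (StrandMap G G.support.ncard C.Piece Φ) := by
  classical
  have := Fintype.ofFinite C.Piece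
  obtain ⟨N, hα, hγ⟩ := C.arcSystem.exists_niceArcs
  have hα : ∀ d, N.α d = d.rev := fun d => by rw [hα]; rfl
  have hbase : ∀ d, N.base d = d.base := fun d => by
    rw [hγ]
    simp [arcSystem, Piece.base]
  have hρ : ∀ d, (N.rotation d).base = d.base := fun d => by
    rw [← hbase, ← hbase]; exact N.base_next d
  have hcyc : ∀ d : C.Piece, ∀ T : Finset C.Piece, (∀ f, f ∈ T ↔ f.base = d.base) →
      N.rotation.IsCycleOn T := fun d T hT => by
    have := N.isCycleOn_rotation d
    convert this using 1
    ext f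
    simp [hT, hbase]
  have hfour : ∀ d f : C.Piece, d.start ≠ 0 → f.base = d.base → f = d ∨ f = N.rotation d ∨
      f = N.rotation (N.rotation d) ∨ f = N.rotation (N.rotation (N.rotation d)) := by
    intro d f h hf
    obtain ⟨T, hT, hmem⟩ := Piece.exists_base_class h
    obtain ⟨k, hk, rfl⟩ := (hcyc d T hmem).exists_pow_eq ((hmem d).2 rfl) ((hmem f).2 hf)
    rw [hT] at hk
    interval_cases k
    · simp
    · simp
    · exact Or.inr (Or.inr (Or.inl rfl))
    · exact Or.inr (Or.inr (Or.inr rfl))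
  have hper : ∀ d : C.Piece, d.start ≠ 0 → ∀ n : ℕ, (N.rotation ^ n) d = d ↔ 4 ∣ n := by
    intro d h n
    obtain ⟨T, hT, hmem⟩ := Piece.exists_base_class h
    rw [← hT]
    exact (hcyc d T hmem).pow_apply_eq ((hmem d).2 rfl)
  obtain ⟨F, hF, hFα⟩ : ∃ F : C.Piece → N.Face, Function.Surjective F ∧
      ∀ d, F (N.α (N.next d)) = F d :=
    ⟨fun d => Quot.mk _ d, Quot.mk_surjective, fun d => (Quot.sound (r := fun d e => e = N.α (N.next d)) rfl).symm⟩
  refine ⟨N.Face, ⟨{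
    α := Piece.rev
    ρ := N.rotation
    opp := Piece.opp
    real := fun d => d.start = 0
    lab := Piece.lab
    rank := Piece.rank
    face := F
    α_α := Piece.rev_rev
    lab_α := Piece.lab_rev
    real_ρ := fun d => ⟨fun h => Piece.start_of_base_eq h (hρ d).symm,
      fun h => Piece.start_of_base_eq h (hρ d)⟩
    fst_ρ := fun d h => C.pos_inj (by
      rw [← Piece.base_of_start_eq h, ← Piece.base_of_start_eq (Piece.start_of_base_eq h (hρ d)),
        hρ])
    lab_inj := fun d d' h h' he => Piece.ext he (h.trans h'.symm)
    exists_real := fun a => ⟨⟨a, 0, C.mem_stops.2 (Or.inl rfl), zero_ne_one⟩, rfl, rfl⟩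
    opp_opp := fun d h => Piece.opp_opp h
    opp_ne := fun d h => Piece.opp_ne h
    lab_opp := fun d h => Piece.lab_opp h
    ρ_four := fun d h => (hper d h 4).2 dvd_rfl
    ρ_ne := fun d => ?_
    ρ_two_ne := fun d h h' => by
      have := (hper d h 2).1 h'
      omega
    opp_near := fun d h => hfour d _ h (Piece.base_opp d)
    edge_ne := fun d d' h hd h1 h2 => Piece.edge_ne h (by
      rcases hd with rfl | rfl | rfl | rfl <;> simp [hρ]) h1 h2
    rank_pos := fun d h => Piece.rank_pos h
    rank_le := fun d h => Piece.rank_le h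
    rank_lt := fun d h => Piece.rank_lt h
    face_α := fun d => by rw [← hα]; exact hFα d
    euler := ?_ }⟩⟩
  · refine (N.isCycleOn_rotation d).apply_ne ?_ rfl
    by_cases h : d.start = 0
    · obtain ⟨b, hb, hne⟩ := hdeg d.lab
      refine ⟨d, rfl, ⟨b, 0, C.mem_stops.2 (Or.inl rfl), zero_ne_one⟩, ?_, ?_⟩
      · rw [mem_ofPred_eq, hbase, hbase, Piece.base_of_start_eq h, Piece.base_of_start_eq rfl, hb]
      · intro he
        exact hne (congrArg Piece.lab he).symm
    · refine ⟨d, rfl, d.opp, ?_, (Piece.opp_ne h).symm⟩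
      rw [mem_ofPred_eq, hbase, hbase, Piece.base_opp]
  · have h1 := N.card_le
    have h2 := C.ncard_range_base_le
    have h3 : N.base = Piece.base := funext hbase
    have h4 : (range F).ncard = Nat.card N.Face := by
      rw [hF.range_eq, Set.ncard_univ]
    rw [h3] at h1
    rw [h4, Nat.card_eq_fintype_card]
    omega

end Curves

namespace PlaneDrawing

variable {V : Type} {G G' : SimpleGraph V}

/-- The restriction of a drawing to a subgraph. -/
def restrict (P : PlaneDrawing G) (h : G' ≤ G) : PlaneDrawing G' where
  pos := P.pos
  pos_inj := P.pos_inj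
  arc _ _ e := P.arc (h e)
  arc_symm _ _ e := P.arc_symm (h e)
  arc_inj _ _ e := P.arc_inj (h e)
  no_vertex_mem _ _ e := P.no_vertex_mem (h e)
  finite_inter _ _ _ _ e₁ e₂ := P.finite_inter (h e₁) (h e₂)
  no_triple_point _ _ _ _ _ _ e₁ e₂ e₃ := P.no_triple_point (h e₁) (h e₂) (h e₃)

theorem IsKPlane.restrict [Finite V] {P : PlaneDrawing G} {k : ℕ} (hP : P.IsKPlane k)
    (h : G' ≤ G) : (P.restrict h).IsKPlane k := by
  intro u v e
  refine (Set.ncard_le_ncard ?_ (P.finite_edgeCrossings (h e))).trans (hP (h e))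
  rintro p ⟨hp, x, y, e₂, hne, hp'⟩
  exact ⟨hp, x, y, h e₂, hne, hp'⟩

theorem two_mul_ncard_edgeSet [Finite V] (G : SimpleGraph V) :
    2 * G.edgeSet.ncard = Nat.card G.Dart := by
  classical
  have := Fintype.ofFinite V
  rw [Nat.card_eq_fintype_card, SimpleGraph.dart_card_eq_twice_card_edges,
    ← SimpleGraph.coe_edgeFinset, Set.ncard_coe_finset]

/-- A triangle-free graph with a `3`-plane drawing has at most five times as many edges as
non-isolated vertices. -/
theorem ncard_edgeSet_le [Finite V] (P : PlaneDrawing G) (hP : P.IsKPlane 3)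
    (hT : ∀ u v w, G.Adj u v → G.Adj v w → G.Adj w u → False) :
    G.edgeSet.ncard ≤ 5 * G.support.ncard := by
  induction hm : G.edgeSet.ncard using Nat.strong_induction_on generalizing G with
  | _ m ih =>
  by_cases hdeg : ∀ a : G.Dart, ∃ b : G.Dart, b.fst = a.fst ∧ b ≠ a
  · obtain ⟨Φ, ⟨S⟩⟩ := (P.curves hP).exists_strandMap hdeg
    have h1 := S.card_dart_le hT
    have h2 := two_mul_ncard_edgeSet G
    omega
  push Not at hdeg
  obtain ⟨a, ha⟩ := hdeg
  have hle : G.deleteEdges {a.edge} ≤ G := G.deleteEdges_le _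
  have hlt : (G.deleteEdges {a.edge}).edgeSet.ncard + 1 = G.edgeSet.ncard := by
    rw [SimpleGraph.edgeSet_deleteEdges]
    exact Set.ncard_sdiff_singleton_add_one a.edge_mem
  have hsupp : (G.deleteEdges {a.edge}).support ⊆ G.support \ {a.fst} := by
    rintro v ⟨w, hw⟩
    refine ⟨⟨w, hle hw⟩, ?_⟩
    rintro rfl
    have := ha ⟨(a.fst, w), hle hw⟩ rfl
    exact (SimpleGraph.deleteEdges_adj.1 hw).2 (congrArg SimpleGraph.Dart.edge this)
  have h1 := Set.ncard_le_ncard hsupp (Set.toFinite _)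
  have h2 : (G.support \ {a.fst}).ncard + 1 = G.support.ncard :=
    Set.ncard_sdiff_singleton_add_one ⟨a.snd, a.adj⟩
  have h3 := ih _ (by omega) (P.restrict hle) (hP.restrict hle)
    (fun u v w h h' h'' => hT u v w (hle h) (hle h') (hle h'')) rfl
  omega

end PlaneDrawing

theorem HasNoCycleOfLength.not_triangle {V : Type*} {G : SimpleGraph V}
    (h : HasNoCycleOfLength G 3) {u v w : V} (huv : G.Adj u v) (hvw : G.Adj v w)
    (hwu : G.Adj w u) : False := by
  refine h u (.cons huv (.cons hvw (.cons hwu .nil))) ?_ rfl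
  simp [SimpleGraph.Walk.cons_isCycle_iff, SimpleGraph.Walk.cons_isPath_iff, huv.ne, huv.ne',
    hvw.ne, hwu.ne, hwu.ne']

theorem five_le_rpow : (5 : ℝ) ≤ (2673 / 20 : ℝ) ^ ((1 : ℝ) / 3) := by
  calc (5 : ℝ) = ((5 : ℝ) ^ (3 : ℝ)) ^ ((1 : ℝ) / 3) := by
        rw [← Real.rpow_mul (by norm_num)]; norm_num
    _ ≤ _ := Real.rpow_le_rpow (by positivity) (by norm_num) (by norm_num)

theorem stmt_16 {V : Type} [Fintype V] (G : SimpleGraph V)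
    (hC3 : HasNoCycleOfLength G 3) (hG : KPlanar G 3)
    (hn : 2 ≤ Fintype.card V) :
    (G.edgeSet.ncard : ℝ) ≤
        (2673 / 20 : ℝ) ^ ((1 : ℝ) / 3) * Fintype.card V ∧
      (G.edgeSet.ncard : ℝ) < 5.113 * Fintype.card V := by
  obtain ⟨P, hP⟩ := hG
  have h1 := P.ncard_edgeSet_le hP fun u v w h h' h'' => hC3.not_triangle h h' h''
  have h2 : G.support.ncard ≤ Fintype.card V := by
    rw [← Nat.card_eq_fintype_card]
    exact Set.ncard_le_card _
  have h3 : (G.edgeSet.ncard : ℝ) ≤ 5 * Fintype.card V := by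
    exact_mod_cast h1.trans (Nat.mul_le_mul_left 5 h2)
  have h4 : (2 : ℝ) ≤ Fintype.card V := by exact_mod_cast hn
  constructor
  · exact h3.trans (mul_le_mul_of_nonneg_right five_le_rpow (by linarith))
  · linarith
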